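/- For every integer r ≥ 1 and every σ ≥ 1 there is a constant C > 0 depending only on r and σ such that: for every σ-quasi-uniform rectangular partition P of Ω with mesh size h, every α : Ω → ℝ piecewise constant with respect to P with 0 < α_0 ≤ α ≤ α_1, every u : Ω → ℝ that is continuous, vanishes on ∂Ω, is C^{r+1} on each closed cell, and whose cellwise flux functions α·∂u/∂x and α·∂u/∂y extend continuously to Ω, and every finite volume solution u_P ∈ U_P^r, one has |u − u_P|_1 ≤ C · (α_1 / α_0) · h^r · |u|_{r+1,P}. -/

import Mathlib

open Polynomial MeasureTheory

noncomputable section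

/-- `Leg r` is the `r`-th (formal) derivative of `(X² − 1)^r`, a nonzero scalar
multiple of the degree-`r` Legendre polynomial. -/
def Leg (r : ℕ) : Polynomial ℝ :=
  (fun p => Polynomial.derivative p)^[r] ((Polynomial.X ^ 2 - 1) ^ r)

/-- `G 1 < … < G r` are the Gauss points: the roots of `Leg r`, all in `(-1,1)`. -/
def IsGaussPoints (r : ℕ) (G : ℕ → ℝ) : Prop :=
  (∀ k, 1 ≤ k → k < r → G k < G (k + 1)) ∧
  ∀ k, 1 ≤ k → k ≤ r → G k ∈ Set.Ioo (-1 : ℝ) 1 ∧ (Leg r).IsRoot (G k)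

/-- `A k = ∫_{-1}^{1} ℓ_k` where `ℓ_k` is the Lagrange basis polynomial of degree
`≤ r - 1` at the Gauss points, i.e. `ℓ_k (G j) = δ_{jk}`. -/
def IsGaussWeights (r : ℕ) (G A : ℕ → ℝ) : Prop :=
  ∀ k, 1 ≤ k → k ≤ r → ∃ ℓ : Polynomial ℝ,
    ℓ.natDegree ≤ r - 1 ∧
    (∀ j, 1 ≤ j → j ≤ r → ℓ.eval (G j) = if j = k then 1 else 0) ∧
    A k = ∫ x in (-1 : ℝ)..1, ℓ.eval x

/-- `Lob 0 = −1 < Lob 1 < … < Lob (r−1) < Lob r = 1` are the Lobatto points: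
`±1` together with the roots of the derivative of `Leg r`. -/
def IsLobattoPoints (r : ℕ) (L : ℕ → ℝ) : Prop :=
  L 0 = -1 ∧ L r = 1 ∧ (∀ k < r, L k < L (k + 1)) ∧
  ∀ k, 1 ≤ k → k + 1 ≤ r → L k ∈ Set.Ioo (-1 : ℝ) 1 ∧
    (Polynomial.derivative (Leg r)).IsRoot (L k)

/-- Cellwise partial derivative in the first (`x`) coordinate. -/
def pdx (f : ℝ × ℝ → ℝ) (z : ℝ × ℝ) : ℝ := fderiv ℝ f z (1, 0)

/-- Cellwise partial derivative in the second (`y`) coordinate. -/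
def pdy (f : ℝ × ℝ → ℝ) (z : ℝ × ℝ) : ℝ := fderiv ℝ f z (0, 1)

/-- A rectangular partition of `Ω = [a,b] × [c,d]`:
`a = x₀ < x₁ < … < x_m = b`, `c = y₀ < y₁ < … < y_n = d`. -/
structure RectPartition (a b c d : ℝ) where
  m : ℕ
  n : ℕ
  hm : 0 < m
  hn : 0 < n
  x : ℕ → ℝ
  y : ℕ → ℝ
  hxa : x 0 = a
  hxb : x m = b
  hyc : y 0 = c
  hyd : y n = d
  hxlt : ∀ i < m, x i < x (i + 1)
  hylt : ∀ j < n, y j < y (j + 1)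

namespace RectPartition

variable {a b c d : ℝ}

/-- The domain `Ω = [a,b] × [c,d]`. -/
def dom (_P : RectPartition a b c d) : Set (ℝ × ℝ) := Set.Icc a b ×ˢ Set.Icc c d

/-- The boundary `∂Ω`. -/
def bdry (P : RectPartition a b c d) : Set (ℝ × ℝ) :=
  P.dom \ (Set.Ioo a b ×ˢ Set.Ioo c d)

variable (P : RectPartition a b c d)

/-- Side length `h_i^x = x_i − x_{i−1}`. -/
def hx (i : ℕ) : ℝ := P.x i - P.x (i - 1)

/-- Side length `h_j^y = y_j − y_{j−1}`. -/
def hy (j : ℕ) : ℝ := P.y j - P.y (j - 1)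

/-- The closed cell `τ_{i,j} = [x_{i−1}, x_i] × [y_{j−1}, y_j]`. -/
def cell (i j : ℕ) : Set (ℝ × ℝ) :=
  Set.Icc (P.x (i - 1)) (P.x i) ×ˢ Set.Icc (P.y (j - 1)) (P.y j)

/-- The open cell `(x_{i−1}, x_i) × (y_{j−1}, y_j)`. -/
def openCell (i j : ℕ) : Set (ℝ × ℝ) :=
  Set.Ioo (P.x (i - 1)) (P.x i) ×ˢ Set.Ioo (P.y (j - 1)) (P.y j)

/-- The finite set of all side lengths of the partition. -/
def sides : Finset ℝ := ((Finset.Icc 1 P.m).image P.hx) ∪ ((Finset.Icc 1 P.n).image P.hy)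

lemma sides_nonempty : P.sides.Nonempty :=
  ⟨P.hx 1, Finset.mem_union_left _
    (Finset.mem_image_of_mem _ (Finset.mem_Icc.mpr ⟨le_rfl, P.hm⟩))⟩

/-- The mesh size `h`: the largest side length. -/
def meshSize : ℝ := P.sides.max' P.sides_nonempty

/-- `σ`-quasi-uniformity: every side length is at most `σ` times any other,
i.e. `h ≤ σ · min side`. -/
def QuasiUniform (σ : ℝ) : Prop := ∀ s ∈ P.sides, ∀ t ∈ P.sides, s ≤ σ * t

variable (r : ℕ) (G : ℕ → ℝ)

/-- The Gauss point `g^x_{i,k} = (x_i + x_{i−1} + h_i^x G_k)/2` for `1 ≤ k ≤ r`,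
with the conventions `g^x_{i,r+1} = g^x_{i+1,1}` (for `i < m`) and `g^x_{m,r+1} = b`. -/
def gx (i k : ℕ) : ℝ :=
  if k = r + 1 then
    (if i = P.m then P.x P.m
     else (P.x (i + 1) + P.x i + P.hx (i + 1) * G 1) / 2)
  else (P.x i + P.x (i - 1) + P.hx i * G k) / 2

/-- The Gauss point `g^y_{j,l}`, with the analogous conventions. -/
def gy (j l : ℕ) : ℝ :=
  if l = r + 1 then
    (if j = P.n then P.y P.n
     else (P.y (j + 1) + P.y j + P.hy (j + 1) * G 1) / 2)
  else (P.y j + P.y (j - 1) + P.hy j * G l) / 2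

end RectPartition

/-- A function on `Ω` which is piecewise smooth with respect to the partition:
a global function together with, for each cell, a (smooth) extension of its
restriction to the closed cell; cellwise derivatives are derivatives of the
cell functions. -/
structure PiecewiseFun {a b c d : ℝ} (P : RectPartition a b c d) where
  toFun : ℝ × ℝ → ℝ
  cellFun : ℕ → ℕ → ℝ × ℝ → ℝ
  agree : ∀ i ∈ Finset.Icc 1 P.m, ∀ j ∈ Finset.Icc 1 P.n, ∀ z ∈ P.cell i j,
    cellFun i j z = toFun z

namespace PiecewiseFun

variable {a b c d : ℝ} {P : RectPartition a b c d}

/-- Difference of two piecewise functions. -/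
def sub (u v : PiecewiseFun P) : PiecewiseFun P where
  toFun := fun z => u.toFun z - v.toFun z
  cellFun := fun i j z => u.cellFun i j z - v.cellFun i j z
  agree := fun i hi j hj z hz => by
    simp only [u.agree i hi j hj z hz, v.agree i hi j hj z hz]

end PiecewiseFun

/-- Cellwise `∂/∂x` of a piecewise function. -/
def cellDx {a b c d : ℝ} {P : RectPartition a b c d} (v : PiecewiseFun P) :
    ℕ → ℕ → ℝ × ℝ → ℝ := fun i j => pdx (v.cellFun i j)

/-- Cellwise `∂/∂y` of a piecewise function. -/
def cellDy {a b c d : ℝ} {P : RectPartition a b c d} (v : PiecewiseFun P) :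
    ℕ → ℕ → ℝ × ℝ → ℝ := fun i j => pdy (v.cellFun i j)

/-- `v` is `C^s` on each closed cell. -/
def CellSmooth {a b c d : ℝ} (P : RectPartition a b c d) (s : ℕ)
    (u : PiecewiseFun P) : Prop :=
  ∀ i ∈ Finset.Icc 1 P.m, ∀ j ∈ Finset.Icc 1 P.n, ContDiff ℝ s (u.cellFun i j)

/-- Evaluation of a bivariate polynomial (outer variable ↦ `x`, coefficients are
polynomials in `y`). -/
def evalXY (p : Polynomial (Polynomial ℝ)) (x y : ℝ) : ℝ :=
  (p.map (Polynomial.evalRingHom y)).eval x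

/-- `f` is (globally) a polynomial of degree `≤ r` in each of the two variables. -/
def IsBiPoly (r : ℕ) (f : ℝ × ℝ → ℝ) : Prop :=
  ∃ p : Polynomial (Polynomial ℝ), p.natDegree ≤ r ∧ (∀ k, (p.coeff k).natDegree ≤ r) ∧
    ∀ x y : ℝ, f (x, y) = evalXY p x y

/-- Membership in the trial space `U_P^r`: continuous on `Ω`, vanishing on `∂Ω`,
and a bi-degree `≤ r` polynomial on each cell. -/
def IsTrialFun {a b c d : ℝ} (r : ℕ) (P : RectPartition a b c d)
    (v : PiecewiseFun P) : Prop :=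
  ContinuousOn v.toFun P.dom ∧ (∀ z ∈ P.bdry, v.toFun z = 0) ∧
  ∀ i ∈ Finset.Icc 1 P.m, ∀ j ∈ Finset.Icc 1 P.n, IsBiPoly r (v.cellFun i j)

/-- The coefficients of a test function extended by the conventions
`w_{i,0;j,l} = w_{i−1,r;j,l}` (`0` if `i = 1`) and
`w_{i,k;j,0} = w_{i,k;j−1,r}` (`0` if `j = 1`). -/
def wE (r : ℕ) (w : ℕ → ℕ → ℕ → ℕ → ℝ) (i k j l : ℕ) : ℝ :=
  if (k = 0 ∧ i = 1) ∨ (l = 0 ∧ j = 1) then 0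
  else
    w (if k = 0 then i - 1 else i) (if k = 0 then r else k)
      (if l = 0 then j - 1 else j) (if l = 0 then r else l)

/-- The jump `[w]^x_{i,k;j,l} = w_{i,k;j,l} − w_{i,k−1;j,l}`. -/
def jumpX (r : ℕ) (w : ℕ → ℕ → ℕ → ℕ → ℝ) (i k j l : ℕ) : ℝ :=
  wE r w i k j l - wE r w i (k - 1) j l

/-- The jump `[w]^y_{i,k;j,l} = w_{i,k;j,l} − w_{i,k;j,l−1}`. -/
def jumpY (r : ℕ) (w : ℕ → ℕ → ℕ → ℕ → ℝ) (i k j l : ℕ) : ℝ :=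
  wE r w i k j l - wE r w i k j (l - 1)

/-- The double jump `⌊w⌋_{i,k;j,l}`. -/
def jumpXY (r : ℕ) (w : ℕ → ℕ → ℕ → ℕ → ℝ) (i k j l : ℕ) : ℝ :=
  wE r w i k j l - wE r w i (k - 1) j l - wE r w i k j (l - 1) + wE r w i (k - 1) j (l - 1)

/-- A test function: coefficients `w_{i,k;j,l}`, `1 ≤ i ≤ m`, `1 ≤ k ≤ r`,
`1 ≤ j ≤ n`, `1 ≤ l ≤ r`, vanishing for `(i,k) = (m,r)` or `(j,l) = (n,r)`. -/
def IsTestFun {a b c d : ℝ} (r : ℕ) (P : RectPartition a b c d)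
    (w : ℕ → ℕ → ℕ → ℕ → ℝ) : Prop :=
  (∀ j ∈ Finset.Icc 1 P.n, ∀ l ∈ Finset.Icc 1 r, w P.m r j l = 0) ∧
  (∀ i ∈ Finset.Icc 1 P.m, ∀ k ∈ Finset.Icc 1 r, w i k P.n r = 0)

/-- The index set `X`: quadruples `(i,k,j,l)` with `(j,l) ≠ (n,r)`. -/
def idxX {a b c d : ℝ} (r : ℕ) (P : RectPartition a b c d) : Finset (ℕ × ℕ × ℕ × ℕ) :=
  (Finset.Icc 1 P.m ×ˢ Finset.Icc 1 r ×ˢ Finset.Icc 1 P.n ×ˢ Finset.Icc 1 r).filter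
    fun q => ¬(q.2.2.1 = P.n ∧ q.2.2.2 = r)

/-- The index set `Y`: quadruples `(i,k,j,l)` with `(i,k) ≠ (m,r)`. -/
def idxY {a b c d : ℝ} (r : ℕ) (P : RectPartition a b c d) : Finset (ℕ × ℕ × ℕ × ℕ) :=
  (Finset.Icc 1 P.m ×ˢ Finset.Icc 1 r ×ˢ Finset.Icc 1 P.n ×ˢ Finset.Icc 1 r).filter
    fun q => ¬(q.1 = P.m ∧ q.2.1 = r)

/-- The index set of interior dual volumes: `(i,k) ≠ (m,r)` and `(j,l) ≠ (n,r)`. -/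
def idxZ {a b c d : ℝ} (r : ℕ) (P : RectPartition a b c d) : Finset (ℕ × ℕ × ℕ × ℕ) :=
  (Finset.Icc 1 P.m ×ˢ Finset.Icc 1 r ×ˢ Finset.Icc 1 P.n ×ˢ Finset.Icc 1 r).filter
    fun q => ¬(q.1 = P.m ∧ q.2.1 = r) ∧ ¬(q.2.2.1 = P.n ∧ q.2.2.2 = r)

/-- The dual-mesh seminorm `|w|_{P'}`. -/
def dualSemi {a b c d : ℝ} (r : ℕ) (P : RectPartition a b c d)
    (w : ℕ → ℕ → ℕ → ℕ → ℝ) : ℝ :=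
  Real.sqrt
    ((∑ q ∈ idxX r P, (jumpX r w q.1 q.2.1 q.2.2.1 q.2.2.2) ^ 2) +
     (∑ q ∈ idxY r P, (jumpY r w q.1 q.2.1 q.2.2.1 q.2.2.2) ^ 2))

/-- The FVM bilinear form `a_P(v, w)`, with the cellwise derivatives of `v`
given by `Dxv i j` and `Dyv i j` on cell `(i,j)`.  The integrals along Gauss
lines are split at the cell interfaces `y = y_j` (resp. `x = x_i`), which only
matters for the last Gauss subinterval `l = r` (resp. `k = r`). -/
def aP {a b c d : ℝ} (r : ℕ) (G : ℕ → ℝ) (P : RectPartition a b c d)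
    (α : ℝ × ℝ → ℝ) (Dxv Dyv : ℕ → ℕ → ℝ × ℝ → ℝ) (w : ℕ → ℕ → ℕ → ℕ → ℝ) : ℝ :=
  (∑ q ∈ idxX r P,
    jumpX r w q.1 q.2.1 q.2.2.1 q.2.2.2 *
      ((∫ t in (P.gy r G q.2.2.1 q.2.2.2)..(min (P.gy r G q.2.2.1 (q.2.2.2 + 1)) (P.y q.2.2.1)),
          α (P.gx r G q.1 q.2.1, t) * Dxv q.1 q.2.2.1 (P.gx r G q.1 q.2.1, t)) +
       (∫ t in (P.y q.2.2.1)..(max (P.gy r G q.2.2.1 (q.2.2.2 + 1)) (P.y q.2.2.1)),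
          α (P.gx r G q.1 q.2.1, t) * Dxv q.1 (q.2.2.1 + 1) (P.gx r G q.1 q.2.1, t)))) +
  (∑ q ∈ idxY r P,
    jumpY r w q.1 q.2.1 q.2.2.1 q.2.2.2 *
      ((∫ t in (P.gx r G q.1 q.2.1)..(min (P.gx r G q.1 (q.2.1 + 1)) (P.x q.1)),
          α (t, P.gy r G q.2.2.1 q.2.2.2) * Dyv q.1 q.2.2.1 (t, P.gy r G q.2.2.1 q.2.2.2)) +
       (∫ t in (P.x q.1)..(max (P.gx r G q.1 (q.2.1 + 1)) (P.x q.1)),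
          α (t, P.gy r G q.2.2.1 q.2.2.2) * Dyv (q.1 + 1) q.2.2.1 (t, P.gy r G q.2.2.1 q.2.2.2))))

/-- The broken `H¹` seminorm `|v|₁` computed cellwise. -/
def semiH1 {a b c d : ℝ} (P : RectPartition a b c d) (v : PiecewiseFun P) : ℝ :=
  Real.sqrt (∑ i ∈ Finset.Icc 1 P.m, ∑ j ∈ Finset.Icc 1 P.n,
    ∫ z in P.cell i j, ((cellDx v i j z) ^ 2 + (cellDy v i j z) ^ 2))

/-- The mesh-dependent seminorm `|v|_P` (broken `H²`-type seminorm). -/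
def semiP {a b c d : ℝ} (P : RectPartition a b c d) (v : PiecewiseFun P) : ℝ :=
  Real.sqrt (∑ i ∈ Finset.Icc 1 P.m, ∑ j ∈ Finset.Icc 1 P.n,
    ((∫ z in P.cell i j, ((cellDx v i j z) ^ 2 + (cellDy v i j z) ^ 2)) +
      (P.hx i ^ 2 + P.hy j ^ 2) *
        ∫ z in P.cell i j,
          ((pdx (pdx (v.cellFun i j)) z) ^ 2 + 2 * (pdy (pdx (v.cellFun i j)) z) ^ 2 +
            (pdy (pdy (v.cellFun i j)) z) ^ 2)))

/-- The broken seminorm `|u|_{s,P}`. -/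
def brokenSemi {a b c d : ℝ} (P : RectPartition a b c d) (u : PiecewiseFun P) (s : ℕ) : ℝ :=
  Real.sqrt (∑ i ∈ Finset.Icc 1 P.m, ∑ j ∈ Finset.Icc 1 P.n, ∑ t ∈ Finset.range (s + 1),
    ∫ z in P.cell i j, (pdx^[t] (pdy^[s - t] (u.cellFun i j)) z) ^ 2)

/-- The broken norm `‖u‖_{s,P} = (Σ_{t=0}^{s} |u|_{t,P}²)^{1/2}`. -/
def brokenNorm {a b c d : ℝ} (P : RectPartition a b c d) (u : PiecewiseFun P) (s : ℕ) : ℝ :=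
  Real.sqrt (∑ t ∈ Finset.range (s + 1), (brokenSemi P u t) ^ 2)

/-- `w = Πv`: the test function determined by the double-jump constraints
`⌊Πv⌋_{i,k;j,l} = A^x_{i,k} A^y_{j,l} ∂²v/∂x∂y(g^x_{i,k}, g^y_{j,l})`. -/
def IsPiOf {a b c d : ℝ} (r : ℕ) (G A : ℕ → ℝ) (P : RectPartition a b c d)
    (v : PiecewiseFun P) (w : ℕ → ℕ → ℕ → ℕ → ℝ) : Prop :=
  IsTestFun r P w ∧
  ∀ i ∈ Finset.Icc 1 P.m, ∀ k ∈ Finset.Icc 1 r, ∀ j ∈ Finset.Icc 1 P.n, ∀ l ∈ Finset.Icc 1 r,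
    ¬(i = P.m ∧ k = r) → ¬(j = P.n ∧ l = r) →
    jumpXY r w i k j l =
      (P.hx i * A k / 2) * (P.hy j * A l / 2) *
        pdy (pdx (v.cellFun i j)) (P.gx r G i k, P.gy r G j l)

/-- `α` is piecewise constant with respect to `P`. -/
def PiecewiseConstant {a b c d : ℝ} (P : RectPartition a b c d) (α : ℝ × ℝ → ℝ) : Prop :=
  ∀ i ∈ Finset.Icc 1 P.m, ∀ j ∈ Finset.Icc 1 P.n, ∃ cst : ℝ, ∀ z ∈ P.openCell i j, α z = cst

/-- The cellwise fluxes `α ∂u/∂x`, `α ∂u/∂y` extend continuously to `Ω`. -/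
def FluxContinuous {a b c d : ℝ} (P : RectPartition a b c d) (α : ℝ × ℝ → ℝ)
    (u : PiecewiseFun P) : Prop :=
  ∃ Fx Fy : ℝ × ℝ → ℝ, ContinuousOn Fx P.dom ∧ ContinuousOn Fy P.dom ∧
    ∀ i ∈ Finset.Icc 1 P.m, ∀ j ∈ Finset.Icc 1 P.n, ∀ z ∈ P.openCell i j,
      Fx z = α z * cellDx u i j z ∧ Fy z = α z * cellDy u i j z

/-- The iterated integral of `f` over the rectangle `[x₁,x₂] × [y₁,y₂]`. -/
def rectInt (f : ℝ × ℝ → ℝ) (x₁ x₂ y₁ y₂ : ℝ) : ℝ :=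
  ∫ s in x₁..x₂, ∫ t in y₁..y₂, f (s, t)

/-- The integral over the dual volume `τ'_{i,k;j,l} = [g^x_{i,k}, g^x_{i,k+1}] ×
[g^y_{j,l}, g^y_{j,l+1}]` of a cellwise-defined integrand `F i j`, split along
the cell interfaces `x = x_i` and `y = y_j`. -/
def dualCellInt {a b c d : ℝ} (r : ℕ) (G : ℕ → ℝ) (P : RectPartition a b c d)
    (F : ℕ → ℕ → ℝ × ℝ → ℝ) (i k j l : ℕ) : ℝ :=
  rectInt (F i j) (P.gx r G i k) (min (P.gx r G i (k + 1)) (P.x i))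
    (P.gy r G j l) (min (P.gy r G j (l + 1)) (P.y j)) +
  rectInt (F (i + 1) j) (P.x i) (max (P.gx r G i (k + 1)) (P.x i))
    (P.gy r G j l) (min (P.gy r G j (l + 1)) (P.y j)) +
  rectInt (F i (j + 1)) (P.gx r G i k) (min (P.gx r G i (k + 1)) (P.x i))
    (P.y j) (max (P.gy r G j (l + 1)) (P.y j)) +
  rectInt (F (i + 1) (j + 1)) (P.x i) (max (P.gx r G i (k + 1)) (P.x i))
    (P.y j) (max (P.gy r G j (l + 1)) (P.y j))

/-- The cellwise source term `f = −α (∂²u/∂x² + ∂²u/∂y²)` (for piecewise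
constant `α`). -/
def cellSource {a b c d : ℝ} {P : RectPartition a b c d} (α : ℝ × ℝ → ℝ)
    (u : PiecewiseFun P) (i j : ℕ) (z : ℝ × ℝ) : ℝ :=
  -(α z * (pdx (pdx (u.cellFun i j)) z + pdy (pdy (u.cellFun i j)) z))

/-- The right-hand side `Σ w_{i,k;j,l} ∫_{τ'_{i,k;j,l}} f` of the FV scheme. -/
def fvRHS {a b c d : ℝ} (r : ℕ) (G : ℕ → ℝ) (P : RectPartition a b c d)
    (α : ℝ × ℝ → ℝ) (u : PiecewiseFun P) (w : ℕ → ℕ → ℕ → ℕ → ℝ) : ℝ :=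
  ∑ q ∈ idxZ r P, w q.1 q.2.1 q.2.2.1 q.2.2.2 *
    dualCellInt r G P (cellSource α u) q.1 q.2.1 q.2.2.1 q.2.2.2

/-- `uP` is a finite volume solution for the exact solution `u`. -/
def IsFVSolution {a b c d : ℝ} (r : ℕ) (G : ℕ → ℝ) (P : RectPartition a b c d)
    (α : ℝ × ℝ → ℝ) (u uP : PiecewiseFun P) : Prop :=
  IsTrialFun r P uP ∧
  ∀ w, IsTestFun r P w → aP r G P α (cellDx uP) (cellDy uP) w = fvRHS r G P α u w

/-- The Lobatto node in cell `(i,j)` with 0-based indices `0 ≤ k, l ≤ r`. -/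
def lobattoNode {a b c d : ℝ} (P : RectPartition a b c d) (L : ℕ → ℝ)
    (i j k l : ℕ) : ℝ × ℝ :=
  ((P.x (i - 1) + P.x i + P.hx i * L k) / 2, (P.y (j - 1) + P.y j + P.hy j * L l) / 2)

/-- `uI` is the Lobatto interpolant of `u` in the trial space `U_P^r`. -/
def IsLobattoInterp {a b c d : ℝ} (r : ℕ) (L : ℕ → ℝ) (P : RectPartition a b c d)
    (u : ℝ × ℝ → ℝ) (uI : PiecewiseFun P) : Prop :=
  IsTrialFun r P uI ∧
  ∀ i ∈ Finset.Icc 1 P.m, ∀ j ∈ Finset.Icc 1 P.n,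
    ∀ k ∈ Finset.Icc 0 r, ∀ l ∈ Finset.Icc 0 r,
      uI.toFun (lobattoNode P L i j k l) = u (lobattoNode P L i j k l)

/-- The piecewise oscillation `osc_P(α)`: the maximum over all cells of
`ess sup α − ess inf α`. -/
def oscP {a b c d : ℝ} (P : RectPartition a b c d) (α : ℝ × ℝ → ℝ) : ℝ :=
  (Finset.Icc 1 P.m ×ˢ Finset.Icc 1 P.n).sup'
    (Finset.Nonempty.product (Finset.nonempty_Icc.mpr P.hm) (Finset.nonempty_Icc.mpr P.hn))
    fun p => essSup α (volume.restrict (P.cell p.1 p.2)) -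
      essInf α (volume.restrict (P.cell p.1 p.2))

end

/-! ### Gauss quadrature on `[-1, 1]` -/

lemma Polynomial.intervalIntegrable_eval (p : ℝ[X]) (a b : ℝ) :
    IntervalIntegrable (fun x => p.eval x) volume a b :=
  p.continuous.intervalIntegrable a b

lemma Polynomial.exists_derivative_eq (q : ℝ[X]) :
    ∃ p : ℝ[X], derivative p = q ∧ p.natDegree ≤ q.natDegree + 1 := by
  refine ⟨∑ k ∈ Finset.range (q.natDegree + 1), C (q.coeff k / (k + 1)) * X ^ (k + 1), ?_, ?_⟩
  · rw [derivative_sum]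
    conv_rhs => rw [q.as_sum_range_C_mul_X_pow]
    refine Finset.sum_congr rfl fun k _ => ?_
    rw [derivative_C_mul_X_pow]
    congr 2
    have : (k : ℝ) + 1 ≠ 0 := by positivity
    push_cast
    field_simp
  · refine natDegree_sum_le_of_forall_le _ _ fun k hk => ?_
    have := Finset.mem_range.mp hk
    exact (natDegree_C_mul_X_pow_le _ _).trans (by omega)

lemma Polynomial.integral_eval_derivative (p : ℝ[X]) (a b : ℝ) :
    ∫ x in a..b, (derivative p).eval x = p.eval b - p.eval a :=
  intervalIntegral.integral_eq_sub_of_hasDerivAt (fun x _ => p.hasDerivAt x)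
    ((derivative p).intervalIntegrable_eval a b)

lemma Polynomial.integral_mul_derivative (p q : ℝ[X]) (a b : ℝ) :
    ∫ x in a..b, (p * derivative q).eval x =
      p.eval b * q.eval b - p.eval a * q.eval a - ∫ x in a..b, (derivative p * q).eval x := by
  simp only [eval_mul]
  exact intervalIntegral.integral_mul_deriv_eq_deriv_mul (fun x _ => p.hasDerivAt x)
    (fun x _ => q.hasDerivAt x) (p.derivative.intervalIntegrable_eval a b)
    (q.derivative.intervalIntegrable_eval a b)

lemma Polynomial.integral_eval_add (p q : ℝ[X]) (a b : ℝ) :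
    ∫ x in a..b, (p + q).eval x = (∫ x in a..b, p.eval x) + ∫ x in a..b, q.eval x := by
  simp only [eval_add]
  exact intervalIntegral.integral_add (p.intervalIntegrable_eval a b)
    (q.intervalIntegrable_eval a b)

lemma Polynomial.integral_eval_C_mul (c : ℝ) (p : ℝ[X]) (a b : ℝ) :
    ∫ x in a..b, (C c * p).eval x = c * ∫ x in a..b, p.eval x := by
  simp only [eval_mul, eval_C]
  exact intervalIntegral.integral_const_mul _ _

lemma Polynomial.integral_eval_sum {ι : Type*} (s : Finset ι) (p : ι → ℝ[X]) (a b : ℝ) :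
    ∫ x in a..b, (∑ i ∈ s, p i).eval x = ∑ i ∈ s, ∫ x in a..b, (p i).eval x := by
  simp only [eval_finsetSum]
  exact intervalIntegral.integral_finsetSum fun i _ => (p i).intervalIntegrable_eval a b

lemma Polynomial.integral_sq_pos {p : ℝ[X]} (hp : p ≠ 0) {a b : ℝ} (hab : a < b) :
    0 < ∫ x in a..b, (p ^ 2).eval x := by
  obtain ⟨x, hx, hpx⟩ : ∃ x ∈ Set.Icc a b, p.eval x ≠ 0 := by
    by_contra! h
    exact hp (Polynomial.eq_zero_of_infinite_isRoot p
      ((Set.Icc_infinite hab).mono fun x hx => h x hx))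
  refine intervalIntegral.integral_pos hab (p ^ 2).continuous.continuousOn
    (fun x _ => by rw [eval_pow]; positivity) ⟨x, hx, ?_⟩
  rw [eval_pow]
  positivity

lemma Polynomial.integral_sq_nonneg (p : ℝ[X]) {a b : ℝ} (hab : a ≤ b) :
    0 ≤ ∫ x in a..b, (p ^ 2).eval x :=
  intervalIntegral.integral_nonneg hab fun x _ => by rw [eval_pow]; positivity

lemma natDegree_X_sq_sub_one_pow (r : ℕ) : ((X ^ 2 - 1 : ℝ[X]) ^ r).natDegree = 2 * r := by
  rw [natDegree_pow, ← C_1, natDegree_X_pow_sub_C, mul_comm]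

lemma natDegree_Leg (r : ℕ) : (Leg r).natDegree = r := by
  have hlead : ((X ^ 2 - 1 : ℝ[X]) ^ r).coeff (r + r) = 1 := by
    have h := (monic_X_pow_sub_C (1 : ℝ) (two_ne_zero)).pow r
    rw [C_1, Monic, leadingCoeff, natDegree_X_sq_sub_one_pow] at h
    rwa [← two_mul]
  refine le_antisymm ?_ ?_
  · refine (natDegree_iterate_derivative _ _).trans ?_
    rw [natDegree_X_sq_sub_one_pow]
    omega
  · refine le_natDegree_of_ne_zero ?_
    change ((derivative)^[r] ((X ^ 2 - 1 : ℝ[X]) ^ r)).coeff r ≠ 0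
    rw [coeff_iterate_derivative, hlead, nsmul_eq_mul, mul_one, Nat.cast_ne_zero, Ne,
      Nat.descFactorial_eq_zero_iff_lt]
    omega

lemma Leg_ne_zero {r : ℕ} (hr : 1 ≤ r) : Leg r ≠ 0 := fun h => by
  have := natDegree_Leg r
  rw [h, natDegree_zero] at this
  omega

lemma integral_iterate_derivative_mul_eq_zero (r : ℕ) :
    ∀ m ≤ r, ∀ q : ℝ[X], derivative^[m] q = 0 →
      ∫ x in (-1 : ℝ)..1, (q * derivative^[m] ((X ^ 2 - 1 : ℝ[X]) ^ r)).eval x = 0 := by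
  intro m
  induction m with
  | zero => intro _ q hq; simp only [Function.iterate_zero, id] at hq; simp [hq]
  | succ m ih =>
    intro hm q hq
    have hdvd := pow_sub_dvd_iterate_derivative_pow (X ^ 2 - 1 : ℝ[X]) r m
    have hroot : ∀ c : ℝ, c ^ 2 = 1 →
        (derivative^[m] ((X ^ 2 - 1 : ℝ[X]) ^ r)).eval c = 0 := by
      intro c hc
      obtain ⟨s, hs⟩ := hdvd
      rw [hs, eval_mul, eval_pow, eval_sub, eval_pow, eval_X, eval_one, hc, sub_self,
        zero_pow (by omega), zero_mul]
    rw [Function.iterate_succ_apply', Polynomial.integral_mul_derivative,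
      hroot 1 (by norm_num), hroot (-1) (by norm_num), ih (by omega) (derivative q)
        (by rwa [← Function.iterate_succ_apply])]
    ring

lemma integral_mul_Leg_eq_zero {r : ℕ} {q : ℝ[X]} (hq : q.natDegree < r) :
    ∫ x in (-1 : ℝ)..1, (q * Leg r).eval x = 0 :=
  integral_iterate_derivative_mul_eq_zero r r le_rfl q (iterate_derivative_eq_zero hq)

lemma IsGaussPoints.injOn {r : ℕ} {G : ℕ → ℝ} (hG : IsGaussPoints r G) :
    Set.InjOn G (Finset.Icc 1 r) := by
  have key : ∀ d k, 1 ≤ k → k + d + 1 ≤ r → G k < G (k + d + 1) := by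
    intro d
    induction d with
    | zero => intro k hk h; exact hG.1 k hk (by omega)
    | succ d ih =>
      intro k hk h
      exact (ih k hk (by omega)).trans (hG.1 (k + d + 1) (by omega) (by omega))
  intro k hk l hl hkl
  simp only [Finset.coe_Icc, Set.mem_Icc] at hk hl
  rcases lt_trichotomy k l with h | h | h
  · have := key (l - k - 1) k hk.1 (by omega)
    rw [show k + (l - k - 1) + 1 = l by omega, hkl] at this
    exact absurd this (lt_irrefl _)
  · exact h
  · have := key (k - l - 1) l hl.1 (by omega)
    rw [show l + (k - l - 1) + 1 = k by omega, hkl] at this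
    exact absurd this (lt_irrefl _)

lemma IsGaussPoints.eval_eq_zero {r : ℕ} {G : ℕ → ℝ} (hG : IsGaussPoints r G) {k : ℕ}
    (hk : k ∈ Finset.Icc 1 r) : (Leg r).eval (G k) = 0 :=
  (hG.2 k (Finset.mem_Icc.mp hk).1 (Finset.mem_Icc.mp hk).2).2

/-- The quadrature weights `A` are positive and integrate polynomials of degree `≤ 2r - 1`
exactly. -/
structure IsGaussRule (r : ℕ) (G A : ℕ → ℝ) : Prop where
  pos : ∀ k ∈ Finset.Icc 1 r, 0 < A k
  exact : ∀ f : ℝ[X], f.natDegree < 2 * r →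
    ∑ k ∈ Finset.Icc 1 r, A k * f.eval (G k) = ∫ x in (-1 : ℝ)..1, f.eval x

lemma IsGaussPoints.exists_isGaussRule {r : ℕ} (hr : 1 ≤ r) {G : ℕ → ℝ}
    (hG : IsGaussPoints r G) : ∃ A, IsGaussRule r G A := by
  set ℓ := fun k => Lagrange.basis (Finset.Icc 1 r) G k with hℓ
  set A := fun k => ∫ x in (-1 : ℝ)..1, (ℓ k).eval x with hA
  have hlow : ∀ s : ℝ[X], s.natDegree < r →
      ∑ k ∈ Finset.Icc 1 r, A k * s.eval (G k) = ∫ x in (-1 : ℝ)..1, s.eval x := by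
    intro s hs
    have h := Lagrange.eq_interpolate_of_eval_eq (f := s) (fun k => s.eval (G k)) hG.injOn
      (lt_of_le_of_lt degree_le_natDegree (by simpa using hs)) fun _ _ => rfl
    rw [Lagrange.interpolate_apply] at h
    conv_rhs => rw [h, Polynomial.integral_eval_sum]
    refine Finset.sum_congr rfl fun k _ => ?_
    rw [Polynomial.integral_eval_C_mul, mul_comm]
  have hexact : ∀ f : ℝ[X], f.natDegree < 2 * r →
      ∑ k ∈ Finset.Icc 1 r, A k * f.eval (G k) = ∫ x in (-1 : ℝ)..1, f.eval x := by
    intro f hf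
    have hdiv : (f / Leg r).natDegree < r := by
      by_cases h0 : f / Leg r = 0
      · rw [h0, natDegree_zero]; omega
      · have h1 := degree_add_div (p := f) (q := Leg r) (Leg_ne_zero hr)
          (by
            by_contra! h
            exact h0 ((Polynomial.div_eq_zero_iff (Leg_ne_zero hr)).mpr h))
        rw [degree_eq_natDegree h0, degree_eq_natDegree (Leg_ne_zero hr), natDegree_Leg] at h1
        have h2 : ((r + (f / Leg r).natDegree : ℕ) : WithBot ℕ) ≤ f.natDegree := by
          push_cast
          rw [h1]
          exact degree_le_natDegree
        have := Nat.cast_le.mp h2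
        omega
    have hmod : (f % Leg r).natDegree < r := by
      have := natDegree_mod_lt f (q := Leg r) (by rw [natDegree_Leg]; omega)
      rwa [natDegree_Leg] at this
    have hf' : f = f / Leg r * Leg r + f % Leg r := by
      rw [mul_comm]; exact (EuclideanDomain.div_add_mod f (Leg r)).symm
    conv_rhs => rw [hf', Polynomial.integral_eval_add, integral_mul_Leg_eq_zero hdiv, zero_add,
      ← hlow _ hmod]
    refine Finset.sum_congr rfl fun k hk => ?_
    conv_lhs => rw [hf', eval_add, eval_mul, hG.eval_eq_zero hk, mul_zero, zero_add]
  refine ⟨A, fun k hk => ?_, hexact⟩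
  have hdeg : (ℓ k).natDegree = r - 1 := by
    have := Lagrange.degree_basis hG.injOn hk
    rw [Nat.card_Icc, add_tsub_cancel_right] at this
    exact natDegree_eq_of_degree_eq_some this
  have h := hexact (ℓ k ^ 2) (by rw [natDegree_pow, hdeg]; omega)
  have hself : (ℓ k).eval (G k) = 1 := Lagrange.eval_basis_self hG.injOn hk
  rw [Finset.sum_eq_single_of_mem k hk, eval_pow, hself, one_pow, mul_one] at h
  · rw [h]
    refine Polynomial.integral_sq_pos (fun h0 => ?_) (by norm_num)
    rw [h0, eval_zero] at hself
    exact zero_ne_one hself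
  · intro l hl hlk
    have : (ℓ k).eval (G l) = 0 := Lagrange.eval_basis_of_ne hlk.symm hl
    rw [eval_pow, this]
    simp

/-- In degree `2r` the Gauss rule underestimates integrals of polynomials with nonnegative
leading coefficient. -/
lemma IsGaussRule.sum_le_integral {r : ℕ} {G A : ℕ → ℝ}
    (hG : IsGaussPoints r G) (hA : IsGaussRule r G A) (hr : 1 ≤ r) {f : ℝ[X]}
    (hf : f.natDegree ≤ 2 * r) (hc : 0 ≤ f.coeff (2 * r)) :
    ∑ k ∈ Finset.Icc 1 r, A k * f.eval (G k) ≤ ∫ x in (-1 : ℝ)..1, f.eval x := by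
  set c := f.coeff (2 * r) / (Leg r).leadingCoeff ^ 2 with hcdef
  have hlead : (Leg r).leadingCoeff ≠ 0 := leadingCoeff_ne_zero.mpr (Leg_ne_zero hr)
  have hdegsq : (Leg r ^ 2).natDegree = 2 * r := by rw [natDegree_pow, natDegree_Leg]
  have hcoeffsq : (Leg r ^ 2).coeff (2 * r) = (Leg r).leadingCoeff ^ 2 := by
    rw [← hdegsq, coeff_natDegree, leadingCoeff_pow]
  set s := f - C c * Leg r ^ 2 with hs
  have hsdeg : s.natDegree < 2 * r := by
    have hle : s.natDegree ≤ 2 * r :=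
      (natDegree_sub_le _ _).trans (max_le hf ((natDegree_C_mul_le _ _).trans hdegsq.le))
    refine lt_of_le_of_ne hle fun h => ?_
    have h0 : s.coeff (2 * r) = 0 := by
      rw [hs, coeff_sub, coeff_C_mul, hcoeffsq, hcdef]
      field_simp
      simp
    rw [← h, coeff_natDegree, leadingCoeff_eq_zero] at h0
    rw [h0, natDegree_zero] at h
    omega
  have hfs : f = s + C c * Leg r ^ 2 := by rw [hs]; ring
  have hintegral : ∫ x in (-1 : ℝ)..1, f.eval x
      = (∫ x in (-1 : ℝ)..1, s.eval x) + c * ∫ x in (-1 : ℝ)..1, (Leg r ^ 2).eval x := by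
    conv_lhs => rw [hfs, Polynomial.integral_eval_add, Polynomial.integral_eval_C_mul]
  have hsum : ∑ k ∈ Finset.Icc 1 r, A k * f.eval (G k)
      = ∑ k ∈ Finset.Icc 1 r, A k * s.eval (G k) := by
    refine Finset.sum_congr rfl fun k hk => ?_
    rw [hfs, eval_add, eval_mul, eval_pow, hG.eval_eq_zero hk]
    simp
  rw [hintegral, hsum, hA.exact s hsdeg]
  have := Polynomial.integral_sq_nonneg (Leg r) (a := -1) (b := 1) (by norm_num)
  have hc0 : 0 ≤ c := by positivity
  nlinarith [mul_nonneg hc0 this]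

/-- Linear functionals on polynomials of degree `≤ r` are bounded in the `L²(-1,1)` norm. -/
lemma IsGaussRule.exists_abs_le {r : ℕ} {G A : ℕ → ℝ}
    (hG : IsGaussPoints r G) (hA : IsGaussRule r G A) (hr : 1 ≤ r) (φ : ℝ[X] →ₗ[ℝ] ℝ) :
    ∃ K : ℝ, 0 ≤ K ∧ ∀ p : ℝ[X], p.natDegree ≤ r →
      |φ p| ≤ K * √(∫ x in (-1 : ℝ)..1, (p ^ 2).eval x) := by
  have hN : 0 < ∫ x in (-1 : ℝ)..1, (Leg r ^ 2).eval x :=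
    Polynomial.integral_sq_pos (Leg_ne_zero hr) (by norm_num)
  set N := ∫ x in (-1 : ℝ)..1, (Leg r ^ 2).eval x with hNdef
  set ℓ := fun k => Lagrange.basis (Finset.Icc 1 r) G k with hℓ
  refine ⟨|φ (Leg r)| / √N + ∑ k ∈ Finset.Icc 1 r, |φ (ℓ k)| / √(A k), by positivity,
    fun p hp => ?_⟩
  have hlead : (Leg r).leadingCoeff ≠ 0 := leadingCoeff_ne_zero.mpr (Leg_ne_zero hr)
  set c := p.coeff r / (Leg r).leadingCoeff with hc
  set s := p - C c * Leg r with hs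
  have hps : p = C c * Leg r + s := by rw [hs]; ring
  have hsdeg : s.natDegree < r := by
    have hle : s.natDegree ≤ r := (natDegree_sub_le _ _).trans
      (max_le hp ((natDegree_C_mul_le _ _).trans (natDegree_Leg r).le))
    refine lt_of_le_of_ne hle fun h => ?_
    have h0 : s.coeff r = 0 := by
      have hl : (Leg r).coeff r = (Leg r).leadingCoeff := by
        rw [leadingCoeff, natDegree_Leg]
      rw [hs, coeff_sub, coeff_C_mul, hl, hc]
      field_simp
      simp
    have h1 : s.coeff s.natDegree = 0 := by rw [h]; exact h0
    rw [coeff_natDegree, leadingCoeff_eq_zero] at h1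
    rw [h1, natDegree_zero] at h
    omega
  have hsinterp : s = ∑ k ∈ Finset.Icc 1 r, C (s.eval (G k)) * ℓ k := by
    have h := Lagrange.eq_interpolate_of_eval_eq (f := s) (fun k => s.eval (G k)) hG.injOn
      (lt_of_le_of_lt degree_le_natDegree (by simpa using hsdeg)) fun _ _ => rfl
    rwa [Lagrange.interpolate_apply] at h
  have hI : ∫ x in (-1 : ℝ)..1, (p ^ 2).eval x
      = c ^ 2 * N + ∑ k ∈ Finset.Icc 1 r, A k * s.eval (G k) ^ 2 := by
    have h1 : p ^ 2 = C (c ^ 2) * Leg r ^ 2 + (C (2 * c) * (s * Leg r) + s ^ 2) := by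
      rw [hps]; simp only [C_mul, C_pow]
      rw [show (C (2 : ℝ) : ℝ[X]) = 2 from rfl]; ring
    rw [h1, Polynomial.integral_eval_add, Polynomial.integral_eval_C_mul,
      Polynomial.integral_eval_add, Polynomial.integral_eval_C_mul, integral_mul_Leg_eq_zero hsdeg,
      ← hA.exact (s ^ 2) (by rw [natDegree_pow]; omega), mul_zero, zero_add]
    simp only [eval_pow, hNdef]
  set I := ∫ x in (-1 : ℝ)..1, (p ^ 2).eval x with hIdef
  have hterm : ∀ k ∈ Finset.Icc 1 r, 0 ≤ A k * s.eval (G k) ^ 2 := fun k hk =>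
    mul_nonneg (hA.pos k hk).le (sq_nonneg _)
  have hcb : |c| ≤ √I / √N := by
    rw [le_div_iff₀ (Real.sqrt_pos.mpr hN), ← Real.sqrt_sq_eq_abs, ← Real.sqrt_mul (sq_nonneg _)]
    refine Real.sqrt_le_sqrt ?_
    rw [hI]
    linarith [Finset.sum_nonneg hterm]
  have hsb : ∀ k ∈ Finset.Icc 1 r, |s.eval (G k)| ≤ √I / √(A k) := by
    intro k hk
    rw [le_div_iff₀ (Real.sqrt_pos.mpr (hA.pos k hk)), ← Real.sqrt_sq_eq_abs,
      ← Real.sqrt_mul (sq_nonneg _)]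
    refine Real.sqrt_le_sqrt ?_
    rw [hI]
    have h1 := Finset.single_le_sum hterm hk
    have h2 : 0 ≤ c ^ 2 * N := by positivity
    linarith
  have hφ : φ p = c * φ (Leg r) + ∑ k ∈ Finset.Icc 1 r, s.eval (G k) * φ (ℓ k) := by
    conv_lhs => rw [hps, hsinterp]
    simp only [map_add, map_sum, ← smul_eq_C_mul, map_smul, smul_eq_mul]
  rw [hφ, add_mul, Finset.sum_mul]
  refine (abs_add_le _ _).trans (add_le_add ?_ ((Finset.abs_sum_le_sum_abs _ _).trans
    (Finset.sum_le_sum fun k hk => ?_)))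
  · rw [abs_mul]
    calc |c| * |φ (Leg r)| ≤ √I / √N * |φ (Leg r)| := by gcongr
      _ = _ := by ring
  · rw [abs_mul]
    calc |s.eval (G k)| * |φ (ℓ k)| ≤ √I / √(A k) * |φ (ℓ k)| := by gcongr; exact hsb k hk
      _ = _ := by ring

/-! ### Gauss quadrature on an interval -/

/-- The image of `G k` under the affine map `[-1, 1] → [x₀, x₁]`. -/
noncomputable def gaussNode (G : ℕ → ℝ) (x₀ x₁ : ℝ) (k : ℕ) : ℝ := (x₁ + x₀ + (x₁ - x₀) * G k) / 2

/-- The Gauss nodes of `[x₀, x₁]` completed by the endpoints (indices `0` and `r + 1`). -/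
noncomputable def cellNode (r : ℕ) (G : ℕ → ℝ) (x₀ x₁ : ℝ) (k : ℕ) : ℝ :=
  if k = 0 then x₀ else if k = r + 1 then x₁ else gaussNode G x₀ x₁ k

/-- The partial quadrature sum `p(x₀) + ∑_{k' ≤ k} A_{k'} p'(g_{k'})`. -/
noncomputable def gaussTrace (G A : ℕ → ℝ) (x₀ x₁ : ℝ) (k : ℕ) : ℝ[X] →ₗ[ℝ] ℝ where
  toFun p := p.eval x₀ +
    ∑ k' ∈ Finset.Icc 1 k, (x₁ - x₀) * A k' / 2 * (derivative p).eval (gaussNode G x₀ x₁ k')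
  map_add' p q := by
    simp only [eval_add, derivative_add, mul_add, Finset.sum_add_distrib]
    ring
  map_smul' c p := by
    simp only [eval_smul, derivative_smul, smul_eq_mul, RingHom.id_apply, mul_add, Finset.mul_sum]
    congr 1
    exact Finset.sum_congr rfl fun _ _ => by ring

section gaussTrace

variable {r : ℕ} {G A : ℕ → ℝ}

lemma gaussTrace_apply (x₀ x₁ : ℝ) (k : ℕ) (p : ℝ[X]) :
    gaussTrace G A x₀ x₁ k p = p.eval x₀ +
      ∑ k' ∈ Finset.Icc 1 k, (x₁ - x₀) * A k' / 2 * (derivative p).eval (gaussNode G x₀ x₁ k') :=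
  rfl

@[simp] lemma gaussTrace_zero (x₀ x₁ : ℝ) (p : ℝ[X]) :
    gaussTrace G A x₀ x₁ 0 p = p.eval x₀ := by
  simp [gaussTrace_apply]

lemma gaussTrace_sub_pred (x₀ x₁ : ℝ) {k : ℕ} (hk : 1 ≤ k) (p : ℝ[X]) :
    gaussTrace G A x₀ x₁ k p - gaussTrace G A x₀ x₁ (k - 1) p =
      (x₁ - x₀) * A k / 2 * (derivative p).eval (gaussNode G x₀ x₁ k) := by
  obtain ⟨k, rfl⟩ := Nat.exists_eq_add_of_le' hk
  rw [gaussTrace_apply, gaussTrace_apply, Nat.add_sub_cancel,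
    Finset.sum_Icc_succ_top (by omega)]
  ring

/-- The affine map `[-1, 1] → [x₀, x₁]` as a polynomial. -/
noncomputable def affinePoly (x₀ x₁ : ℝ) : ℝ[X] := C ((x₁ - x₀) / 2) * X + C ((x₁ + x₀) / 2)

lemma eval_affinePoly (x₀ x₁ t : ℝ) :
    (affinePoly x₀ x₁).eval t = (x₁ - x₀) / 2 * t + (x₁ + x₀) / 2 := by
  simp [affinePoly]

lemma natDegree_comp_affinePoly_le (x₀ x₁ : ℝ) (p : ℝ[X]) :
    (p.comp (affinePoly x₀ x₁)).natDegree ≤ p.natDegree := by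
  refine natDegree_comp_le.trans ?_
  have : (affinePoly x₀ x₁).natDegree ≤ 1 := natDegree_linear_le
  nlinarith

lemma integral_comp_affinePoly (x₀ x₁ s t : ℝ) (p : ℝ[X]) :
    ∫ x in (affinePoly x₀ x₁).eval s..(affinePoly x₀ x₁).eval t, p.eval x =
      (x₁ - x₀) / 2 * ∫ x in s..t, (p.comp (affinePoly x₀ x₁)).eval x := by
  simp only [eval_comp, eval_affinePoly]
  have := intervalIntegral.smul_integral_comp_mul_add (a := s) (b := t) (fun x => p.eval x)
    ((x₁ - x₀) / 2) ((x₁ + x₀) / 2)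
  rw [smul_eq_mul] at this
  exact this.symm

lemma integral_eq_integral_comp_affinePoly (x₀ x₁ : ℝ) (p : ℝ[X]) :
    ∫ x in x₀..x₁, p.eval x =
      (x₁ - x₀) / 2 * ∫ x in (-1 : ℝ)..1, (p.comp (affinePoly x₀ x₁)).eval x := by
  rw [← integral_comp_affinePoly, eval_affinePoly, eval_affinePoly]
  congr 1 <;> ring

lemma eval_affinePoly_gaussNode (x₀ x₁ : ℝ) (k : ℕ) :
    gaussNode G x₀ x₁ k = (affinePoly x₀ x₁).eval (G k) := by
  rw [eval_affinePoly, gaussNode]; ring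

lemma cellNode_eq_eval_affinePoly (x₀ x₁ : ℝ) (k : ℕ) :
    cellNode r G x₀ x₁ k = (affinePoly x₀ x₁).eval (cellNode r G (-1) 1 k) := by
  unfold cellNode gaussNode
  rw [eval_affinePoly]
  split_ifs <;> ring

lemma gaussTrace_eq_comp (x₀ x₁ : ℝ) (k : ℕ) (p : ℝ[X]) :
    gaussTrace G A x₀ x₁ k p = gaussTrace G A (-1) 1 k (p.comp (affinePoly x₀ x₁)) := by
  rw [gaussTrace_apply, gaussTrace_apply, eval_comp, eval_affinePoly]
  congr 1
  · congr 1; ring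
  · refine Finset.sum_congr rfl fun k' _ => ?_
    have hd : derivative (affinePoly x₀ x₁) = C ((x₁ - x₀) / 2) := by simp [affinePoly]
    have hn : gaussNode G (-1) 1 k' = G k' := by unfold gaussNode; ring
    rw [derivative_comp, hd, eval_mul, eval_C, eval_comp, hn, eval_affinePoly_gaussNode]
    ring

lemma IsGaussRule.exact_interval (hA : IsGaussRule r G A) (x₀ x₁ : ℝ) {f : ℝ[X]}
    (hf : f.natDegree < 2 * r) :
    ∑ k ∈ Finset.Icc 1 r, (x₁ - x₀) * A k / 2 * f.eval (gaussNode G x₀ x₁ k) =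
      ∫ x in x₀..x₁, f.eval x := by
  rw [integral_eq_integral_comp_affinePoly,
    ← hA.exact _ ((natDegree_comp_affinePoly_le x₀ x₁ f).trans_lt hf), Finset.mul_sum]
  refine Finset.sum_congr rfl fun k _ => ?_
  rw [eval_comp, ← eval_affinePoly_gaussNode]
  ring

lemma IsGaussRule.weight_le_two (hA : IsGaussRule r G A) {k : ℕ} (hk : k ∈ Finset.Icc 1 r) :
    A k ≤ 2 := by
  have hr := Finset.mem_Icc.mp hk
  have h := hA.exact 1 (by rw [natDegree_one]; omega)
  simp only [eval_one, mul_one, intervalIntegral.integral_const, smul_eq_mul] at h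
  have := Finset.single_le_sum (fun k hk => (hA.pos k hk).le) hk
  linarith

lemma gaussTrace_last (hA : IsGaussRule r G A) (hr : 1 ≤ r) (x₀ x₁ : ℝ) {p : ℝ[X]}
    (hp : p.natDegree ≤ r) : gaussTrace G A x₀ x₁ r p = p.eval x₁ := by
  have := natDegree_derivative_le p
  rw [gaussTrace_apply, hA.exact_interval x₀ x₁ (by omega), Polynomial.integral_eval_derivative]
  ring

lemma sum_range_mul_sub_eq (T P : ℕ → ℝ) (r : ℕ) :
    ∑ l ∈ Finset.range (r + 1), T l * (P (l + 1) - P l) =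
      T r * P (r + 1) - T 0 * P 0 - ∑ l ∈ Finset.Icc 1 r, (T l - T (l - 1)) * P l := by
  induction r with
  | zero => simp; ring
  | succ r ih =>
    rw [Finset.sum_range_succ, ih, Finset.sum_Icc_succ_top (by omega), Nat.add_sub_cancel]
    ring

lemma gaussTrace_coercive_ref (hG : IsGaussPoints r G) (hA : IsGaussRule r G A) (hr : 1 ≤ r)
    {p : ℝ[X]} (hp : p.natDegree ≤ r) :
    ∫ x in (-1 : ℝ)..1, (p ^ 2).eval x ≤
      ∑ l ∈ Finset.range (r + 1), gaussTrace G A (-1) 1 l p *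
        ∫ x in cellNode r G (-1) 1 l..cellNode r G (-1) 1 (l + 1), p.eval x := by
  obtain ⟨P, hP, hPdeg⟩ := Polynomial.exists_derivative_eq p
  have hintegral : ∀ a b : ℝ, ∫ x in a..b, p.eval x = P.eval b - P.eval a := fun a b => by
    rw [← hP]; exact Polynomial.integral_eval_derivative P a b
  simp only [hintegral]
  rw [sum_range_mul_sub_eq (fun l => gaussTrace G A (-1) 1 l p)
    (fun l => P.eval (cellNode r G (-1) 1 l)), gaussTrace_last hA hr _ _ hp, gaussTrace_zero,
    show cellNode r G (-1) 1 (r + 1) = 1 by simp [cellNode],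
    show cellNode r G (-1) 1 0 = -1 by simp [cellNode]]
  have hsum : ∑ l ∈ Finset.Icc 1 r,
      (gaussTrace G A (-1) 1 l p - gaussTrace G A (-1) 1 (l - 1) p) *
        P.eval (cellNode r G (-1) 1 l) =
      ∑ l ∈ Finset.Icc 1 r, A l * (derivative p * P).eval (G l) := by
    refine Finset.sum_congr rfl fun l hl => ?_
    have hl' := Finset.mem_Icc.mp hl
    rw [gaussTrace_sub_pred _ _ hl'.1, cellNode, if_neg (by omega), if_neg (by omega),
      show gaussNode G (-1) 1 l = G l by unfold gaussNode; ring, eval_mul]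
    ring
  have hdd := natDegree_derivative_le p
  have hquad := hA.sum_le_integral hG hr (f := derivative p * P)
    (natDegree_mul_le.trans (by omega)) (by
      have h := coeff_mul_add_eq_of_natDegree_le (f := derivative p) (g := P) (df := r - 1)
        (dg := r + 1) (by omega) (by omega)
      rw [show 2 * r = r - 1 + (r + 1) by omega, h, coeff_derivative]
      have hc : p.coeff r = P.coeff (r + 1) * (r + 1) := by rw [← hP, coeff_derivative]
      rw [show r - 1 + 1 = r by omega, hc]
      have : P.coeff (r + 1) * (r + 1) * (((r - 1 : ℕ) : ℝ) + 1) * P.coeff (r + 1) =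
        P.coeff (r + 1) ^ 2 * ((r + 1) * (((r - 1 : ℕ) : ℝ) + 1)) := by ring
      rw [this]
      positivity)
  have hparts := Polynomial.integral_mul_derivative p P (-1) 1
  rw [hP, ← sq] at hparts
  rw [hsum, hparts]
  linarith

/-- The cellwise form `∑_l (T_l p) ∫_{g_l}^{g_{l+1}} p` dominates `∫ p²`. -/
lemma gaussTrace_coercive (hG : IsGaussPoints r G) (hA : IsGaussRule r G A) (hr : 1 ≤ r)
    {x₀ x₁ : ℝ} (h : x₀ < x₁) {p : ℝ[X]} (hp : p.natDegree ≤ r) :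
    ∫ x in x₀..x₁, (p ^ 2).eval x ≤
      ∑ l ∈ Finset.range (r + 1), gaussTrace G A x₀ x₁ l p *
        ∫ x in cellNode r G x₀ x₁ l..cellNode r G x₀ x₁ (l + 1), p.eval x := by
  have href := gaussTrace_coercive_ref hG hA hr
    (p := p.comp (affinePoly x₀ x₁)) ((natDegree_comp_affinePoly_le _ _ _).trans hp)
  rw [integral_eq_integral_comp_affinePoly, pow_comp]
  refine (mul_le_mul_of_nonneg_left href (by linarith)).trans_eq ?_
  rw [Finset.mul_sum]
  refine Finset.sum_congr rfl fun l _ => ?_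
  rw [cellNode_eq_eval_affinePoly x₀ x₁ l, cellNode_eq_eval_affinePoly x₀ x₁ (l + 1),
    integral_comp_affinePoly, gaussTrace_eq_comp x₀ x₁]
  ring

lemma exists_gaussTrace_sq_le (hG : IsGaussPoints r G) (hA : IsGaussRule r G A) (hr : 1 ≤ r) :
    ∃ K : ℝ, 0 < K ∧ ∀ x₀ x₁ : ℝ, x₀ < x₁ → ∀ l ∈ Finset.range (r + 1), ∀ p : ℝ[X],
      p.natDegree ≤ r →
        (gaussTrace G A x₀ x₁ l p) ^ 2 ≤ K / (x₁ - x₀) * ∫ x in x₀..x₁, (p ^ 2).eval x := by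
  choose K hK0 hK using fun l => hA.exists_abs_le hG hr (gaussTrace G A (-1) 1 l)
  refine ⟨2 * ∑ l ∈ Finset.range (r + 1), K l ^ 2 + 1, by positivity, ?_⟩
  intro x₀ x₁ hx l hl p hp
  have h1 := hK l (p.comp (affinePoly x₀ x₁)) ((natDegree_comp_affinePoly_le _ _ _).trans hp)
  have hI := Polynomial.integral_sq_nonneg (p.comp (affinePoly x₀ x₁)) (a := -1) (b := 1)
    (by norm_num)
  have h2 : (gaussTrace G A x₀ x₁ l p) ^ 2 ≤
      K l ^ 2 * ∫ x in (-1 : ℝ)..1, (p.comp (affinePoly x₀ x₁) ^ 2).eval x := by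
    rw [gaussTrace_eq_comp, ← sq_abs, ← Real.sq_sqrt hI, ← mul_pow]
    exact pow_le_pow_left₀ (abs_nonneg _) h1 2
  refine h2.trans ?_
  rw [integral_eq_integral_comp_affinePoly x₀ x₁, pow_comp]
  have hl2 : K l ^ 2 ≤ ∑ l ∈ Finset.range (r + 1), K l ^ 2 :=
    Finset.single_le_sum (f := fun l => K l ^ 2) (fun _ _ => sq_nonneg _) hl
  have hd : x₁ - x₀ ≠ 0 := by linarith
  calc K l ^ 2 * ∫ x in (-1 : ℝ)..1, (p.comp (affinePoly x₀ x₁) ^ 2).eval x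
      ≤ (∑ l ∈ Finset.range (r + 1), K l ^ 2 + 1 / 2) *
          ∫ x in (-1 : ℝ)..1, (p.comp (affinePoly x₀ x₁) ^ 2).eval x := by
        gcongr; linarith
    _ = _ := by
        generalize ∑ l ∈ Finset.range (r + 1), K l ^ 2 = S
        field_simp

end gaussTrace

lemma IsGaussPoints.gaussNode_mem_Ioo {r : ℕ} {G : ℕ → ℝ} (hG : IsGaussPoints r G)
    {x₀ x₁ : ℝ} (h : x₀ < x₁) {k : ℕ} (hk : k ∈ Finset.Icc 1 r) :
    gaussNode G x₀ x₁ k ∈ Set.Ioo x₀ x₁ := by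
  have hk' := Finset.mem_Icc.mp hk
  obtain ⟨h1, h2⟩ := (hG.2 k hk'.1 hk'.2).1
  unfold gaussNode
  constructor <;> nlinarith

lemma IsGaussPoints.cellNode_mem_Icc {r : ℕ} {G : ℕ → ℝ} (hG : IsGaussPoints r G)
    {x₀ x₁ : ℝ} (h : x₀ < x₁) {k : ℕ} (hk : k ≤ r + 1) :
    cellNode r G x₀ x₁ k ∈ Set.Icc x₀ x₁ := by
  unfold cellNode
  split_ifs with h0 h1
  · exact Set.left_mem_Icc.mpr h.le
  · exact Set.right_mem_Icc.mpr h.le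
  · exact Set.Ioo_subset_Icc_self
      (hG.gaussNode_mem_Ioo h (Finset.mem_Icc.mpr ⟨by omega, by omega⟩))

/-! ### One-dimensional Lagrange interpolation -/

/-- The `r + 1` equispaced nodes of `[x₀, x₁]`, endpoints included. -/
noncomputable def interpNode (r : ℕ) (x₀ x₁ : ℝ) (k : ℕ) : ℝ := x₀ + (x₁ - x₀) * (k / r)

/-- The Lagrange basis polynomials at the equispaced nodes. -/
noncomputable def nodal (r : ℕ) (x₀ x₁ : ℝ) (k : ℕ) : ℝ[X] :=
  Lagrange.basis (Finset.range (r + 1)) (interpNode r x₀ x₁) k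

section nodal

variable {r : ℕ} {x₀ x₁ : ℝ}

@[simp] lemma interpNode_zero : interpNode r x₀ x₁ 0 = x₀ := by simp [interpNode]

lemma interpNode_last (hr : 1 ≤ r) : interpNode r x₀ x₁ r = x₁ := by
  have : (r : ℝ) ≠ 0 := by positivity
  simp [interpNode, this]

lemma interpNode_mem (hr : 1 ≤ r) (h : x₀ < x₁) {k : ℕ} (hk : k ∈ Finset.range (r + 1)) :
    interpNode r x₀ x₁ k ∈ Set.Icc x₀ x₁ := by
  have hk' : (k : ℝ) ≤ r := by exact_mod_cast Nat.lt_succ_iff.mp (Finset.mem_range.mp hk)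
  have hr' : (0 : ℝ) < r := by positivity
  have h0 : 0 ≤ (k : ℝ) / r := by positivity
  have h1 : (k : ℝ) / r ≤ 1 := (div_le_one hr').mpr hk'
  unfold interpNode
  constructor <;> nlinarith

lemma interpNode_injOn (hr : 1 ≤ r) (h : x₀ < x₁) :
    Set.InjOn (interpNode r x₀ x₁) (Finset.range (r + 1)) := by
  intro k _ l _ hkl
  have hr' : (r : ℝ) ≠ 0 := by positivity
  have hd : x₁ - x₀ ≠ 0 := by linarith
  unfold interpNode at hkl
  have h1 : (k : ℝ) / r = l / r := mul_left_cancel₀ hd (add_left_cancel hkl)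
  rw [div_left_inj' hr'] at h1
  exact_mod_cast h1

lemma natDegree_nodal_le (hr : 1 ≤ r) (h : x₀ < x₁) {k : ℕ} (hk : k ∈ Finset.range (r + 1)) :
    (nodal r x₀ x₁ k).natDegree ≤ r := by
  have := Lagrange.degree_basis (interpNode_injOn hr h) hk
  rw [Finset.card_range, add_tsub_cancel_right] at this
  exact (natDegree_eq_of_degree_eq_some this).le

lemma sum_nodal_eq (hr : 1 ≤ r) (h : x₀ < x₁) {p : ℝ[X]} (hp : p.natDegree ≤ r) :
    ∑ k ∈ Finset.range (r + 1), C (p.eval (interpNode r x₀ x₁ k)) * nodal r x₀ x₁ k = p := by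
  have := Lagrange.eq_interpolate_of_eval_eq (f := p) (fun k => p.eval (interpNode r x₀ x₁ k))
    (interpNode_injOn hr h)
    (lt_of_le_of_lt degree_le_natDegree (by rw [Finset.card_range]; exact_mod_cast by omega))
    fun _ _ => rfl
  rw [Lagrange.interpolate_apply] at this
  exact this.symm

lemma eval_nodal (hr : 1 ≤ r) (h : x₀ < x₁) {k l : ℕ} (hk : k ∈ Finset.range (r + 1))
    (hl : l ∈ Finset.range (r + 1)) :
    (nodal r x₀ x₁ k).eval (interpNode r x₀ x₁ l) = if k = l then 1 else 0 := by
  split_ifs with hkl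
  · subst hkl
    exact Lagrange.eval_basis_self (interpNode_injOn hr h) hk
  · exact Lagrange.eval_basis_of_ne hkl hl

lemma sum_mul_eval_nodal_left (hr : 1 ≤ r) (h : x₀ < x₁) (a : ℕ → ℝ) :
    ∑ k ∈ Finset.range (r + 1), a k * (nodal r x₀ x₁ k).eval x₀ = a 0 := by
  rw [Finset.sum_eq_single_of_mem 0 (by simp)]
  · have := eval_nodal hr h (k := 0) (l := 0) (by simp) (by simp)
    rw [interpNode_zero] at this
    simp [this]
  · intro k hk hk0
    have := eval_nodal hr h (k := k) (l := 0) hk (by simp)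
    rw [interpNode_zero] at this
    simp [this, hk0]

lemma sum_mul_eval_nodal_right (hr : 1 ≤ r) (h : x₀ < x₁) (a : ℕ → ℝ) :
    ∑ k ∈ Finset.range (r + 1), a k * (nodal r x₀ x₁ k).eval x₁ = a r := by
  rw [Finset.sum_eq_single_of_mem r (by simp)]
  · have := eval_nodal hr h (k := r) (l := r) (by simp) (by simp)
    rw [interpNode_last hr] at this
    simp [this]
  · intro k hk hk0
    have := eval_nodal hr h (k := k) (l := r) hk (by simp)
    rw [interpNode_last hr] at this
    simp [this, hk0]

lemma nodal_eq_comp (h : x₀ < x₁) (k : ℕ) :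
    nodal r x₀ x₁ k = (nodal r 0 1 k).comp (C (x₁ - x₀)⁻¹ * (X - C x₀)) := by
  have hd : x₁ - x₀ ≠ 0 := by linarith
  unfold nodal Lagrange.basis
  rw [prod_comp]
  refine Finset.prod_congr rfl fun j _ => Polynomial.funext fun x => ?_
  simp only [Lagrange.basisDivisor, eval_comp, eval_mul, eval_sub, eval_C, eval_X, interpNode]
  rw [show x₀ + (x₁ - x₀) * (k / r) - (x₀ + (x₁ - x₀) * (j / r)) =
      (x₁ - x₀) * ((k : ℝ) / r - j / r) by ring, mul_inv]
  rw [show x - (x₀ + (x₁ - x₀) * ((j : ℝ) / r)) = (x₁ - x₀) * ((x₁ - x₀)⁻¹ * (x - x₀) - j / r) by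
    field_simp
    ring]
  rw [show (0 : ℝ) + (1 - 0) * (k / r) - (0 + (1 - 0) * (j / r)) = k / r - j / r by ring,
    show (0 : ℝ) + (1 - 0) * (j / r) = j / r by ring]
  field_simp

end nodal

lemma exists_nodal_bound (r : ℕ) : ∃ Λ : ℝ, 0 < Λ ∧ ∀ x₀ x₁ : ℝ, x₀ < x₁ →
    ∀ k ∈ Finset.range (r + 1), ∀ x ∈ Set.Icc x₀ x₁, |(nodal r x₀ x₁ k).eval x| ≤ Λ ∧
      |(derivative (nodal r x₀ x₁ k)).eval x| ≤ Λ / (x₁ - x₀) := by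
  have hb : ∀ p : ℝ[X], ∃ B : ℝ, 0 ≤ B ∧ ∀ t ∈ Set.Icc (0 : ℝ) 1, |p.eval t| ≤ B := fun p => by
    obtain ⟨B, hB⟩ := isCompact_Icc.exists_bound_of_continuousOn
      (p.continuous.continuousOn (s := Set.Icc (0 : ℝ) 1))
    exact ⟨B, (abs_nonneg _).trans (hB 0 (by simp)), hB⟩
  choose B hB0 hB using hb
  refine ⟨1 + ∑ k ∈ Finset.range (r + 1), (B (nodal r 0 1 k) + B (derivative (nodal r 0 1 k))),
    by
      have : 0 ≤ ∑ k ∈ Finset.range (r + 1),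
          (B (nodal r 0 1 k) + B (derivative (nodal r 0 1 k))) :=
        Finset.sum_nonneg fun k _ => add_nonneg (hB0 _) (hB0 _)
      linarith, ?_⟩
  intro x₀ x₁ h k hk x hx
  have hd : 0 < x₁ - x₀ := by linarith
  have hsum := Finset.single_le_sum
    (f := fun k => B (nodal r 0 1 k) + B (derivative (nodal r 0 1 k)))
    (fun k _ => add_nonneg (hB0 _) (hB0 _)) hk
  have ht : (x₁ - x₀)⁻¹ * (x - x₀) ∈ Set.Icc (0 : ℝ) 1 := by
    rw [inv_mul_eq_div]
    exact ⟨div_nonneg (by linarith [hx.1]) hd.le, (div_le_one hd).mpr (by linarith [hx.2])⟩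
  have h1 := hB (nodal r 0 1 k) _ ht
  have h2 := hB (derivative (nodal r 0 1 k)) _ ht
  have h3 := hB0 (nodal r 0 1 k)
  have h4 := hB0 (derivative (nodal r 0 1 k))
  rw [nodal_eq_comp h]
  constructor
  · simp only [eval_comp, eval_mul, eval_C, eval_sub, eval_X]
    linarith
  · have hder : derivative (C (x₁ - x₀)⁻¹ * (X - C x₀) : ℝ[X]) = C (x₁ - x₀)⁻¹ := by simp
    rw [derivative_comp, hder]
    simp only [eval_comp, eval_mul, eval_C, eval_sub, eval_X]
    rw [abs_mul, abs_inv, abs_of_pos hd, inv_mul_eq_div]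
    gcongr
    linarith

lemma abs_sub_le_integral_abs_deriv {g g' : ℝ → ℝ} (hg : ∀ x, HasDerivAt g (g' x) x)
    (hg' : Continuous g') {x₀ x₁ x : ℝ} (hx : x ∈ Set.Icc x₀ x₁) :
    |g x - g x₀| ≤ ∫ s in x₀..x₁, |g' s| := by
  rw [← intervalIntegral.integral_eq_sub_of_hasDerivAt (fun x _ => hg x)
    (hg'.intervalIntegrable _ _)]
  refine (intervalIntegral.abs_integral_le_integral_abs hx.1).trans ?_
  exact intervalIntegral.integral_mono_interval le_rfl hx.1 hx.2
    (Filter.Eventually.of_forall fun _ => abs_nonneg _) (hg'.abs.intervalIntegrable _ _)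

lemma exists_poly_approx_of_deriv {g g' : ℝ → ℝ} (hg : ∀ x, HasDerivAt g (g' x) x)
    {x₀ x₁ B : ℝ} (h : x₀ < x₁) {q : ℝ[X]} (hq : ∀ x ∈ Set.Icc x₀ x₁, |g' x - q.eval x| ≤ B) :
    ∃ p : ℝ[X], derivative p = q ∧ p.natDegree ≤ q.natDegree + 1 ∧
      ∀ x ∈ Set.Icc x₀ x₁, |g x - p.eval x| ≤ (x₁ - x₀) * B := by
  obtain ⟨p, hp, hpd⟩ := q.exists_derivative_eq
  refine ⟨p + C (g x₀ - p.eval x₀), by simp [hp], ?_, fun x hx => ?_⟩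
  · rw [natDegree_add_C]; exact hpd
  · have hmv := (convex_Icc x₀ x₁).norm_image_sub_le_of_norm_hasDerivWithin_le
      (f := fun x => g x - p.eval x) (f' := fun x => g' x - q.eval x) (C := B)
      (fun x _ => ((hg x).sub (hp ▸ p.hasDerivAt x)).hasDerivWithinAt) hq
      (Set.left_mem_Icc.mpr h.le) hx
    simp only [Real.norm_eq_abs] at hmv
    rw [eval_add, eval_C, show g x - (p.eval x + (g x₀ - p.eval x₀)) =
      g x - p.eval x - (g x₀ - p.eval x₀) by ring]
    refine hmv.trans ?_
    have hB : 0 ≤ B := (abs_nonneg _).trans (hq x hx)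
    rw [abs_of_nonneg (by linarith [hx.1]), mul_comm]
    exact mul_le_mul_of_nonneg_right (by linarith [hx.2]) hB

lemma exists_poly_approx {x₀ x₁ : ℝ} (h : x₀ < x₁) (n : ℕ) : ∀ D : ℕ → ℝ → ℝ,
    (∀ k ≤ n, ∀ x, HasDerivAt (D k) (D (k + 1) x) x) → Continuous (D (n + 1)) →
    ∃ q : ℝ[X], q.natDegree ≤ n ∧ ∀ x ∈ Set.Icc x₀ x₁,
      |D 0 x - q.eval x| ≤ (x₁ - x₀) ^ n * ∫ s in x₀..x₁, |D (n + 1) s| := by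
  induction n with
  | zero =>
    intro D hD hc
    refine ⟨C (D 0 x₀), by simp, fun x hx => ?_⟩
    rw [eval_C, pow_zero, one_mul]
    exact abs_sub_le_integral_abs_deriv (hD 0 le_rfl) hc hx
  | succ n ih =>
    intro D hD hc
    obtain ⟨q, hqd, hq⟩ := ih (fun k => D (k + 1)) (fun k hk => hD (k + 1) (by omega)) hc
    obtain ⟨p, -, hpd, hp⟩ := exists_poly_approx_of_deriv (hD 0 (by omega)) h hq
    refine ⟨p, by omega, fun x hx => (hp x hx).trans_eq (by ring)⟩

/-- Value, derivative and stability estimates for one-dimensional interpolation. -/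
structure InterpBound (r : ℕ) (K : ℝ) : Prop where
  pos : 0 < K
  value : ∀ x₀ x₁ : ℝ, x₀ < x₁ → ∀ D : ℕ → ℝ → ℝ,
    (∀ k < r, ∀ x, HasDerivAt (D k) (D (k + 1) x) x) → Continuous (D r) →
    ∀ x ∈ Set.Icc x₀ x₁,
      |D 0 x - ∑ k ∈ Finset.range (r + 1), D 0 (interpNode r x₀ x₁ k) * (nodal r x₀ x₁ k).eval x|
        ≤ K * (x₁ - x₀) ^ (r - 1) * ∫ s in x₀..x₁, |D r s|
  deriv : ∀ x₀ x₁ : ℝ, x₀ < x₁ → ∀ D : ℕ → ℝ → ℝ,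
    (∀ k ≤ r, ∀ x, HasDerivAt (D k) (D (k + 1) x) x) → Continuous (D (r + 1)) →
    ∀ x ∈ Set.Icc x₀ x₁,
      |D 1 x - ∑ k ∈ Finset.range (r + 1),
          D 0 (interpNode r x₀ x₁ k) * (derivative (nodal r x₀ x₁ k)).eval x|
        ≤ K * (x₁ - x₀) ^ (r - 1) * ∫ s in x₀..x₁, |D (r + 1) s|
  stable : ∀ x₀ x₁ : ℝ, x₀ < x₁ → ∀ g g' : ℝ → ℝ, (∀ x, HasDerivAt g (g' x) x) → Continuous g' →
    ∀ x ∈ Set.Icc x₀ x₁,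
      |∑ k ∈ Finset.range (r + 1),
          g (interpNode r x₀ x₁ k) * (derivative (nodal r x₀ x₁ k)).eval x|
        ≤ K / (x₁ - x₀) * ∫ s in x₀..x₁, |g' s|

lemma abs_sum_range_mul_le {r : ℕ} {a b : ℕ → ℝ} {α β : ℝ}
    (ha : ∀ k ∈ Finset.range (r + 1), |a k| ≤ α) (hb : ∀ k ∈ Finset.range (r + 1), |b k| ≤ β) :
    |∑ k ∈ Finset.range (r + 1), a k * b k| ≤ (r + 1) * (α * β) := by
  refine (Finset.abs_sum_le_sum_abs _ _).trans ?_
  refine (Finset.sum_le_card_nsmul _ _ (α * β) fun k hk => ?_).trans_eq (by simp)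
  rw [abs_mul]
  exact mul_le_mul (ha k hk) (hb k hk) (abs_nonneg _) ((abs_nonneg _).trans (ha k hk))

lemma exists_interpBound {r : ℕ} (hr : 1 ≤ r) : ∃ K, InterpBound r K := by
  obtain ⟨Λ, hΛ, hbound⟩ := exists_nodal_bound r
  refine ⟨1 + (r + 1) * Λ, by positivity, ?_, ?_, ?_⟩
  · intro x₀ x₁ h D hD hc x hx
    obtain ⟨s, rfl⟩ := Nat.exists_eq_add_of_le' hr
    obtain ⟨q, hqd, hq⟩ := exists_poly_approx h s D (fun k hk => hD k (by omega)) hc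
    set B := (x₁ - x₀) ^ s * ∫ t in x₀..x₁, |D (s + 1) t| with hB
    have hrep := congrArg (Polynomial.eval x) (sum_nodal_eq (p := q) hr h (by omega))
    simp only [eval_finsetSum, eval_mul, eval_C] at hrep
    have hsplit : D 0 x - ∑ k ∈ Finset.range (s + 1 + 1), D 0 (interpNode (s + 1) x₀ x₁ k) *
          (nodal (s + 1) x₀ x₁ k).eval x =
        (D 0 x - q.eval x) - ∑ k ∈ Finset.range (s + 1 + 1),
          (D 0 (interpNode (s + 1) x₀ x₁ k) - q.eval (interpNode (s + 1) x₀ x₁ k)) *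
          (nodal (s + 1) x₀ x₁ k).eval x := by
      simp only [sub_mul, Finset.sum_sub_distrib, hrep]
      ring
    have h2 := abs_sum_range_mul_le (r := s + 1)
      (a := fun k => D 0 (interpNode (s + 1) x₀ x₁ k) - q.eval (interpNode (s + 1) x₀ x₁ k))
      (b := fun k => (nodal (s + 1) x₀ x₁ k).eval x)
      (fun k hk => hq _ (interpNode_mem hr h hk)) (fun k hk => (hbound x₀ x₁ h k hk x hx).1)
    rw [hsplit]
    refine (abs_sub _ _).trans ((add_le_add (hq x hx) h2).trans_eq ?_)
    rw [Nat.add_sub_cancel, hB]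
    ring
  · intro x₀ x₁ h D hD hc x hx
    obtain ⟨s, rfl⟩ := Nat.exists_eq_add_of_le' hr
    have hd : x₁ - x₀ ≠ 0 := by linarith
    obtain ⟨q, hqd, hq⟩ := exists_poly_approx h s (fun k => D (k + 1))
      (fun k hk => hD (k + 1) (by omega)) hc
    set B := (x₁ - x₀) ^ s * ∫ t in x₀..x₁, |D (s + 1 + 1) t| with hB
    obtain ⟨p, hpq, hpd, hp⟩ := exists_poly_approx_of_deriv (hD 0 (by omega)) h hq
    have hrep := congrArg (fun f => Polynomial.eval x (derivative f))
      (sum_nodal_eq (p := p) hr h (by omega))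
    simp only [derivative_sum, eval_finsetSum, derivative_C_mul, eval_mul, eval_C, hpq] at hrep
    have hsplit : D 1 x - ∑ k ∈ Finset.range (s + 1 + 1), D 0 (interpNode (s + 1) x₀ x₁ k) *
          (derivative (nodal (s + 1) x₀ x₁ k)).eval x =
        (D 1 x - q.eval x) - ∑ k ∈ Finset.range (s + 1 + 1),
          (D 0 (interpNode (s + 1) x₀ x₁ k) - p.eval (interpNode (s + 1) x₀ x₁ k)) *
          (derivative (nodal (s + 1) x₀ x₁ k)).eval x := by
      simp only [sub_mul, Finset.sum_sub_distrib, hrep]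
      ring
    have h2 := abs_sum_range_mul_le (r := s + 1)
      (a := fun k => D 0 (interpNode (s + 1) x₀ x₁ k) - p.eval (interpNode (s + 1) x₀ x₁ k))
      (b := fun k => (derivative (nodal (s + 1) x₀ x₁ k)).eval x)
      (fun k hk => hp _ (interpNode_mem hr h hk)) (fun k hk => (hbound x₀ x₁ h k hk x hx).2)
    rw [hsplit]
    refine (abs_sub _ _).trans ((add_le_add (hq x hx) h2).trans_eq ?_)
    rw [Nat.add_sub_cancel]
    rw [show (x₁ - x₀) * ((x₁ - x₀) ^ s * ∫ t in x₀..x₁, |D (s + 1 + 1) t|) * (Λ / (x₁ - x₀)) =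
      B * Λ by rw [hB]; field_simp]
    rw [hB]
    ring
  · intro x₀ x₁ h g g' hg hg' x hx
    have hd : 0 < x₁ - x₀ := by linarith
    have hrep := congrArg (fun f => Polynomial.eval x (derivative f))
      (sum_nodal_eq (p := C (g x₀)) hr h (by simp))
    simp only [derivative_sum, eval_finsetSum, derivative_C_mul, eval_mul, eval_C,
      derivative_C, eval_zero] at hrep
    have hsplit : ∑ k ∈ Finset.range (r + 1), g (interpNode r x₀ x₁ k) *
          (derivative (nodal r x₀ x₁ k)).eval x =
        ∑ k ∈ Finset.range (r + 1), (g (interpNode r x₀ x₁ k) - g x₀) *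
          (derivative (nodal r x₀ x₁ k)).eval x := by
      simp only [sub_mul, Finset.sum_sub_distrib, hrep, sub_zero]
    have h2 := abs_sum_range_mul_le (r := r)
      (a := fun k => g (interpNode r x₀ x₁ k) - g x₀)
      (b := fun k => (derivative (nodal r x₀ x₁ k)).eval x)
      (fun k hk => abs_sub_le_integral_abs_deriv hg hg' (interpNode_mem hr h hk))
      (fun k hk => (hbound x₀ x₁ h k hk x hx).2)
    rw [hsplit]
    refine h2.trans ?_
    have hI : 0 ≤ ∫ s in x₀..x₁, |g' s| :=
      intervalIntegral.integral_nonneg h.le fun _ _ => abs_nonneg _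
    have : (1 + (r + 1) * Λ) / (x₁ - x₀) * ∫ s in x₀..x₁, |g' s| =
        (∫ s in x₀..x₁, |g' s|) / (x₁ - x₀) +
          (r + 1) * ((∫ s in x₀..x₁, |g' s|) * (Λ / (x₁ - x₀))) := by
      field_simp
    rw [this]
    linarith [div_nonneg hI hd.le]

/-! ### Partial derivatives and integrals over rectangles -/

section calculus

variable {f : ℝ × ℝ → ℝ}

lemma hasDerivAt_pdx (hf : Differentiable ℝ f) (x y : ℝ) :
    HasDerivAt (fun s => f (s, y)) (pdx f (x, y)) x := by
  have h := (hf (x, y)).hasFDerivAt.comp_hasDerivAt x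
    ((hasDerivAt_id x).prodMk (hasDerivAt_const x y))
  exact h

lemma hasDerivAt_pdy (hf : Differentiable ℝ f) (x y : ℝ) :
    HasDerivAt (fun t => f (x, t)) (pdy f (x, y)) y := by
  have h := (hf (x, y)).hasFDerivAt.comp_hasDerivAt y
    ((hasDerivAt_const y x).prodMk (hasDerivAt_id y))
  exact h

lemma contDiff_pdx {n : ℕ} (hf : ContDiff ℝ (n + 1 : ℕ) f) : ContDiff ℝ n (pdx f) :=
  (hf.fderiv_right (m := n) (by norm_cast)).clm_apply contDiff_const

lemma contDiff_pdy {n : ℕ} (hf : ContDiff ℝ (n + 1 : ℕ) f) : ContDiff ℝ n (pdy f) :=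
  (hf.fderiv_right (m := n) (by norm_cast)).clm_apply contDiff_const

lemma contDiff_iterate_pdx {n : ℕ} (k : ℕ) (hf : ContDiff ℝ (n + k : ℕ) f) :
    ContDiff ℝ n (pdx^[k] f) := by
  induction k generalizing f with
  | zero => simpa using hf
  | succ k ih => exact ih (contDiff_pdx hf)

lemma contDiff_iterate_pdy {n : ℕ} (k : ℕ) (hf : ContDiff ℝ (n + k : ℕ) f) :
    ContDiff ℝ n (pdy^[k] f) := by
  induction k generalizing f with
  | zero => simpa using hf
  | succ k ih => exact ih (contDiff_pdy hf)

lemma pdy_pdx_comm (hf : ContDiff ℝ 2 f) : pdy (pdx f) = pdx (pdy f) := by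
  have hd : Differentiable ℝ (fderiv ℝ f) :=
    (hf.fderiv_right (m := 1) (by norm_num [one_add_one_eq_two])).differentiable one_ne_zero
  have happ : ∀ (v w z : ℝ × ℝ), fderiv ℝ (fun z => fderiv ℝ f z v) z w =
      fderiv ℝ (fderiv ℝ f) z w v := by
    intro v w z
    rw [fderiv_clm_apply (hd z) (differentiableAt_const v)]
    simp
  funext z
  have hs : IsSymmSndFDerivAt ℝ f z := hf.contDiffAt.isSymmSndFDerivAt (by simp)
  exact (happ _ _ z).trans ((hs _ _).trans (happ _ _ z).symm)

lemma iterate_pdy_pdx (k : ℕ) (hf : ContDiff ℝ (k + 1 : ℕ) f) :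
    pdy^[k] (pdx f) = pdx (pdy^[k] f) := by
  induction k generalizing f with
  | zero => rfl
  | succ k ih =>
    rw [Function.iterate_succ_apply, Function.iterate_succ_apply,
      pdy_pdx_comm (hf.of_le (by norm_cast; omega)), ih (contDiff_pdy hf)]

lemma pdx_comp_swap (hf : Differentiable ℝ f) : pdx (f ∘ Prod.swap) = pdy f ∘ Prod.swap := by
  funext z
  exact (hasDerivAt_pdx (hf.comp (ContinuousLinearEquiv.prodComm ℝ ℝ ℝ).differentiable)
    z.1 z.2).unique (hasDerivAt_pdy hf z.2 z.1)

lemma pdy_comp_swap (hf : Differentiable ℝ f) : pdy (f ∘ Prod.swap) = pdx f ∘ Prod.swap := by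
  funext z
  exact (hasDerivAt_pdy (hf.comp (ContinuousLinearEquiv.prodComm ℝ ℝ ℝ).differentiable)
    z.1 z.2).unique (hasDerivAt_pdx hf z.2 z.1)

lemma iterate_pdx_comp_swap (k : ℕ) (hf : ContDiff ℝ k f) :
    pdx^[k] (f ∘ Prod.swap) = pdy^[k] f ∘ Prod.swap := by
  induction k generalizing f with
  | zero => rfl
  | succ k ih =>
    rw [Function.iterate_succ_apply, Function.iterate_succ_apply,
      pdx_comp_swap (hf.differentiable (by norm_cast)), ih (contDiff_pdy hf)]

lemma iterate_pdy_comp_swap (k : ℕ) (hf : ContDiff ℝ k f) :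
    pdy^[k] (f ∘ Prod.swap) = pdx^[k] f ∘ Prod.swap := by
  induction k generalizing f with
  | zero => rfl
  | succ k ih =>
    rw [Function.iterate_succ_apply, Function.iterate_succ_apply,
      pdy_comp_swap (hf.differentiable (by norm_cast)), ih (contDiff_pdx hf)]

lemma rectInt_swap (hf : Continuous f) (x₀ x₁ y₀ y₁ : ℝ) :
    rectInt f x₀ x₁ y₀ y₁ = ∫ t in y₀..y₁, ∫ s in x₀..x₁, f (s, t) :=
  intervalIntegral_intervalIntegral_swap (F := fun s t => f (s, t))
    ((hf.continuousOn.integrableOn_compact (isCompact_uIcc.prod isCompact_uIcc)).mono_set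
      (Set.prod_mono Set.uIoc_subset_uIcc Set.uIoc_subset_uIcc))

lemma setIntegral_prod_eq_rectInt (hf : Continuous f) {x₀ x₁ y₀ y₁ : ℝ} (hx : x₀ ≤ x₁)
    (hy : y₀ ≤ y₁) :
    ∫ z in Set.Icc x₀ x₁ ×ˢ Set.Icc y₀ y₁, f z = rectInt f x₀ x₁ y₀ y₁ := by
  rw [Measure.volume_eq_prod, setIntegral_prod]
  · rw [rectInt, intervalIntegral.integral_of_le hx, integral_Icc_eq_integral_Ioc]
    refine integral_congr_ae (Filter.Eventually.of_forall fun s => ?_)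
    simp only
    rw [intervalIntegral.integral_of_le hy, integral_Icc_eq_integral_Ioc]
  · rw [← Measure.volume_eq_prod]
    exact hf.continuousOn.integrableOn_compact (isCompact_Icc.prod isCompact_Icc)

lemma continuous_integral_right (hf : Continuous f) (y₀ y₁ : ℝ) :
    Continuous fun s => ∫ t in y₀..y₁, f (s, t) :=
  intervalIntegral.continuous_parametric_intervalIntegral_of_continuous'
    (f := fun s t => f (s, t)) hf _ _

lemma continuous_integral_left (hf : Continuous f) (x₀ x₁ : ℝ) :
    Continuous fun t => ∫ s in x₀..x₁, f (s, t) :=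
  intervalIntegral.continuous_parametric_intervalIntegral_of_continuous'
    (f := fun t s => f (s, t)) (hf.comp continuous_swap) _ _

lemma sq_integral_abs_le {g : ℝ → ℝ} (hg : Continuous g) {x₀ x₁ : ℝ} (h : x₀ < x₁) :
    (∫ s in x₀..x₁, |g s|) ^ 2 ≤ (x₁ - x₀) * ∫ s in x₀..x₁, g s ^ 2 := by
  have hd : 0 < x₁ - x₀ := sub_pos.2 h
  set M := ∫ s in x₀..x₁, |g s| with hM
  have h0 : 0 ≤ ∫ s in x₀..x₁, (|g s| - M / (x₁ - x₀)) ^ 2 :=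
    intervalIntegral.integral_nonneg h.le fun _ _ => sq_nonneg _
  have h1 : ∀ s, (|g s| - M / (x₁ - x₀)) ^ 2 =
      g s ^ 2 - 2 * (M / (x₁ - x₀)) * |g s| + (M / (x₁ - x₀)) ^ 2 := by
    intro s
    rw [sub_sq, sq_abs]; ring
  simp_rw [h1] at h0
  rw [intervalIntegral.integral_add
      (Continuous.intervalIntegrable (by fun_prop) _ _)
      (Continuous.intervalIntegrable (by fun_prop) _ _),
    intervalIntegral.integral_sub (Continuous.intervalIntegrable (by fun_prop) _ _)
      (Continuous.intervalIntegrable (by fun_prop) _ _),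
    intervalIntegral.integral_const_mul, intervalIntegral.integral_const, ← hM,
    smul_eq_mul] at h0
  have h2 : (x₁ - x₀) * (M / (x₁ - x₀)) ^ 2 = M ^ 2 / (x₁ - x₀) := by field_simp
  have h3 : 2 * (M / (x₁ - x₀)) * M = 2 * (M ^ 2 / (x₁ - x₀)) := by ring
  rw [h2, h3] at h0
  have h4 : M ^ 2 / (x₁ - x₀) ≤ ∫ s in x₀..x₁, g s ^ 2 := by linarith
  rwa [div_le_iff₀' hd] at h4

end calculus

/-! ### Tensor-product interpolation on a cell -/

/-- The tensor-product Lagrange interpolant of `f` on `[x₀, x₁] × [y₀, y₁]`. -/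
noncomputable def cellInterp (r : ℕ) (x₀ x₁ y₀ y₁ : ℝ) (f : ℝ × ℝ → ℝ) (z : ℝ × ℝ) : ℝ :=
  ∑ k ∈ Finset.range (r + 1), ∑ l ∈ Finset.range (r + 1),
    f (interpNode r x₀ x₁ k, interpNode r y₀ y₁ l) *
      ((nodal r x₀ x₁ k).eval z.1 * (nodal r y₀ y₁ l).eval z.2)

section interp

variable {r : ℕ} {x₀ x₁ y₀ y₁ : ℝ} {f : ℝ × ℝ → ℝ}

lemma contDiff_cellInterp {n : WithTop ℕ∞} : ContDiff ℝ n (cellInterp r x₀ x₁ y₀ y₁ f) := by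
  unfold cellInterp
  refine ContDiff.sum fun k _ => ContDiff.sum fun l _ => contDiff_const.mul (ContDiff.mul ?_ ?_)
  · exact (nodal r x₀ x₁ k).contDiff_aeval n |>.comp contDiff_fst
  · exact (nodal r y₀ y₁ l).contDiff_aeval n |>.comp contDiff_snd

lemma pdx_cellInterp (x y : ℝ) :
    pdx (cellInterp r x₀ x₁ y₀ y₁ f) (x, y) =
      ∑ k ∈ Finset.range (r + 1), ∑ l ∈ Finset.range (r + 1),
        f (interpNode r x₀ x₁ k, interpNode r y₀ y₁ l) *
          ((derivative (nodal r x₀ x₁ k)).eval x * (nodal r y₀ y₁ l).eval y) := by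
  refine (hasDerivAt_pdx (contDiff_cellInterp.differentiable one_ne_zero) x y).unique ?_
  refine HasDerivAt.fun_sum fun k _ => HasDerivAt.fun_sum fun l _ => ?_
  exact (((nodal r x₀ x₁ k).hasDerivAt x).mul_const ((nodal r y₀ y₁ l).eval y)).const_mul
    (f (interpNode r x₀ x₁ k, interpNode r y₀ y₁ l))

lemma cellInterp_comp_swap :
    cellInterp r y₀ y₁ x₀ x₁ (f ∘ Prod.swap) = cellInterp r x₀ x₁ y₀ y₁ f ∘ Prod.swap := by
  funext z
  simp only [cellInterp, Function.comp_apply, Prod.swap_prod_mk, Prod.fst_swap, Prod.snd_swap]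
  rw [Finset.sum_comm]
  exact Finset.sum_congr rfl fun k _ => Finset.sum_congr rfl fun l _ => by ring

lemma abs_pdx_sub_cellInterp_le {K : ℝ} (hK : InterpBound r K) (hx : x₀ < x₁) (hy : y₀ < y₁)
    (hf : ContDiff ℝ (r + 1 : ℕ) f) {x y : ℝ} (hxm : x ∈ Set.Icc x₀ x₁)
    (hym : y ∈ Set.Icc y₀ y₁) :
    |pdx f (x, y) - pdx (cellInterp r x₀ x₁ y₀ y₁ f) (x, y)| ≤
      K * (x₁ - x₀) ^ (r - 1) * (∫ s in x₀..x₁, |pdx^[r + 1] f (s, y)|) +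
      K / (x₁ - x₀) * (K * (y₁ - y₀) ^ (r - 1)) *
        ∫ s in x₀..x₁, ∫ t in y₀..y₁, |pdy^[r] (pdx f) (s, t)| := by
  have hdf : Differentiable ℝ f := hf.differentiable (by norm_cast)
  have hpf : ContDiff ℝ r (pdx f) := contDiff_pdx hf
  have hdx : ∀ k ≤ r, Differentiable ℝ (pdx^[k] f) := fun k hk =>
    (contDiff_iterate_pdx (n := 1) k (hf.of_le (by norm_cast; omega))).differentiable one_ne_zero
  have hdy : ∀ k < r, Differentiable ℝ (pdy^[k] (pdx f)) := fun k hk =>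
    (contDiff_iterate_pdy (n := 1) k (hpf.of_le (by norm_cast; omega))).differentiable one_ne_zero
  have hcx : Continuous (pdx^[r + 1] f) :=
    (contDiff_iterate_pdx (n := 0) (r + 1) (hf.of_le (by norm_cast; omega))).continuous
  have hcy : Continuous (pdy^[r] (pdx f)) :=
    (contDiff_iterate_pdy (n := 0) r (hpf.of_le (by norm_cast; omega))).continuous
  have hderiv := hK.deriv x₀ x₁ hx (fun k s => pdx^[k] f (s, y))
    (fun k hk s => by
      simp only [Function.iterate_succ_apply']
      exact hasDerivAt_pdx (hdx k hk) s y)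
    (hcx.comp (by fun_prop)) x hxm
  have hval : ∀ s, |pdx f (s, y) - ∑ l ∈ Finset.range (r + 1),
      pdx f (s, interpNode r y₀ y₁ l) * (nodal r y₀ y₁ l).eval y| ≤
      K * (y₁ - y₀) ^ (r - 1) * ∫ t in y₀..y₁, |pdy^[r] (pdx f) (s, t)| := fun s =>
    hK.value y₀ y₁ hy (fun k t => pdy^[k] (pdx f) (s, t))
      (fun k hk t => by
        simp only [Function.iterate_succ_apply']
        exact hasDerivAt_pdy (hdy k hk) s t)
      (hcy.comp (by fun_prop)) y hym
  have hpc : Continuous (pdx f) := hpf.continuous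
  have hψc : Continuous fun s => pdx f (s, y) - ∑ l ∈ Finset.range (r + 1),
      pdx f (s, interpNode r y₀ y₁ l) * (nodal r y₀ y₁ l).eval y := by fun_prop
  have hstab := hK.stable x₀ x₁ hx
    (fun s => f (s, y) - ∑ l ∈ Finset.range (r + 1),
      f (s, interpNode r y₀ y₁ l) * (nodal r y₀ y₁ l).eval y) _
    (fun s => (hasDerivAt_pdx hdf s y).sub (HasDerivAt.fun_sum fun l _ =>
      (hasDerivAt_pdx hdf s (interpNode r y₀ y₁ l)).mul_const _)) hψc x hxm
  have hmono : (∫ s in x₀..x₁, |pdx f (s, y) - ∑ l ∈ Finset.range (r + 1),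
      pdx f (s, interpNode r y₀ y₁ l) * (nodal r y₀ y₁ l).eval y|) ≤
      K * (y₁ - y₀) ^ (r - 1) * ∫ s in x₀..x₁, ∫ t in y₀..y₁, |pdy^[r] (pdx f) (s, t)| := by
    rw [← intervalIntegral.integral_const_mul]
    exact intervalIntegral.integral_mono_on hx.le (hψc.abs.intervalIntegrable _ _)
      ((continuous_const.mul (continuous_integral_right (f := fun z => |pdy^[r] (pdx f) z|)
        hcy.abs y₀ y₁)).intervalIntegrable _ _) fun s _ => hval s
  have hsplit : pdx f (x, y) - pdx (cellInterp r x₀ x₁ y₀ y₁ f) (x, y) =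
      (pdx f (x, y) - ∑ k ∈ Finset.range (r + 1),
        f (interpNode r x₀ x₁ k, y) * (derivative (nodal r x₀ x₁ k)).eval x) +
      ∑ k ∈ Finset.range (r + 1), (f (interpNode r x₀ x₁ k, y) - ∑ l ∈ Finset.range (r + 1),
        f (interpNode r x₀ x₁ k, interpNode r y₀ y₁ l) * (nodal r y₀ y₁ l).eval y) *
          (derivative (nodal r x₀ x₁ k)).eval x := by
    rw [pdx_cellInterp]
    simp only [sub_mul, Finset.sum_sub_distrib, Finset.sum_mul]
    rw [sub_add_sub_cancel]
    congr 1
    exact Finset.sum_congr rfl fun k _ => Finset.sum_congr rfl fun l _ => by ring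
  rw [hsplit]
  refine (abs_add_le _ _).trans (add_le_add hderiv (hstab.trans ?_))
  rw [mul_assoc]
  exact mul_le_mul_of_nonneg_left hmono (div_nonneg hK.pos.le (by linarith))

lemma sq_rectInt_abs_le (hx : x₀ < x₁) (hy : y₀ < y₁) (hf : Continuous f) :
    (∫ s in x₀..x₁, ∫ t in y₀..y₁, |f (s, t)|) ^ 2 ≤
      (x₁ - x₀) * ((y₁ - y₀) * rectInt (fun z => f z ^ 2) x₀ x₁ y₀ y₁) := by
  have hc := continuous_integral_right (f := fun z => |f z|) hf.abs y₀ y₁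
  have hc2 := continuous_integral_right (f := fun z => f z ^ 2) (hf.pow 2) y₀ y₁
  have h1 := sq_integral_abs_le hc hx
  have h2 : ∀ s, |(∫ t in y₀..y₁, |f (s, t)|)| = ∫ t in y₀..y₁, |f (s, t)| := fun s =>
    abs_of_nonneg (intervalIntegral.integral_nonneg hy.le fun _ _ => abs_nonneg _)
  simp only [h2] at h1
  refine h1.trans (mul_le_mul_of_nonneg_left ?_ (by linarith))
  rw [rectInt, ← intervalIntegral.integral_const_mul]
  exact intervalIntegral.integral_mono_on hx.le ((hc.pow 2).intervalIntegrable _ _)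
    ((continuous_const.mul hc2).intervalIntegrable _ _) fun s _ =>
      sq_integral_abs_le (hf.comp (by fun_prop)) hy

lemma rectInt_nonneg (hx : x₀ ≤ x₁) (hy : y₀ ≤ y₁) (hf : ∀ z, 0 ≤ f z) :
    0 ≤ rectInt f x₀ x₁ y₀ y₁ :=
  intervalIntegral.integral_nonneg hx fun _ _ => intervalIntegral.integral_nonneg hy fun _ _ => hf _

lemma mul_integral_sq_pdx_sub_cellInterp_le {K h σ : ℝ} (hr : 1 ≤ r) (hK : InterpBound r K)
    (hx : x₀ < x₁) (hy : y₀ < y₁) (hxh : x₁ - x₀ ≤ h) (hyh : y₁ - y₀ ≤ h)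
    (hσ : y₁ - y₀ ≤ σ * (x₁ - x₀)) (hf : ContDiff ℝ (r + 1 : ℕ) f) {x : ℝ}
    (hxm : x ∈ Set.Icc x₀ x₁) :
    h * ∫ y in y₀..y₁, (pdx f (x, y) - pdx (cellInterp r x₀ x₁ y₀ y₁ f) (x, y)) ^ 2 ≤
      (2 * K ^ 2 + 2 * K ^ 4 * σ) * (h ^ r) ^ 2 *
        (rectInt (fun z => (pdx^[r + 1] f z) ^ 2) x₀ x₁ y₀ y₁ +
          rectInt (fun z => (pdy^[r] (pdx f) z) ^ 2) x₀ x₁ y₀ y₁) := by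
  have hpf : ContDiff ℝ r (pdx f) := contDiff_pdx hf
  have hcx : Continuous (pdx^[r + 1] f) :=
    (contDiff_iterate_pdx (n := 0) (r + 1) (hf.of_le (by norm_cast; omega))).continuous
  have hcy : Continuous (pdy^[r] (pdx f)) :=
    (contDiff_iterate_pdy (n := 0) r (hpf.of_le (by norm_cast; omega))).continuous
  have hpI : Continuous (pdx (cellInterp r x₀ x₁ y₀ y₁ f)) :=
    (contDiff_pdx (n := 0) contDiff_cellInterp).continuous
  have hpc : Continuous (pdx f) := hpf.continuous
  obtain ⟨q, rfl⟩ := Nat.exists_eq_add_of_le' hr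
  set R₁ := rectInt (fun z => (pdx^[q + 1 + 1] f z) ^ 2) x₀ x₁ y₀ y₁ with hR₁
  set R₂ := rectInt (fun z => (pdy^[q + 1] (pdx f) z) ^ 2) x₀ x₁ y₀ y₁ with hR₂
  have hR₁0 : 0 ≤ R₁ := rectInt_nonneg hx.le hy.le fun _ => sq_nonneg _
  have hR₂0 : 0 ≤ R₂ := rectInt_nonneg hx.le hy.le fun _ => sq_nonneg _
  have hdx : 0 < x₁ - x₀ := sub_pos.2 hx
  have hdy : 0 < y₁ - y₀ := sub_pos.2 hy
  have hh : 0 < h := hdx.trans_le hxh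
  have hKpos := hK.pos
  have hpoint : ∀ y ∈ Set.Icc y₀ y₁,
      (pdx f (x, y) - pdx (cellInterp (q + 1) x₀ x₁ y₀ y₁ f) (x, y)) ^ 2 ≤
      2 * K ^ 2 * (((x₁ - x₀) ^ q) ^ 2 * (x₁ - x₀)) *
        (∫ s in x₀..x₁, (pdx^[q + 1 + 1] f (s, y)) ^ 2) +
      2 * K ^ 4 * (((y₁ - y₀) ^ q) ^ 2 * (y₁ - y₀) / (x₁ - x₀)) * R₂ := by
    intro y hym
    have h1 := abs_pdx_sub_cellInterp_le hK hx hy hf hxm hym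
    have hcs1 := sq_integral_abs_le (g := fun s => pdx^[q + 1 + 1] f (s, y))
      (hcx.comp (by fun_prop)) hx
    have hcs2 := sq_rectInt_abs_le hx hy hcy
    rw [Nat.add_sub_cancel] at h1
    set I₁ := ∫ s in x₀..x₁, |pdx^[q + 1 + 1] f (s, y)|
    set I₂ := ∫ s in x₀..x₁, ∫ t in y₀..y₁, |pdy^[q + 1] (pdx f) (s, t)|
    have h2 := pow_le_pow_left₀ (abs_nonneg _) h1 2
    rw [sq_abs] at h2
    refine h2.trans ((add_sq_le).trans ?_)
    rw [mul_add]
    refine add_le_add ?_ ?_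
    · calc 2 * (K * (x₁ - x₀) ^ q * I₁) ^ 2 = 2 * K ^ 2 * ((x₁ - x₀) ^ q) ^ 2 * I₁ ^ 2 := by ring
        _ ≤ 2 * K ^ 2 * ((x₁ - x₀) ^ q) ^ 2 *
            ((x₁ - x₀) * ∫ s in x₀..x₁, (pdx^[q + 1 + 1] f (s, y)) ^ 2) :=
          mul_le_mul_of_nonneg_left hcs1 (by positivity)
        _ = _ := by ring
    · calc 2 * (K / (x₁ - x₀) * (K * (y₁ - y₀) ^ q) * I₂) ^ 2 =
            2 * K ^ 4 * ((y₁ - y₀) ^ q) ^ 2 / (x₁ - x₀) ^ 2 * I₂ ^ 2 := by field_simp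
        _ ≤ 2 * K ^ 4 * ((y₁ - y₀) ^ q) ^ 2 / (x₁ - x₀) ^ 2 *
            ((x₁ - x₀) * ((y₁ - y₀) * R₂)) :=
          mul_le_mul_of_nonneg_left hcs2 (by positivity)
        _ = _ := by field_simp
  have hcI := continuous_integral_left (f := fun z => (pdx^[q + 1 + 1] f z) ^ 2) (hcx.pow 2) x₀ x₁
  have hintegral : (∫ y in y₀..y₁,
      (pdx f (x, y) - pdx (cellInterp (q + 1) x₀ x₁ y₀ y₁ f) (x, y)) ^ 2) ≤
      2 * K ^ 2 * (((x₁ - x₀) ^ q) ^ 2 * (x₁ - x₀)) * R₁ +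
      (y₁ - y₀) * (2 * K ^ 4 * (((y₁ - y₀) ^ q) ^ 2 * (y₁ - y₀) / (x₁ - x₀)) * R₂) := by
    refine (intervalIntegral.integral_mono_on hy.le
      (Continuous.intervalIntegrable (by fun_prop) _ _)
      (Continuous.intervalIntegrable (by fun_prop) _ _) hpoint).trans_eq ?_
    rw [intervalIntegral.integral_add (Continuous.intervalIntegrable (by fun_prop) _ _)
      (Continuous.intervalIntegrable (by fun_prop) _ _), intervalIntegral.integral_const_mul,
      intervalIntegral.integral_const, smul_eq_mul, hR₁,
      rectInt_swap (f := fun z => (pdx^[q + 1 + 1] f z) ^ 2) (hcx.pow 2)]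
  have hpx : ((x₁ - x₀) ^ q) ^ 2 * (x₁ - x₀) * h ≤ (h ^ (q + 1)) ^ 2 := by
    calc ((x₁ - x₀) ^ q) ^ 2 * (x₁ - x₀) * h ≤ (h ^ q) ^ 2 * h * h := by gcongr
      _ = _ := by ring
  have hpy : ((y₁ - y₀) ^ q) ^ 2 * (y₁ - y₀) * h ≤ (h ^ (q + 1)) ^ 2 := by
    calc ((y₁ - y₀) ^ q) ^ 2 * (y₁ - y₀) * h ≤ (h ^ q) ^ 2 * h * h := by gcongr
      _ = _ := by ring
  have hσ' : (y₁ - y₀) / (x₁ - x₀) ≤ σ := by rwa [div_le_iff₀ hdx]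
  have hσ0 : 0 ≤ σ := (by positivity : 0 ≤ (y₁ - y₀) / (x₁ - x₀)).trans hσ'
  calc _ ≤ h * (2 * K ^ 2 * (((x₁ - x₀) ^ q) ^ 2 * (x₁ - x₀)) * R₁ +
        (y₁ - y₀) * (2 * K ^ 4 * (((y₁ - y₀) ^ q) ^ 2 * (y₁ - y₀) / (x₁ - x₀)) * R₂)) :=
        mul_le_mul_of_nonneg_left hintegral hh.le
    _ = 2 * K ^ 2 * R₁ * (((x₁ - x₀) ^ q) ^ 2 * (x₁ - x₀) * h) +
        2 * K ^ 4 * R₂ * ((((y₁ - y₀) ^ q) ^ 2 * (y₁ - y₀) * h) * ((y₁ - y₀) / (x₁ - x₀))) := by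
      ring
    _ ≤ 2 * K ^ 2 * R₁ * (h ^ (q + 1)) ^ 2 + 2 * K ^ 4 * R₂ * ((h ^ (q + 1)) ^ 2 * σ) := by
      gcongr
    _ ≤ 2 * K ^ 2 * R₁ * (h ^ (q + 1)) ^ 2 + 2 * K ^ 4 * R₂ * ((h ^ (q + 1)) ^ 2 * σ) +
        (2 * K ^ 2 * R₂ * (h ^ (q + 1)) ^ 2 + 2 * K ^ 4 * R₁ * ((h ^ (q + 1)) ^ 2 * σ)) :=
      le_add_of_nonneg_right (by positivity)
    _ = _ := by ring

/-- The local contribution of a cell to the broken seminorm of order `r + 1`, squared. -/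
noncomputable def cellSemiSq (r : ℕ) (x₀ x₁ y₀ y₁ : ℝ) (f : ℝ × ℝ → ℝ) : ℝ :=
  ∑ t ∈ Finset.range (r + 1 + 1),
    rectInt (fun z => (pdx^[t] (pdy^[r + 1 - t] f) z) ^ 2) x₀ x₁ y₀ y₁

lemma cellSemiSq_nonneg (hx : x₀ ≤ x₁) (hy : y₀ ≤ y₁) : 0 ≤ cellSemiSq r x₀ x₁ y₀ y₁ f :=
  Finset.sum_nonneg fun _ _ => rectInt_nonneg hx hy fun _ => sq_nonneg _

lemma add_le_cellSemiSq (hx : x₀ ≤ x₁) (hy : y₀ ≤ y₁) {t t' : ℕ} (ht : t ≤ r + 1)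
    (ht' : t' ≤ r + 1) (hne : t ≠ t') :
    rectInt (fun z => (pdx^[t] (pdy^[r + 1 - t] f) z) ^ 2) x₀ x₁ y₀ y₁ +
      rectInt (fun z => (pdx^[t'] (pdy^[r + 1 - t'] f) z) ^ 2) x₀ x₁ y₀ y₁ ≤
      cellSemiSq r x₀ x₁ y₀ y₁ f := by
  rw [← Finset.sum_pair (f := fun t => rectInt (fun z => (pdx^[t] (pdy^[r + 1 - t] f) z) ^ 2)
    x₀ x₁ y₀ y₁) hne]
  refine Finset.sum_le_sum_of_subset_of_nonneg ?_ fun _ _ _ =>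
    rectInt_nonneg hx hy fun _ => sq_nonneg _
  intro i hi
  simp only [Finset.mem_insert, Finset.mem_singleton] at hi
  simp only [Finset.mem_range]
  omega

lemma rectInt_comp_swap (hf : Continuous f) :
    rectInt (f ∘ Prod.swap) y₀ y₁ x₀ x₁ = rectInt f x₀ x₁ y₀ y₁ :=
  (rectInt_swap hf x₀ x₁ y₀ y₁).symm

/-- Interpolation error bounds for the gradient along the lines of a cell. -/
lemma exists_integral_sq_sub_cellInterp_le (hr : 1 ≤ r) {σ : ℝ} (hσ : 0 ≤ σ) :
    ∃ K : ℝ, 0 < K ∧ ∀ x₀ x₁ y₀ y₁ h : ℝ, x₀ < x₁ → y₀ < y₁ → x₁ - x₀ ≤ h → y₁ - y₀ ≤ h →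
      y₁ - y₀ ≤ σ * (x₁ - x₀) → x₁ - x₀ ≤ σ * (y₁ - y₀) →
      ∀ f : ℝ × ℝ → ℝ, ContDiff ℝ (r + 1 : ℕ) f →
      (∀ x ∈ Set.Icc x₀ x₁,
        h * ∫ y in y₀..y₁, (pdx f (x, y) - pdx (cellInterp r x₀ x₁ y₀ y₁ f) (x, y)) ^ 2 ≤
          K * (h ^ r) ^ 2 * cellSemiSq r x₀ x₁ y₀ y₁ f) ∧
      (∀ y ∈ Set.Icc y₀ y₁,
        h * ∫ x in x₀..x₁, (pdy f (x, y) - pdy (cellInterp r x₀ x₁ y₀ y₁ f) (x, y)) ^ 2 ≤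
          K * (h ^ r) ^ 2 * cellSemiSq r x₀ x₁ y₀ y₁ f) := by
  obtain ⟨K, hK⟩ := exists_interpBound hr
  have hKpos := hK.pos
  refine ⟨2 * K ^ 2 + 2 * K ^ 4 * σ, by positivity, ?_⟩
  intro x₀ x₁ y₀ y₁ h hx hy hxh hyh hσ₁ hσ₂ f hf
  have hdf : Differentiable ℝ f := hf.differentiable (by norm_cast)
  have hfs : ContDiff ℝ (r + 1 : ℕ) (f ∘ Prod.swap) :=
    hf.comp (ContinuousLinearEquiv.prodComm ℝ ℝ ℝ).contDiff
  have hcx : Continuous (pdx^[r] (pdy f)) := (contDiff_iterate_pdx (n := 0) r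
    ((contDiff_pdy hf).of_le (by norm_cast; omega))).continuous
  have hcy : Continuous (pdy^[r + 1] f) :=
    (contDiff_iterate_pdy (n := 0) (r + 1) (hf.of_le (by norm_cast; omega))).continuous
  constructor
  · intro x hxm
    refine (mul_integral_sq_pdx_sub_cellInterp_le hr hK hx hy hxh hyh hσ₁ hf hxm).trans
      (mul_le_mul_of_nonneg_left ?_ (by positivity))
    have := add_le_cellSemiSq (r := r) (f := f) hx.le hy.le (t := r + 1) (t' := 1) le_rfl
      (by omega) (by omega)
    rw [iterate_pdy_pdx r hf]
    simpa using this
  · intro y hym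
    have h1 := mul_integral_sq_pdx_sub_cellInterp_le hr hK hy hx hyh hxh hσ₂ hfs hym
    rw [cellInterp_comp_swap, pdx_comp_swap hdf,
      pdx_comp_swap (contDiff_cellInterp.differentiable one_ne_zero),
      iterate_pdx_comp_swap _ hf, iterate_pdy_comp_swap _ (contDiff_pdy hf)] at h1
    refine h1.trans (mul_le_mul_of_nonneg_left ?_ (by positivity))
    have := add_le_cellSemiSq (r := r) (f := f) hx.le hy.le (t := 0) (t' := r) (by omega)
      (by omega) (by omega)
    simp only [Function.iterate_zero, id_eq, tsub_zero, Nat.add_sub_cancel_left,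
      Function.iterate_one] at this
    rw [← rectInt_comp_swap (f := fun z => (pdy^[r + 1] f z) ^ 2) (hcy.pow 2),
      ← rectInt_comp_swap (f := fun z => (pdx^[r] (pdy f) z) ^ 2) (hcx.pow 2)] at this
    exact this

end interp

/-! ### Regrouping sums over dual volumes into sums over cells -/

lemma sum_Icc_one_eq_sum_range (f : ℕ → ℝ) (m : ℕ) :
    ∑ i ∈ Finset.Icc 1 m, f i = ∑ i ∈ Finset.range m, f (i + 1) := by
  induction m with
  | zero => simp
  | succ m ih => rw [Finset.sum_Icc_succ_top (by omega), Finset.sum_range_succ, ih]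

lemma sum_range_succ_eq_add_sum_Icc (f : ℕ → ℝ) (r : ℕ) :
    ∑ k ∈ Finset.range (r + 1), f k = f 0 + ∑ k ∈ Finset.Icc 1 r, f k := by
  rw [Finset.sum_range_succ', sum_Icc_one_eq_sum_range, add_comm]

/-- Contributions from the right end of each cell match those from the left end of the next. -/
lemma sum_Icc_eq_of_shift {m : ℕ} (hm : 0 < m) {p q : ℕ → ℝ} (hq : q 1 = 0) (hp : p m = 0)
    (h : ∀ i, 1 ≤ i → i < m → p i = q (i + 1)) :
    ∑ i ∈ Finset.Icc 1 m, p i = ∑ i ∈ Finset.Icc 1 m, q i := by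
  obtain ⟨m, rfl⟩ := Nat.exists_eq_add_of_le' hm
  rw [Finset.sum_Icc_succ_top (by omega), hp, add_zero, sum_Icc_one_eq_sum_range q,
    Finset.sum_range_succ', hq, add_zero, sum_Icc_one_eq_sum_range]
  exact Finset.sum_congr rfl fun i hi => h _ (by omega) (by simpa using hi)

/-- The Gauss points of a one-dimensional partition, in the indexing of the dual mesh. -/
noncomputable def lineNode (m : ℕ) (x : ℕ → ℝ) (r : ℕ) (G : ℕ → ℝ) (i k : ℕ) : ℝ :=
  if k = r + 1 then
    (if i = m then x m else (x (i + 1) + x i + (x (i + 1) - x i) * G 1) / 2)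
  else (x i + x (i - 1) + (x i - x (i - 1)) * G k) / 2

section line

variable {m r : ℕ} {x G : ℕ → ℝ}

lemma cellNode_zero (x₀ x₁ : ℝ) : cellNode r G x₀ x₁ 0 = x₀ := by simp [cellNode]

lemma cellNode_last (x₀ x₁ : ℝ) : cellNode r G x₀ x₁ (r + 1) = x₁ := by simp [cellNode]

lemma cellNode_of_mem (x₀ x₁ : ℝ) {k : ℕ} (hk : k ∈ Finset.Icc 1 r) :
    cellNode r G x₀ x₁ k = gaussNode G x₀ x₁ k := by
  rw [Finset.mem_Icc] at hk
  rw [cellNode, if_neg (by omega), if_neg (by omega)]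

lemma lineNode_of_mem {i k : ℕ} (hk : k ∈ Finset.Icc 1 r) :
    lineNode m x r G i k = gaussNode G (x (i - 1)) (x i) k := by
  rw [Finset.mem_Icc] at hk
  rw [lineNode, if_neg (by omega), gaussNode]

lemma lineNode_last {i : ℕ} (hi : i ≠ m) :
    lineNode m x r G i (r + 1) = gaussNode G (x i) (x (i + 1)) 1 := by
  rw [lineNode, if_pos rfl, if_neg hi, gaussNode]

lemma min_lineNode_succ (hG : IsGaussPoints r G) (hr : 1 ≤ r) (hx : ∀ i < m, x i < x (i + 1))
    {i k : ℕ} (hi : i ∈ Finset.Icc 1 m) (hk : k ∈ Finset.Icc 1 r) :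
    min (lineNode m x r G i (k + 1)) (x i) = cellNode r G (x (i - 1)) (x i) (k + 1) := by
  rw [Finset.mem_Icc] at hi hk
  have hlt : x (i - 1) < x i := by simpa [Nat.sub_add_cancel hi.1] using hx (i - 1) (by omega)
  rcases hk.2.eq_or_lt with rfl | hkr
  · rw [cellNode_last]
    by_cases him : i = m
    · subst him; simp [lineNode]
    · rw [lineNode_last him]
      exact min_eq_right (hG.gaussNode_mem_Ioo (hx i (by omega)) (by simp [hr])).1.le
  · have hk1 : k + 1 ∈ Finset.Icc 1 r := by simp; omega
    rw [lineNode_of_mem hk1, cellNode_of_mem _ _ hk1]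
    exact min_eq_left (hG.gaussNode_mem_Ioo hlt hk1).2.le

lemma max_lineNode_succ (hG : IsGaussPoints r G) (hx : ∀ i < m, x i < x (i + 1))
    {i k : ℕ} (hi : i ∈ Finset.Icc 1 m) (hkr : k < r) :
    max (lineNode m x r G i (k + 1)) (x i) = x i := by
  rw [Finset.mem_Icc] at hi
  have hlt : x (i - 1) < x i := by simpa [Nat.sub_add_cancel hi.1] using hx (i - 1) (by omega)
  have hk1 : k + 1 ∈ Finset.Icc 1 r := by simp; omega
  rw [lineNode_of_mem hk1]
  exact max_eq_right (hG.gaussNode_mem_Ioo hlt hk1).2.le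

lemma max_lineNode_last (hG : IsGaussPoints r G) (hr : 1 ≤ r) (hx : ∀ i < m, x i < x (i + 1))
    {i : ℕ} (hi : i < m) :
    max (lineNode m x r G i (r + 1)) (x i) = cellNode r G (x i) (x (i + 1)) 1 := by
  have h1 : 1 ∈ Finset.Icc 1 r := by simp [hr]
  rw [lineNode_last hi.ne, cellNode_of_mem _ _ h1]
  exact max_eq_left (hG.gaussNode_mem_Ioo (hx i hi) h1).1.le

lemma sum_dual_eq_sum_cell (hG : IsGaussPoints r G) (hr : 1 ≤ r) (hx : ∀ i < m, x i < x (i + 1))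
    (hm : 0 < m) {J : ℕ → ℕ → ℝ} (hJ0 : J 1 0 = 0)
    (hJs : ∀ i, 1 ≤ i → i < m → J i r = J (i + 1) 0) (hJm : J m r = 0)
    {H : ℕ → ℝ → ℝ → ℝ} (hH : ∀ i s, H i s s = 0) :
    ∑ i ∈ Finset.Icc 1 m, ∑ k ∈ Finset.Icc 1 r, J i k *
      (H i (lineNode m x r G i k) (min (lineNode m x r G i (k + 1)) (x i)) +
        H (i + 1) (x i) (max (lineNode m x r G i (k + 1)) (x i))) =
    ∑ i ∈ Finset.Icc 1 m, ∑ k ∈ Finset.range (r + 1), J i k *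
      H i (cellNode r G (x (i - 1)) (x i) k) (cellNode r G (x (i - 1)) (x i) (k + 1)) := by
  have hL : ∀ i ∈ Finset.Icc 1 m, ∑ k ∈ Finset.Icc 1 r, J i k *
      (H i (lineNode m x r G i k) (min (lineNode m x r G i (k + 1)) (x i)) +
        H (i + 1) (x i) (max (lineNode m x r G i (k + 1)) (x i))) =
      (∑ k ∈ Finset.Icc 1 r, J i k *
        H i (cellNode r G (x (i - 1)) (x i) k) (cellNode r G (x (i - 1)) (x i) (k + 1))) +
      J i r * H (i + 1) (x i) (max (lineNode m x r G i (r + 1)) (x i)) := by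
    intro i hi
    simp only [mul_add, Finset.sum_add_distrib]
    congr 1
    · refine Finset.sum_congr rfl fun k hk => ?_
      rw [min_lineNode_succ hG hr hx hi hk, lineNode_of_mem hk, cellNode_of_mem _ _ hk]
    · refine Finset.sum_eq_single r (fun k hk hkr => ?_) (fun h => absurd (by simp [hr]) h)
      rw [max_lineNode_succ hG hx hi (by simp at hk; omega), hH, mul_zero]
  rw [Finset.sum_congr rfl hL]
  simp only [sum_range_succ_eq_add_sum_Icc _ r]
  rw [Finset.sum_add_distrib, Finset.sum_add_distrib, add_comm]
  congr 1
  refine sum_Icc_eq_of_shift hm (by rw [hJ0, zero_mul]) (by rw [hJm, zero_mul]) fun i hi him => ?_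
  rw [hJs i hi him, max_lineNode_last hG hr hx him, cellNode_zero, Nat.add_sub_cancel]

end line

lemma RectPartition.gx_eq {a b c d : ℝ} (P : RectPartition a b c d) (r : ℕ) (G : ℕ → ℝ)
    (i k : ℕ) : P.gx r G i k = lineNode P.m P.x r G i k := rfl

lemma RectPartition.gy_eq {a b c d : ℝ} (P : RectPartition a b c d) (r : ℕ) (G : ℕ → ℝ)
    (j l : ℕ) : P.gy r G j l = lineNode P.n P.y r G j l := rfl

section testFun

variable {a b c d : ℝ} {P : RectPartition a b c d} {r : ℕ} {w : ℕ → ℕ → ℕ → ℕ → ℝ}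

lemma wE_left_boundary (j l : ℕ) : wE r w 1 0 j l = 0 := by simp [wE]

lemma wE_bottom_boundary (i k : ℕ) : wE r w i k 1 0 = 0 := by simp [wE]

lemma wE_of_pos {i k j l : ℕ} (hk : k ∈ Finset.Icc 1 r) (hl : l ∈ Finset.Icc 1 r) :
    wE r w i k j l = w i k j l := by
  rw [Finset.mem_Icc] at hk hl
  have h1 : k ≠ 0 := by omega
  have h2 : l ≠ 0 := by omega
  simp [wE, h1, h2]

lemma wE_succ_left (hr : 1 ≤ r) {i : ℕ} (hi : 1 ≤ i) (j l : ℕ) :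
    wE r w i r j l = wE r w (i + 1) 0 j l := by
  have h1 : r ≠ 0 := by omega
  have h2 : i ≠ 0 := by omega
  simp [wE, h1, h2]

lemma wE_succ_bottom (hr : 1 ≤ r) {j : ℕ} (hj : 1 ≤ j) (i k : ℕ) :
    wE r w i k j r = wE r w i k (j + 1) 0 := by
  have h1 : r ≠ 0 := by omega
  have h2 : j ≠ 0 := by omega
  simp [wE, h1, h2]

lemma wE_right_boundary (hr : 1 ≤ r) (hw : IsTestFun r P w) {j l : ℕ} (hj : j ∈ Finset.Icc 1 P.n)
    (hl : l ≤ r) : wE r w P.m r j l = 0 := by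
  have h1 : r ≠ 0 := by omega
  rw [Finset.mem_Icc] at hj
  rw [wE]
  split_ifs with h
  · rfl
  · exact hw.1 _ (by simp; omega) _ (by simp; omega)
  · exact hw.1 _ (by simp; omega) _ (by simp; omega)

lemma wE_top_boundary (hr : 1 ≤ r) (hw : IsTestFun r P w) {i k : ℕ} (hi : i ∈ Finset.Icc 1 P.m)
    (hk : k ≤ r) : wE r w i k P.n r = 0 := by
  have h1 : r ≠ 0 := by omega
  rw [Finset.mem_Icc] at hi
  rw [wE]
  split_ifs with h
  · rfl
  · exact hw.2 _ (by simp; omega) _ (by simp; omega)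
  · exact hw.2 _ (by simp; omega) _ (by simp; omega)

end testFun

/-! ### The bilinear form and the load functional as sums over cells -/

/-- The contribution of one cell to the bilinear form when the coefficient is `1`. -/
noncomputable def cellForm (r : ℕ) (G : ℕ → ℝ) (x₀ x₁ y₀ y₁ : ℝ) (Dx Dy : ℝ × ℝ → ℝ)
    (W : ℕ → ℕ → ℝ) : ℝ :=
  (∑ k ∈ Finset.Icc 1 r, ∑ l ∈ Finset.range (r + 1), (W k l - W (k - 1) l) *
    ∫ t in (cellNode r G y₀ y₁ l)..(cellNode r G y₀ y₁ (l + 1)), Dx (gaussNode G x₀ x₁ k, t)) +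
  ∑ l ∈ Finset.Icc 1 r, ∑ k ∈ Finset.range (r + 1), (W k l - W k (l - 1)) *
    ∫ s in (cellNode r G x₀ x₁ k)..(cellNode r G x₀ x₁ (k + 1)), Dy (s, gaussNode G y₀ y₁ l)

/-- The contribution of one cell to the load functional. -/
noncomputable def cellLoad (r : ℕ) (G : ℕ → ℝ) (x₀ x₁ y₀ y₁ : ℝ) (f : ℝ × ℝ → ℝ)
    (W : ℕ → ℕ → ℝ) : ℝ :=
  ∑ k ∈ Finset.range (r + 1), ∑ l ∈ Finset.range (r + 1), W k l *
    rectInt f (cellNode r G x₀ x₁ k) (cellNode r G x₀ x₁ (k + 1))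
      (cellNode r G y₀ y₁ l) (cellNode r G y₀ y₁ (l + 1))

namespace RectPartition

variable {a b c d : ℝ} (P : RectPartition a b c d)

lemma x_pred_lt {i : ℕ} (hi : i ∈ Finset.Icc 1 P.m) : P.x (i - 1) < P.x i := by
  rw [Finset.mem_Icc] at hi
  simpa [Nat.sub_add_cancel hi.1] using P.hxlt (i - 1) (by omega)

lemma y_pred_lt {j : ℕ} (hj : j ∈ Finset.Icc 1 P.n) : P.y (j - 1) < P.y j := by
  rw [Finset.mem_Icc] at hj
  simpa [Nat.sub_add_cancel hj.1] using P.hylt (j - 1) (by omega)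

lemma le_of_forall_lt_succ {m : ℕ} {x : ℕ → ℝ} (hx : ∀ i < m, x i < x (i + 1)) {i j : ℕ}
    (hij : i ≤ j) (hj : j ≤ m) : x i ≤ x j := by
  induction j, hij using Nat.le_induction with
  | base => exact le_rfl
  | succ j hij ih => exact (ih (by omega)).trans (hx j (by omega)).le

lemma x_mem {i : ℕ} (hi : i ≤ P.m) : P.x i ∈ Set.Icc a b :=
  ⟨P.hxa.ge.trans (le_of_forall_lt_succ P.hxlt (Nat.zero_le _) hi),
    (le_of_forall_lt_succ P.hxlt hi le_rfl).trans P.hxb.le⟩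

lemma y_mem {j : ℕ} (hj : j ≤ P.n) : P.y j ∈ Set.Icc c d :=
  ⟨P.hyc.ge.trans (le_of_forall_lt_succ P.hylt (Nat.zero_le _) hj),
    (le_of_forall_lt_succ P.hylt hj le_rfl).trans P.hyd.le⟩

lemma cell_subset_dom {i j : ℕ} (hi : i ∈ Finset.Icc 1 P.m) (hj : j ∈ Finset.Icc 1 P.n) :
    P.cell i j ⊆ P.dom := by
  rw [Finset.mem_Icc] at hi hj
  exact Set.prod_mono
    (Set.Icc_subset_Icc (P.x_mem (i := i - 1) (by omega)).1 (P.x_mem hi.2).2)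
    (Set.Icc_subset_Icc (P.y_mem (j := j - 1) (by omega)).1 (P.y_mem hj.2).2)

lemma openCell_subset_cell (i j : ℕ) : P.openCell i j ⊆ P.cell i j :=
  Set.prod_mono Set.Ioo_subset_Icc_self Set.Ioo_subset_Icc_self

lemma cell_subset_closure_openCell {i j : ℕ} (hi : i ∈ Finset.Icc 1 P.m)
    (hj : j ∈ Finset.Icc 1 P.n) : P.cell i j ⊆ closure (P.openCell i j) := by
  rw [openCell, closure_prod_eq, closure_Ioo (P.x_pred_lt hi).ne, closure_Ioo (P.y_pred_lt hj).ne]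
  exact subset_rfl

/-- `κ i j` is the value of `α` on the open cell `(i, j)`. -/
def IsCellValue (α : ℝ × ℝ → ℝ) (κ : ℕ → ℕ → ℝ) : Prop :=
  ∀ i ∈ Finset.Icc 1 P.m, ∀ j ∈ Finset.Icc 1 P.n, ∀ z ∈ P.openCell i j, α z = κ i j

end RectPartition

section regroup

variable {a b c d : ℝ} {P : RectPartition a b c d} {r : ℕ} {G : ℕ → ℝ} {w : ℕ → ℕ → ℕ → ℕ → ℝ}
  {α : ℝ × ℝ → ℝ} {κ : ℕ → ℕ → ℝ}

lemma exists_isCellValue (hα : PiecewiseConstant P α) : ∃ κ, P.IsCellValue α κ := by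
  classical
  refine ⟨fun i j => if h : i ∈ Finset.Icc 1 P.m ∧ j ∈ Finset.Icc 1 P.n then
    (hα i h.1 j h.2).choose else 0, fun i hi j hj z hz => ?_⟩
  simp only [hi, hj, and_self, dite_true]
  exact (hα i hi j hj).choose_spec z hz

lemma integral_cellNode_congr (hG : IsGaussPoints r G) {y₀ y₁ : ℝ} (hy : y₀ < y₁) {l : ℕ}
    (hl : l ∈ Finset.range (r + 1)) {f g : ℝ → ℝ} (h : ∀ t ∈ Set.Ioo y₀ y₁, f t = g t) :
    ∫ t in (cellNode r G y₀ y₁ l)..(cellNode r G y₀ y₁ (l + 1)), f t =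
      ∫ t in (cellNode r G y₀ y₁ l)..(cellNode r G y₀ y₁ (l + 1)), g t := by
  have hl' : l < r + 1 := Finset.mem_range.1 hl
  have h1 := hG.cellNode_mem_Icc hy (k := l) (by omega)
  have h2 := hG.cellNode_mem_Icc hy (k := l + 1) (by omega)
  refine intervalIntegral.integral_congr_uIoo fun t ht => h t ⟨?_, ?_⟩
  · exact (le_min h1.1 h2.1).trans_lt ht.1
  · exact ht.2.trans_le (max_le h1.2 h2.2)

lemma sum_jumpX_eq (hG : IsGaussPoints r G) (hr : 1 ≤ r) (hκ : P.IsCellValue α κ)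
    (hw : IsTestFun r P w) (Dx : ℕ → ℕ → ℝ × ℝ → ℝ) {i k : ℕ} (hi : i ∈ Finset.Icc 1 P.m)
    (hk : k ∈ Finset.Icc 1 r) :
    ∑ j ∈ Finset.Icc 1 P.n, ∑ l ∈ Finset.Icc 1 r, jumpX r w i k j l *
      ((∫ t in (P.gy r G j l)..(min (P.gy r G j (l + 1)) (P.y j)),
          α (P.gx r G i k, t) * Dx i j (P.gx r G i k, t)) +
       (∫ t in (P.y j)..(max (P.gy r G j (l + 1)) (P.y j)),
          α (P.gx r G i k, t) * Dx i (j + 1) (P.gx r G i k, t))) =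
    ∑ j ∈ Finset.Icc 1 P.n, κ i j * ∑ l ∈ Finset.range (r + 1),
      (wE r w i k j l - wE r w i (k - 1) j l) *
        ∫ t in (cellNode r G (P.y (j - 1)) (P.y j) l)..
          (cellNode r G (P.y (j - 1)) (P.y j) (l + 1)),
          Dx i j (gaussNode G (P.x (i - 1)) (P.x i) k, t) := by
  have hk' := Finset.mem_Icc.1 hk
  simp only [P.gy_eq]
  rw [sum_dual_eq_sum_cell hG hr P.hylt P.hn (J := fun j l => jumpX r w i k j l)
    (H := fun j s t => ∫ t in s..t, α (P.gx r G i k, t) * Dx i j (P.gx r G i k, t))]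
  · refine Finset.sum_congr rfl fun j hj => ?_
    rw [Finset.mul_sum]
    refine Finset.sum_congr rfl fun l hl => ?_
    rw [integral_cellNode_congr hG (P.y_pred_lt hj) hl
      (g := fun t => κ i j * Dx i j (gaussNode G (P.x (i - 1)) (P.x i) k, t)),
      intervalIntegral.integral_const_mul, jumpX]
    · ring
    · intro t ht
      rw [P.gx_eq, lineNode_of_mem hk,
        hκ i hi j hj _ ⟨hG.gaussNode_mem_Ioo (P.x_pred_lt hi) hk, ht⟩]
  · simp [jumpX, wE_bottom_boundary]
  · intro j hj _
    simp only [jumpX, wE_succ_bottom hr hj]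
  · simp only [jumpX]
    rw [wE_top_boundary hr hw hi hk'.2, wE_top_boundary hr hw hi (by omega), sub_zero]
  · simp

lemma sum_jumpY_eq (hG : IsGaussPoints r G) (hr : 1 ≤ r) (hκ : P.IsCellValue α κ)
    (hw : IsTestFun r P w) (Dy : ℕ → ℕ → ℝ × ℝ → ℝ) {j l : ℕ} (hj : j ∈ Finset.Icc 1 P.n)
    (hl : l ∈ Finset.Icc 1 r) :
    ∑ i ∈ Finset.Icc 1 P.m, ∑ k ∈ Finset.Icc 1 r, jumpY r w i k j l *
      ((∫ t in (P.gx r G i k)..(min (P.gx r G i (k + 1)) (P.x i)),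
          α (t, P.gy r G j l) * Dy i j (t, P.gy r G j l)) +
       (∫ t in (P.x i)..(max (P.gx r G i (k + 1)) (P.x i)),
          α (t, P.gy r G j l) * Dy (i + 1) j (t, P.gy r G j l))) =
    ∑ i ∈ Finset.Icc 1 P.m, κ i j * ∑ k ∈ Finset.range (r + 1),
      (wE r w i k j l - wE r w i k j (l - 1)) *
        ∫ t in (cellNode r G (P.x (i - 1)) (P.x i) k)..
          (cellNode r G (P.x (i - 1)) (P.x i) (k + 1)),
          Dy i j (t, gaussNode G (P.y (j - 1)) (P.y j) l) := by
  have hl' := Finset.mem_Icc.1 hl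
  simp only [P.gx_eq]
  rw [sum_dual_eq_sum_cell hG hr P.hxlt P.hm (J := fun i k => jumpY r w i k j l)
    (H := fun i s t => ∫ t in s..t, α (t, P.gy r G j l) * Dy i j (t, P.gy r G j l))]
  · refine Finset.sum_congr rfl fun i hi => ?_
    rw [Finset.mul_sum]
    refine Finset.sum_congr rfl fun k hk => ?_
    rw [integral_cellNode_congr hG (P.x_pred_lt hi) hk
      (g := fun t => κ i j * Dy i j (t, gaussNode G (P.y (j - 1)) (P.y j) l)),
      intervalIntegral.integral_const_mul, jumpY]
    · ring
    · intro t ht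
      rw [P.gy_eq, lineNode_of_mem hl,
        hκ i hi j hj _ ⟨ht, hG.gaussNode_mem_Ioo (P.y_pred_lt hj) hl⟩]
  · simp [jumpY, wE_left_boundary]
  · intro i hi _
    simp only [jumpY, wE_succ_left hr hi]
  · simp only [jumpY]
    rw [wE_right_boundary hr hw hj hl'.2, wE_right_boundary hr hw hj (by omega), sub_zero]
  · simp

lemma aP_eq_sum_cellForm (hG : IsGaussPoints r G) (hr : 1 ≤ r) (hκ : P.IsCellValue α κ)
    (hw : IsTestFun r P w) (Dx Dy : ℕ → ℕ → ℝ × ℝ → ℝ) :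
    aP r G P α Dx Dy w = ∑ i ∈ Finset.Icc 1 P.m, ∑ j ∈ Finset.Icc 1 P.n, κ i j *
      cellForm r G (P.x (i - 1)) (P.x i) (P.y (j - 1)) (P.y j) (Dx i j) (Dy i j)
        (fun k l => wE r w i k j l) := by
  simp only [cellForm, mul_add, Finset.sum_add_distrib]
  rw [aP]
  congr 1
  · rw [idxX, Finset.sum_filter_of_ne, Finset.sum_product]
    · simp only [Finset.sum_product]
      refine Finset.sum_congr rfl fun i hi => ?_
      rw [Finset.sum_congr rfl fun k hk => sum_jumpX_eq hG hr hκ hw Dx hi hk, Finset.sum_comm]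
      exact Finset.sum_congr rfl fun j _ => by rw [Finset.mul_sum]
    · rintro ⟨i, k, j, l⟩ hq hne ⟨hj, hl⟩
      refine hne ?_
      simp only [Finset.mem_product] at hq hj hl ⊢
      have hk := Finset.mem_Icc.1 hq.2.1
      subst hj hl
      rw [jumpX, wE_top_boundary hr hw hq.1 hk.2, wE_top_boundary hr hw hq.1 (by omega), sub_zero,
        zero_mul]
  · rw [idxY, Finset.sum_filter_of_ne, Finset.sum_product]
    · simp only [Finset.sum_product]
      rw [Finset.sum_congr rfl fun i _ => Finset.sum_comm, Finset.sum_comm,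
        Finset.sum_congr rfl fun j _ => Finset.sum_congr rfl fun i _ => Finset.sum_comm,
        Finset.sum_comm (s := Finset.Icc 1 P.m)]
      refine Finset.sum_congr rfl fun j hj => ?_
      rw [Finset.sum_comm, Finset.sum_congr rfl fun l hl => sum_jumpY_eq hG hr hκ hw Dy hj hl,
        Finset.sum_comm]
      exact Finset.sum_congr rfl fun i _ => by rw [Finset.mul_sum]
    · rintro ⟨i, k, j, l⟩ hq hne ⟨hi, hk⟩
      refine hne ?_
      simp only [Finset.mem_product] at hq hi hk ⊢
      have hl := Finset.mem_Icc.1 hq.2.2.2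
      subst hi hk
      rw [jumpY, wE_right_boundary hr hw hq.2.2.1 hl.2, wE_right_boundary hr hw hq.2.2.1 (by omega),
        sub_zero, zero_mul]

lemma rectInt_cellNode_congr (hG : IsGaussPoints r G) {x₀ x₁ y₀ y₁ : ℝ} (hx : x₀ < x₁)
    (hy : y₀ < y₁) {k l : ℕ} (hk : k ∈ Finset.range (r + 1)) (hl : l ∈ Finset.range (r + 1))
    {f g : ℝ × ℝ → ℝ} (h : ∀ z ∈ Set.Ioo x₀ x₁ ×ˢ Set.Ioo y₀ y₁, f z = g z) :
    rectInt f (cellNode r G x₀ x₁ k) (cellNode r G x₀ x₁ (k + 1))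
        (cellNode r G y₀ y₁ l) (cellNode r G y₀ y₁ (l + 1)) =
      rectInt g (cellNode r G x₀ x₁ k) (cellNode r G x₀ x₁ (k + 1))
        (cellNode r G y₀ y₁ l) (cellNode r G y₀ y₁ (l + 1)) :=
  integral_cellNode_congr hG hx hk fun _ hs => integral_cellNode_congr hG hy hl fun _ ht =>
    h _ ⟨hs, ht⟩

lemma sum_comm_pairs (s t s' t' : Finset ℕ) (f : ℕ → ℕ → ℕ → ℕ → ℝ) :
    ∑ i ∈ s, ∑ k ∈ t, ∑ j ∈ s', ∑ l ∈ t', f i k j l =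
      ∑ j ∈ s', ∑ l ∈ t', ∑ i ∈ s, ∑ k ∈ t, f i k j l := by
  rw [← Finset.sum_product' s t fun i k => ∑ j ∈ s', ∑ l ∈ t', f i k j l,
    ← Finset.sum_product' s' t' fun j l => ∑ i ∈ s, ∑ k ∈ t, f i k j l]
  refine (Finset.sum_congr rfl fun p _ => (Finset.sum_product' s' t' (f p.1 p.2)).symm).trans
    (Finset.sum_comm.trans (Finset.sum_congr rfl fun q _ => ?_))
  exact Finset.sum_product' s t fun i k => f i k q.1 q.2

lemma fvRHS_eq_sum_cellLoad (hG : IsGaussPoints r G) (hr : 1 ≤ r) (hκ : P.IsCellValue α κ)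
    (hw : IsTestFun r P w) (u : PiecewiseFun P) :
    fvRHS r G P α u w = ∑ i ∈ Finset.Icc 1 P.m, ∑ j ∈ Finset.Icc 1 P.n, -κ i j *
      cellLoad r G (P.x (i - 1)) (P.x i) (P.y (j - 1)) (P.y j)
        (fun z => pdx (pdx (u.cellFun i j)) z + pdy (pdy (u.cellFun i j)) z)
        (fun k l => wE r w i k j l) := by
  rw [fvRHS, idxZ, Finset.sum_filter_of_ne, Finset.sum_product]
  · simp only [Finset.sum_product]
    have hstep : ∀ j ∈ Finset.Icc 1 P.n, ∀ l ∈ Finset.Icc 1 r,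
        ∑ i ∈ Finset.Icc 1 P.m, ∑ k ∈ Finset.Icc 1 r,
          w i k j l * dualCellInt r G P (cellSource α u) i k j l =
        ∑ i ∈ Finset.Icc 1 P.m, ∑ k ∈ Finset.range (r + 1), wE r w i k j l *
          (rectInt (cellSource α u i j) (cellNode r G (P.x (i - 1)) (P.x i) k)
            (cellNode r G (P.x (i - 1)) (P.x i) (k + 1)) (P.gy r G j l)
            (min (P.gy r G j (l + 1)) (P.y j)) +
          rectInt (cellSource α u i (j + 1)) (cellNode r G (P.x (i - 1)) (P.x i) k)
            (cellNode r G (P.x (i - 1)) (P.x i) (k + 1)) (P.y j)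
            (max (P.gy r G j (l + 1)) (P.y j))) := by
      intro j hj l hl
      have hl' := Finset.mem_Icc.1 hl
      rw [← sum_dual_eq_sum_cell hG hr P.hxlt P.hm (J := fun i k => wE r w i k j l)
        (H := fun i s t => rectInt (cellSource α u i j) s t (P.gy r G j l)
            (min (P.gy r G j (l + 1)) (P.y j)) +
          rectInt (cellSource α u i (j + 1)) s t (P.y j) (max (P.gy r G j (l + 1)) (P.y j)))
        (wE_left_boundary _ _) (fun i hi _ => wE_succ_left hr hi _ _)
        (wE_right_boundary hr hw hj hl'.2) (by simp [rectInt])]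
      refine Finset.sum_congr rfl fun i _ => Finset.sum_congr rfl fun k hk => ?_
      rw [wE_of_pos hk hl, dualCellInt]
      simp only [P.gx_eq]
      ring
    have hstep' : ∀ i ∈ Finset.Icc 1 P.m, ∀ k ∈ Finset.range (r + 1),
        ∑ j ∈ Finset.Icc 1 P.n, ∑ l ∈ Finset.Icc 1 r, wE r w i k j l *
          (rectInt (cellSource α u i j) (cellNode r G (P.x (i - 1)) (P.x i) k)
            (cellNode r G (P.x (i - 1)) (P.x i) (k + 1)) (P.gy r G j l)
            (min (P.gy r G j (l + 1)) (P.y j)) +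
          rectInt (cellSource α u i (j + 1)) (cellNode r G (P.x (i - 1)) (P.x i) k)
            (cellNode r G (P.x (i - 1)) (P.x i) (k + 1)) (P.y j)
            (max (P.gy r G j (l + 1)) (P.y j))) =
        ∑ j ∈ Finset.Icc 1 P.n, -κ i j * ∑ l ∈ Finset.range (r + 1), wE r w i k j l *
          rectInt (fun z => pdx (pdx (u.cellFun i j)) z + pdy (pdy (u.cellFun i j)) z)
            (cellNode r G (P.x (i - 1)) (P.x i) k)
            (cellNode r G (P.x (i - 1)) (P.x i) (k + 1)) (cellNode r G (P.y (j - 1)) (P.y j) l)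
            (cellNode r G (P.y (j - 1)) (P.y j) (l + 1)) := by
      intro i hi k hk
      simp only [P.gy_eq]
      rw [sum_dual_eq_sum_cell hG hr P.hylt P.hn (J := fun j l => wE r w i k j l)
        (H := fun j s t => rectInt (cellSource α u i j) (cellNode r G (P.x (i - 1)) (P.x i) k)
            (cellNode r G (P.x (i - 1)) (P.x i) (k + 1)) s t)
        (wE_bottom_boundary _ _) (fun j hj _ => wE_succ_bottom hr hj _ _)
        (wE_top_boundary hr hw hi (by simp at hk; omega)) (by simp [rectInt])]
      refine Finset.sum_congr rfl fun j hj => ?_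
      rw [Finset.mul_sum]
      refine Finset.sum_congr rfl fun l hl => ?_
      rw [rectInt_cellNode_congr hG (P.x_pred_lt hi) (P.y_pred_lt hj) hk hl
        (g := fun z => -κ i j * (pdx (pdx (u.cellFun i j)) z + pdy (pdy (u.cellFun i j)) z))]
      · simp only [rectInt, intervalIntegral.integral_const_mul]
        ring
      · intro z hz
        rw [cellSource, hκ i hi j hj z hz]
        ring
    calc ∑ i ∈ Finset.Icc 1 P.m, ∑ k ∈ Finset.Icc 1 r, ∑ j ∈ Finset.Icc 1 P.n,
          ∑ l ∈ Finset.Icc 1 r, w i k j l * dualCellInt r G P (cellSource α u) i k j l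
        = ∑ j ∈ Finset.Icc 1 P.n, ∑ l ∈ Finset.Icc 1 r, ∑ i ∈ Finset.Icc 1 P.m,
          ∑ k ∈ Finset.Icc 1 r, w i k j l * dualCellInt r G P (cellSource α u) i k j l :=
          sum_comm_pairs _ _ _ _ _
      _ = _ := Finset.sum_congr rfl fun j hj => Finset.sum_congr rfl fun l hl => hstep j hj l hl
      _ = ∑ i ∈ Finset.Icc 1 P.m, ∑ k ∈ Finset.range (r + 1), ∑ j ∈ Finset.Icc 1 P.n,
          ∑ l ∈ Finset.Icc 1 r, wE r w i k j l *
          (rectInt (cellSource α u i j) (cellNode r G (P.x (i - 1)) (P.x i) k)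
            (cellNode r G (P.x (i - 1)) (P.x i) (k + 1)) (P.gy r G j l)
            (min (P.gy r G j (l + 1)) (P.y j)) +
          rectInt (cellSource α u i (j + 1)) (cellNode r G (P.x (i - 1)) (P.x i) k)
            (cellNode r G (P.x (i - 1)) (P.x i) (k + 1)) (P.y j)
            (max (P.gy r G j (l + 1)) (P.y j))) :=
          sum_comm_pairs _ _ _ _ _
      _ = _ := Finset.sum_congr rfl fun i hi => Finset.sum_congr rfl fun k hk => hstep' i hi k hk
      _ = _ := Finset.sum_congr rfl fun i _ => by
          rw [Finset.sum_comm]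
          exact Finset.sum_congr rfl fun j _ => by rw [cellLoad, Finset.mul_sum]
  · rintro ⟨i, k, j, l⟩ hq hne
    simp only [Finset.mem_product] at hq
    constructor
    · rintro ⟨hi, hk⟩
      simp only at hi hk
      subst hi hk
      exact hne (by rw [hw.1 _ hq.2.2.1 _ hq.2.2.2, zero_mul])
    · rintro ⟨hj, hl⟩
      simp only at hj hl
      subst hj hl
      exact hne (by rw [hw.2 _ hq.1 _ hq.2.1, zero_mul])

end regroup

/-! ### Consistency: the exact solution satisfies the finite volume equations -/

section divergence

variable {f : ℝ × ℝ → ℝ}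

lemma rectInt_add {g : ℝ × ℝ → ℝ} (hf : Continuous f) (hg : Continuous g) (x₀ x₁ y₀ y₁ : ℝ) :
    rectInt (fun z => f z + g z) x₀ x₁ y₀ y₁ = rectInt f x₀ x₁ y₀ y₁ + rectInt g x₀ x₁ y₀ y₁ := by
  unfold rectInt
  rw [← intervalIntegral.integral_add ((continuous_integral_right hf _ _).intervalIntegrable _ _)
    ((continuous_integral_right hg _ _).intervalIntegrable _ _)]
  refine intervalIntegral.integral_congr fun s _ => ?_
  exact intervalIntegral.integral_add (Continuous.intervalIntegrable (by fun_prop) _ _)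
    (Continuous.intervalIntegrable (by fun_prop) _ _)

lemma rectInt_pdy (hf : ContDiff ℝ 1 f) (x₀ x₁ y₀ y₁ : ℝ) :
    rectInt (pdy f) x₀ x₁ y₀ y₁ = (∫ s in x₀..x₁, f (s, y₁)) - ∫ s in x₀..x₁, f (s, y₀) := by
  have hc : Continuous f := hf.continuous
  have hpc : Continuous (pdy f) := (contDiff_pdy (n := 0) (by exact_mod_cast hf)).continuous
  rw [← intervalIntegral.integral_sub (Continuous.intervalIntegrable (by fun_prop) _ _)
    (Continuous.intervalIntegrable (by fun_prop) _ _)]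
  refine intervalIntegral.integral_congr fun s _ => ?_
  exact intervalIntegral.integral_eq_sub_of_hasDerivAt
    (fun t _ => hasDerivAt_pdy (hf.differentiable one_ne_zero) s t)
    (Continuous.intervalIntegrable (by fun_prop) _ _)

lemma rectInt_pdx (hf : ContDiff ℝ 1 f) (x₀ x₁ y₀ y₁ : ℝ) :
    rectInt (pdx f) x₀ x₁ y₀ y₁ = (∫ t in y₀..y₁, f (x₁, t)) - ∫ t in y₀..y₁, f (x₀, t) := by
  have hc : Continuous f := hf.continuous
  have hpc : Continuous (pdx f) := (contDiff_pdx (n := 0) (by exact_mod_cast hf)).continuous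
  rw [rectInt_swap hpc, ← intervalIntegral.integral_sub
    (Continuous.intervalIntegrable (by fun_prop) _ _)
    (Continuous.intervalIntegrable (by fun_prop) _ _)]
  refine intervalIntegral.integral_congr fun t _ => ?_
  exact intervalIntegral.integral_eq_sub_of_hasDerivAt
    (fun s _ => hasDerivAt_pdx (hf.differentiable one_ne_zero) s t)
    (Continuous.intervalIntegrable (by fun_prop) _ _)

/-- Discrete integration by parts on a cell. -/
lemma cellForm_add_cellLoad {r : ℕ} {G : ℕ → ℝ} (hf : ContDiff ℝ 2 f) (x₀ x₁ y₀ y₁ : ℝ)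
    (W : ℕ → ℕ → ℝ) :
    cellForm r G x₀ x₁ y₀ y₁ (pdx f) (pdy f) W +
      cellLoad r G x₀ x₁ y₀ y₁ (fun z => pdx (pdx f) z + pdy (pdy f) z) W =
    ∑ l ∈ Finset.range (r + 1),
      (W r l * (∫ t in (cellNode r G y₀ y₁ l)..(cellNode r G y₀ y₁ (l + 1)), pdx f (x₁, t)) -
        W 0 l * ∫ t in (cellNode r G y₀ y₁ l)..(cellNode r G y₀ y₁ (l + 1)), pdx f (x₀, t)) +
    ∑ k ∈ Finset.range (r + 1),
      (W k r * (∫ s in (cellNode r G x₀ x₁ k)..(cellNode r G x₀ x₁ (k + 1)), pdy f (s, y₁)) -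
        W k 0 * ∫ s in (cellNode r G x₀ x₁ k)..(cellNode r G x₀ x₁ (k + 1)), pdy f (s, y₀)) := by
  have hpx : ContDiff ℝ 1 (pdx f) := contDiff_pdx (n := 1) (by exact_mod_cast hf)
  have hpy : ContDiff ℝ 1 (pdy f) := contDiff_pdy (n := 1) (by exact_mod_cast hf)
  have hpxx : Continuous (pdx (pdx f)) := (contDiff_pdx (n := 0) (by exact_mod_cast hpx)).continuous
  have hpyy : Continuous (pdy (pdy f)) := (contDiff_pdy (n := 0) (by exact_mod_cast hpy)).continuous
  have hX : ∀ l, (∑ k ∈ Finset.Icc 1 r, (W k l - W (k - 1) l) *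
        ∫ t in (cellNode r G y₀ y₁ l)..(cellNode r G y₀ y₁ (l + 1)),
          pdx f (gaussNode G x₀ x₁ k, t)) +
      ∑ k ∈ Finset.range (r + 1), W k l *
        rectInt (pdx (pdx f)) (cellNode r G x₀ x₁ k) (cellNode r G x₀ x₁ (k + 1))
          (cellNode r G y₀ y₁ l) (cellNode r G y₀ y₁ (l + 1)) =
      W r l * (∫ t in (cellNode r G y₀ y₁ l)..(cellNode r G y₀ y₁ (l + 1)), pdx f (x₁, t)) -
        W 0 l * ∫ t in (cellNode r G y₀ y₁ l)..(cellNode r G y₀ y₁ (l + 1)), pdx f (x₀, t) := by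
    intro l
    have h := sum_range_mul_sub_eq (fun k => W k l)
      (fun k => ∫ t in (cellNode r G y₀ y₁ l)..(cellNode r G y₀ y₁ (l + 1)),
        pdx f (cellNode r G x₀ x₁ k, t)) r
    simp only [cellNode_zero, cellNode_last] at h
    simp only [rectInt_pdx hpx, h]
    rw [Finset.sum_congr rfl fun k hk => by rw [← cellNode_of_mem (r := r) x₀ x₁ hk]]
    ring
  have hY : ∀ k, (∑ l ∈ Finset.Icc 1 r, (W k l - W k (l - 1)) *
        ∫ s in (cellNode r G x₀ x₁ k)..(cellNode r G x₀ x₁ (k + 1)),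
          pdy f (s, gaussNode G y₀ y₁ l)) +
      ∑ l ∈ Finset.range (r + 1), W k l *
        rectInt (pdy (pdy f)) (cellNode r G x₀ x₁ k) (cellNode r G x₀ x₁ (k + 1))
          (cellNode r G y₀ y₁ l) (cellNode r G y₀ y₁ (l + 1)) =
      W k r * (∫ s in (cellNode r G x₀ x₁ k)..(cellNode r G x₀ x₁ (k + 1)), pdy f (s, y₁)) -
        W k 0 * ∫ s in (cellNode r G x₀ x₁ k)..(cellNode r G x₀ x₁ (k + 1)), pdy f (s, y₀) := by
    intro k
    have h := sum_range_mul_sub_eq (fun l => W k l)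
      (fun l => ∫ s in (cellNode r G x₀ x₁ k)..(cellNode r G x₀ x₁ (k + 1)),
        pdy f (s, cellNode r G y₀ y₁ l)) r
    simp only [cellNode_zero, cellNode_last] at h
    simp only [rectInt_pdy hpy, h]
    rw [Finset.sum_congr rfl fun l hl => by rw [← cellNode_of_mem (r := r) y₀ y₁ hl]]
    ring
  rw [← Finset.sum_congr rfl fun l _ => hX l, ← Finset.sum_congr rfl fun k _ => hY k, cellForm,
    cellLoad]
  simp only [rectInt_add hpxx hpyy, mul_add, Finset.sum_add_distrib]
  rw [Finset.sum_comm (s := Finset.Icc 1 r), Finset.sum_comm (s := Finset.Icc 1 r),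
    Finset.sum_comm (s := Finset.range (r + 1)) (t := Finset.range (r + 1))
      (f := fun l k => W k l * rectInt (pdx (pdx f)) (cellNode r G x₀ x₁ k)
        (cellNode r G x₀ x₁ (k + 1)) (cellNode r G y₀ y₁ l) (cellNode r G y₀ y₁ (l + 1)))]
  ring

end divergence

section consistency

variable {a b c d : ℝ} {P : RectPartition a b c d} {r : ℕ} {G : ℕ → ℝ} {w : ℕ → ℕ → ℕ → ℕ → ℝ}
  {α : ℝ × ℝ → ℝ} {κ : ℕ → ℕ → ℝ}

lemma eqOn_cell_of_eqOn_openCell {i j : ℕ} (hi : i ∈ Finset.Icc 1 P.m) (hj : j ∈ Finset.Icc 1 P.n)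
    {F g : ℝ × ℝ → ℝ} (hF : ContinuousOn F P.dom) (hg : Continuous g)
    (h : Set.EqOn F g (P.openCell i j)) : Set.EqOn F g (P.cell i j) :=
  h.of_subset_closure (hF.mono (P.cell_subset_dom hi hj)) hg.continuousOn
    (P.openCell_subset_cell i j) (P.cell_subset_closure_openCell hi hj)

lemma integral_cellNode_congr_Icc (hG : IsGaussPoints r G) {y₀ y₁ : ℝ} (hy : y₀ < y₁) {l : ℕ}
    (hl : l ∈ Finset.range (r + 1)) {f g : ℝ → ℝ} (h : ∀ t ∈ Set.Icc y₀ y₁, f t = g t) :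
    ∫ t in (cellNode r G y₀ y₁ l)..(cellNode r G y₀ y₁ (l + 1)), f t =
      ∫ t in (cellNode r G y₀ y₁ l)..(cellNode r G y₀ y₁ (l + 1)), g t :=
  integral_cellNode_congr hG hy hl fun t ht => h t (Set.Ioo_subset_Icc_self ht)

lemma aP_eq_fvRHS (hG : IsGaussPoints r G) (hr : 1 ≤ r) (hκ : P.IsCellValue α κ)
    (hw : IsTestFun r P w) {u : PiecewiseFun P} (hu : CellSmooth P (r + 1) u)
    (hflux : FluxContinuous P α u) :
    aP r G P α (cellDx u) (cellDy u) w = fvRHS r G P α u w := by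
  obtain ⟨Fx, Fy, hFx, hFy, hF⟩ := hflux
  have hu2 : ∀ i ∈ Finset.Icc 1 P.m, ∀ j ∈ Finset.Icc 1 P.n, ContDiff ℝ 2 (u.cellFun i j) :=
    fun i hi j hj => (hu i hi j hj).of_le (by norm_cast; omega)
  have hFx' : ∀ i ∈ Finset.Icc 1 P.m, ∀ j ∈ Finset.Icc 1 P.n,
      Set.EqOn Fx (fun z => κ i j * pdx (u.cellFun i j) z) (P.cell i j) := fun i hi j hj => by
    have hc : Continuous (pdx (u.cellFun i j)) :=
      (contDiff_pdx (n := 1) (by exact_mod_cast hu2 i hi j hj)).continuous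
    refine eqOn_cell_of_eqOn_openCell hi hj hFx (by fun_prop) fun z hz => ?_
    rw [(hF i hi j hj z hz).1, hκ i hi j hj z hz, cellDx]
  have hFy' : ∀ i ∈ Finset.Icc 1 P.m, ∀ j ∈ Finset.Icc 1 P.n,
      Set.EqOn Fy (fun z => κ i j * pdy (u.cellFun i j) z) (P.cell i j) := fun i hi j hj => by
    have hc : Continuous (pdy (u.cellFun i j)) :=
      (contDiff_pdy (n := 1) (by exact_mod_cast hu2 i hi j hj)).continuous
    refine eqOn_cell_of_eqOn_openCell hi hj hFy (by fun_prop) fun z hz => ?_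
    rw [(hF i hi j hj z hz).2, hκ i hi j hj z hz, cellDy]
  rw [aP_eq_sum_cellForm hG hr hκ hw, fvRHS_eq_sum_cellLoad hG hr hκ hw, ← sub_eq_zero]
  simp only [← Finset.sum_sub_distrib, neg_mul, sub_neg_eq_add, ← mul_add]
  have hcell : ∀ i ∈ Finset.Icc 1 P.m, ∀ j ∈ Finset.Icc 1 P.n,
      κ i j * (cellForm r G (P.x (i - 1)) (P.x i) (P.y (j - 1)) (P.y j) (cellDx u i j)
        (cellDy u i j) (fun k l => wE r w i k j l) +
      cellLoad r G (P.x (i - 1)) (P.x i) (P.y (j - 1)) (P.y j)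
        (fun z => pdx (pdx (u.cellFun i j)) z + pdy (pdy (u.cellFun i j)) z)
        (fun k l => wE r w i k j l)) =
      (∑ l ∈ Finset.range (r + 1),
        (wE r w i r j l * (∫ t in (cellNode r G (P.y (j - 1)) (P.y j) l)..
          (cellNode r G (P.y (j - 1)) (P.y j) (l + 1)), Fx (P.x i, t)) -
        wE r w i 0 j l * (∫ t in (cellNode r G (P.y (j - 1)) (P.y j) l)..
          (cellNode r G (P.y (j - 1)) (P.y j) (l + 1)), Fx (P.x (i - 1), t)))) +
      ∑ k ∈ Finset.range (r + 1),
        (wE r w i k j r * (∫ s in (cellNode r G (P.x (i - 1)) (P.x i) k)..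
          (cellNode r G (P.x (i - 1)) (P.x i) (k + 1)), Fy (s, P.y j)) -
        wE r w i k j 0 * (∫ s in (cellNode r G (P.x (i - 1)) (P.x i) k)..
          (cellNode r G (P.x (i - 1)) (P.x i) (k + 1)), Fy (s, P.y (j - 1)))) := by
    intro i hi j hj
    have hxi := P.x_pred_lt hi
    have hyj := P.y_pred_lt hj
    rw [cellDx, cellDy, cellForm_add_cellLoad (hu2 i hi j hj), mul_add, Finset.mul_sum,
      Finset.mul_sum]
    congr 1
    · refine Finset.sum_congr rfl fun l hl => ?_
      rw [integral_cellNode_congr_Icc hG hyj hl fun t ht =>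
          hFx' i hi j hj (x := (P.x i, t)) ⟨Set.right_mem_Icc.2 hxi.le, ht⟩,
        integral_cellNode_congr_Icc hG hyj hl fun t ht =>
          hFx' i hi j hj (x := (P.x (i - 1), t)) ⟨Set.left_mem_Icc.2 hxi.le, ht⟩,
        intervalIntegral.integral_const_mul, intervalIntegral.integral_const_mul]
      ring
    · refine Finset.sum_congr rfl fun k hk => ?_
      rw [integral_cellNode_congr_Icc hG hxi hk fun s hs =>
          hFy' i hi j hj (x := (s, P.y j)) ⟨hs, Set.right_mem_Icc.2 hyj.le⟩,
        integral_cellNode_congr_Icc hG hxi hk fun s hs =>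
          hFy' i hi j hj (x := (s, P.y (j - 1))) ⟨hs, Set.left_mem_Icc.2 hyj.le⟩,
        intervalIntegral.integral_const_mul, intervalIntegral.integral_const_mul]
      ring
  rw [Finset.sum_congr rfl fun i hi => Finset.sum_congr rfl fun j hj => hcell i hi j hj]
  simp only [Finset.sum_add_distrib]
  rw [Finset.sum_comm]
  have hX : ∀ j ∈ Finset.Icc 1 P.n, (∑ i ∈ Finset.Icc 1 P.m, ∑ l ∈ Finset.range (r + 1),
        (wE r w i r j l * (∫ t in (cellNode r G (P.y (j - 1)) (P.y j) l)..
          (cellNode r G (P.y (j - 1)) (P.y j) (l + 1)), Fx (P.x i, t)) -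
        wE r w i 0 j l * (∫ t in (cellNode r G (P.y (j - 1)) (P.y j) l)..
          (cellNode r G (P.y (j - 1)) (P.y j) (l + 1)), Fx (P.x (i - 1), t)))) = 0 := by
    intro j hj
    rw [Finset.sum_comm]
    refine Finset.sum_eq_zero fun l hl => ?_
    rw [Finset.sum_sub_distrib, sub_eq_zero]
    refine sum_Icc_eq_of_shift P.hm (by rw [wE_left_boundary, zero_mul])
      (by rw [wE_right_boundary hr hw hj (by simp at hl; omega), zero_mul]) fun i hi _ => ?_
    rw [wE_succ_left hr hi, Nat.add_sub_cancel]
  have hY : ∀ i ∈ Finset.Icc 1 P.m, (∑ j ∈ Finset.Icc 1 P.n, ∑ k ∈ Finset.range (r + 1),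
        (wE r w i k j r * (∫ s in (cellNode r G (P.x (i - 1)) (P.x i) k)..
          (cellNode r G (P.x (i - 1)) (P.x i) (k + 1)), Fy (s, P.y j)) -
        wE r w i k j 0 * (∫ s in (cellNode r G (P.x (i - 1)) (P.x i) k)..
          (cellNode r G (P.x (i - 1)) (P.x i) (k + 1)), Fy (s, P.y (j - 1))))) = 0 := by
    intro i hi
    rw [Finset.sum_comm]
    refine Finset.sum_eq_zero fun k hk => ?_
    rw [Finset.sum_sub_distrib, sub_eq_zero]
    refine sum_Icc_eq_of_shift P.hn (by rw [wE_bottom_boundary, zero_mul])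
      (by rw [wE_top_boundary hr hw hi (by simp at hk; omega), zero_mul]) fun j hj _ => ?_
    rw [wE_succ_bottom hr hj, Nat.add_sub_cancel]
  rw [Finset.sum_eq_zero hX, Finset.sum_eq_zero hY, add_zero]

end consistency

/-! ### Polynomials of bidegree at most `r` and their discrete traces -/

/-- The bivariate polynomial function with coefficient matrix `c`. -/
noncomputable def biPoly (r : ℕ) (c : ℕ → ℕ → ℝ) (z : ℝ × ℝ) : ℝ :=
  ∑ a ∈ Finset.range (r + 1), ∑ b ∈ Finset.range (r + 1), c a b * (z.1 ^ a * z.2 ^ b)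

/-- The polynomial in the second variable obtained by replacing `x ^ a` by `φ a`. -/
noncomputable def sectionPoly (r : ℕ) (c : ℕ → ℕ → ℝ) (φ : ℕ → ℝ) : ℝ[X] :=
  ∑ a ∈ Finset.range (r + 1), ∑ b ∈ Finset.range (r + 1), (c a b * φ a) • X ^ b

/-- The values `w_{k,l}` of the test function attached to the polynomial `biPoly r c`. -/
noncomputable def dualTrace (r : ℕ) (G A : ℕ → ℝ) (x₀ x₁ y₀ y₁ : ℝ) (c : ℕ → ℕ → ℝ)
    (k l : ℕ) : ℝ :=
  ∑ a ∈ Finset.range (r + 1), ∑ b ∈ Finset.range (r + 1), c a b *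
    (gaussTrace G A x₀ x₁ k (X ^ a) * gaussTrace G A y₀ y₁ l (X ^ b))

section biPoly

variable {r : ℕ} {G A : ℕ → ℝ} {c c' : ℕ → ℕ → ℝ} {x₀ x₁ y₀ y₁ : ℝ}

lemma biPoly_sub :
    biPoly r (fun a b => c a b - c' a b) = fun z => biPoly r c z - biPoly r c' z := by
  funext z
  simp only [biPoly, ← Finset.sum_sub_distrib, sub_mul]

lemma biPoly_swap : biPoly r (fun a b => c b a) = biPoly r c ∘ Prod.swap := by
  funext z
  simp only [biPoly, Function.comp_apply, Prod.fst_swap, Prod.snd_swap]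
  rw [Finset.sum_comm]
  exact Finset.sum_congr rfl fun _ _ => Finset.sum_congr rfl fun _ _ => by ring

lemma contDiff_biPoly {n : WithTop ℕ∞} : ContDiff ℝ n (biPoly r c) := by
  unfold biPoly
  fun_prop

lemma IsBiPoly.exists_eq_biPoly {f : ℝ × ℝ → ℝ} (hf : IsBiPoly r f) : ∃ c, f = biPoly r c := by
  obtain ⟨p, hp, hpc, hfp⟩ := hf
  refine ⟨fun a b => (p.coeff a).coeff b, funext fun z => ?_⟩
  have h := hfp z.1 z.2
  rw [Prod.mk.eta] at h
  rw [h, evalXY, eval_eq_sum_range' (n := r + 1) (by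
    have := natDegree_map_le (f := evalRingHom z.2) (p := p); omega), biPoly]
  refine Finset.sum_congr rfl fun a _ => ?_
  rw [coeff_map, coe_evalRingHom, eval_eq_sum_range' (n := r + 1) (by have := hpc a; omega),
    Finset.sum_mul]
  exact Finset.sum_congr rfl fun b _ => by ring

lemma exists_cellInterp_eq_biPoly (hr : 1 ≤ r) (hx : x₀ < x₁) (hy : y₀ < y₁) (f : ℝ × ℝ → ℝ) :
    ∃ c, cellInterp r x₀ x₁ y₀ y₁ f = biPoly r c := by
  refine ⟨fun a b => ∑ k ∈ Finset.range (r + 1), ∑ l ∈ Finset.range (r + 1),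
    f (interpNode r x₀ x₁ k, interpNode r y₀ y₁ l) *
      ((nodal r x₀ x₁ k).coeff a * (nodal r y₀ y₁ l).coeff b), funext fun z => ?_⟩
  simp only [biPoly, Finset.sum_mul]
  rw [sum_comm_pairs, cellInterp]
  refine Finset.sum_congr rfl fun k hk => Finset.sum_congr rfl fun l hl => ?_
  rw [eval_eq_sum_range' (n := r + 1) (Nat.lt_succ_of_le (natDegree_nodal_le hr hx hk)),
    eval_eq_sum_range' (n := r + 1) (Nat.lt_succ_of_le (natDegree_nodal_le hr hy hl)),
    Finset.sum_mul_sum, Finset.mul_sum]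
  refine Finset.sum_congr rfl fun a _ => ?_
  rw [Finset.mul_sum]
  exact Finset.sum_congr rfl fun b _ => by ring

lemma natDegree_sectionPoly_le (φ : ℕ → ℝ) : (sectionPoly r c φ).natDegree ≤ r := by
  refine natDegree_sum_le_of_forall_le _ _ fun a _ =>
    natDegree_sum_le_of_forall_le _ _ fun b hb => ?_
  exact (natDegree_smul_le _ _).trans
    ((natDegree_X_pow_le b).trans (Nat.lt_succ_iff.1 (Finset.mem_range.1 hb)))

lemma eval_sectionPoly (φ : ℕ → ℝ) (t : ℝ) : (sectionPoly r c φ).eval t =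
    ∑ a ∈ Finset.range (r + 1), ∑ b ∈ Finset.range (r + 1), c a b * (φ a * t ^ b) := by
  simp only [sectionPoly, eval_finsetSum, eval_smul, eval_pow, eval_X, smul_eq_mul, mul_assoc]

lemma eval_sectionPoly_pow (s t : ℝ) :
    (sectionPoly r c (fun a => s ^ a)).eval t = biPoly r c (s, t) := eval_sectionPoly _ _

lemma gaussTrace_sectionPoly (φ : ℕ → ℝ) (l : ℕ) : gaussTrace G A y₀ y₁ l (sectionPoly r c φ) =
    ∑ a ∈ Finset.range (r + 1), ∑ b ∈ Finset.range (r + 1),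
      c a b * (φ a * gaussTrace G A y₀ y₁ l (X ^ b)) := by
  simp only [sectionPoly, map_sum, map_smul, smul_eq_mul, mul_assoc]

lemma eval_sectionPoly_deriv (s t : ℝ) :
    (sectionPoly r c (fun a => a * s ^ (a - 1))).eval t = pdx (biPoly r c) (s, t) := by
  rw [eval_sectionPoly]
  refine HasDerivAt.unique ?_
    (hasDerivAt_pdx (contDiff_biPoly.differentiable one_ne_zero) s t)
  refine HasDerivAt.fun_sum fun a _ => HasDerivAt.fun_sum fun b _ => ?_
  exact ((hasDerivAt_pow a s).mul_const (t ^ b)).const_mul (c a b)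

lemma eval_derivative_sectionPoly_swap (s t : ℝ) :
    (derivative (sectionPoly r (fun a b => c b a) (fun b => t ^ b))).eval s =
      pdx (biPoly r c) (s, t) := by
  refine HasDerivAt.unique (Polynomial.hasDerivAt _ s) ?_
  simp only [eval_sectionPoly_pow, biPoly_swap, Function.comp_apply, Prod.swap_prod_mk]
  exact hasDerivAt_pdx (contDiff_biPoly.differentiable one_ne_zero) s t

lemma dualTrace_swap (k l : ℕ) :
    dualTrace r G A y₀ y₁ x₀ x₁ (fun a b => c b a) l k = dualTrace r G A x₀ x₁ y₀ y₁ c k l := by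
  rw [dualTrace, Finset.sum_comm]
  exact Finset.sum_congr rfl fun _ _ => Finset.sum_congr rfl fun _ _ => by ring

lemma dualTrace_zero_left (l : ℕ) : dualTrace r G A x₀ x₁ y₀ y₁ c 0 l =
    gaussTrace G A y₀ y₁ l (sectionPoly r c (fun a => x₀ ^ a)) := by
  simp [dualTrace, gaussTrace_sectionPoly]

lemma dualTrace_last_left (hA : IsGaussRule r G A) (hr : 1 ≤ r) (l : ℕ) :
    dualTrace r G A x₀ x₁ y₀ y₁ c r l =
      gaussTrace G A y₀ y₁ l (sectionPoly r c (fun a => x₁ ^ a)) := by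
  rw [dualTrace, gaussTrace_sectionPoly]
  refine Finset.sum_congr rfl fun a ha => Finset.sum_congr rfl fun b _ => ?_
  rw [gaussTrace_last hA hr x₀ x₁ (p := X ^ a)
    ((natDegree_X_pow_le a).trans (Nat.lt_succ_iff.1 (Finset.mem_range.1 ha))), eval_pow, eval_X]

lemma dualTrace_sub_pred {k : ℕ} (hk : 1 ≤ k) (l : ℕ) :
    dualTrace r G A x₀ x₁ y₀ y₁ c k l - dualTrace r G A x₀ x₁ y₀ y₁ c (k - 1) l =
      (x₁ - x₀) * A k / 2 * gaussTrace G A y₀ y₁ l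
        (sectionPoly r c (fun a => a * gaussNode G x₀ x₁ k ^ (a - 1))) := by
  rw [dualTrace, dualTrace, gaussTrace_sectionPoly]
  simp only [← Finset.sum_sub_distrib, Finset.mul_sum]
  refine Finset.sum_congr rfl fun a _ => Finset.sum_congr rfl fun b _ => ?_
  have h := gaussTrace_sub_pred (G := G) (A := A) x₀ x₁ hk (X ^ a)
  rw [derivative_X_pow, eval_mul, eval_C, eval_pow, eval_X] at h
  rw [← mul_sub, ← sub_mul, h]
  ring

lemma sum_weight_mul_integral_sectionPoly_sq (hA : IsGaussRule r G A) (hr : 1 ≤ r) :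
    ∑ k ∈ Finset.Icc 1 r, (x₁ - x₀) * A k / 2 * ∫ t in y₀..y₁,
        ((sectionPoly r c (fun a => a * gaussNode G x₀ x₁ k ^ (a - 1))) ^ 2).eval t =
      rectInt (fun z => (pdx (biPoly r c) z) ^ 2) x₀ x₁ y₀ y₁ := by
  have hc : Continuous (pdx (biPoly r c)) :=
    (contDiff_pdx (n := 0) contDiff_biPoly).continuous
  rw [rectInt_swap (f := fun z => (pdx (biPoly r c) z) ^ 2) (hc.pow 2)]
  simp only [← intervalIntegral.integral_const_mul]
  rw [← intervalIntegral.integral_finsetSum fun k _ =>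
    (Polynomial.intervalIntegrable_eval _ _ _).const_mul _]
  refine intervalIntegral.integral_congr fun t _ => ?_
  have hdeg := natDegree_derivative_le (sectionPoly r (fun a b => c b a) (fun b => t ^ b))
  have hdeg' := natDegree_sectionPoly_le (r := r) (c := fun a b => c b a) (fun b => t ^ b)
  have h := hA.exact_interval x₀ x₁
    (f := (derivative (sectionPoly r (fun a b => c b a) (fun b => t ^ b))) ^ 2) (by
      refine natDegree_pow_le.trans_lt ?_
      omega)
  simp only [eval_pow, eval_derivative_sectionPoly_swap] at h
  simp only [eval_pow, eval_sectionPoly_deriv]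
  exact h

end biPoly

/-! ### Coercivity and boundedness of the form on one cell -/

/-- The part of `cellForm` carrying the fluxes in the first coordinate direction. -/
noncomputable def fluxForm (r : ℕ) (G : ℕ → ℝ) (x₀ x₁ y₀ y₁ : ℝ) (D : ℝ × ℝ → ℝ)
    (W : ℕ → ℕ → ℝ) : ℝ :=
  ∑ k ∈ Finset.Icc 1 r, ∑ l ∈ Finset.range (r + 1), (W k l - W (k - 1) l) *
    ∫ t in (cellNode r G y₀ y₁ l)..(cellNode r G y₀ y₁ (l + 1)), D (gaussNode G x₀ x₁ k, t)

/-- The square of the `H¹` seminorm on a rectangle. -/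
noncomputable def cellEnergy (x₀ x₁ y₀ y₁ : ℝ) (f : ℝ × ℝ → ℝ) : ℝ :=
  rectInt (fun z => (pdx f z) ^ 2) x₀ x₁ y₀ y₁ + rectInt (fun z => (pdy f z) ^ 2) x₀ x₁ y₀ y₁

/-- `K` bounds the discrete traces of polynomials of degree at most `r` by their `L²` norms. -/
def GaussTraceBound (r : ℕ) (G A : ℕ → ℝ) (K : ℝ) : Prop :=
  ∀ x₀ x₁ : ℝ, x₀ < x₁ → ∀ l ∈ Finset.range (r + 1), ∀ p : ℝ[X], p.natDegree ≤ r →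
    (gaussTrace G A x₀ x₁ l p) ^ 2 ≤ K / (x₁ - x₀) * ∫ x in x₀..x₁, (p ^ 2).eval x

section cell

variable {r : ℕ} {G A : ℕ → ℝ} {c : ℕ → ℕ → ℝ} {x₀ x₁ y₀ y₁ : ℝ}

lemma cellForm_eq_fluxForm_add (Dx Dy : ℝ × ℝ → ℝ) (W : ℕ → ℕ → ℝ) :
    cellForm r G x₀ x₁ y₀ y₁ Dx Dy W = fluxForm r G x₀ x₁ y₀ y₁ Dx W +
      fluxForm r G y₀ y₁ x₀ x₁ (Dy ∘ Prod.swap) (fun l k => W k l) := rfl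

lemma fluxForm_sub {D D' : ℝ × ℝ → ℝ} (hD : Continuous D) (hD' : Continuous D')
    (W : ℕ → ℕ → ℝ) :
    fluxForm r G x₀ x₁ y₀ y₁ (fun z => D z - D' z) W =
      fluxForm r G x₀ x₁ y₀ y₁ D W - fluxForm r G x₀ x₁ y₀ y₁ D' W := by
  simp only [fluxForm, ← Finset.sum_sub_distrib, ← mul_sub]
  refine Finset.sum_congr rfl fun k _ => Finset.sum_congr rfl fun l _ => ?_
  rw [intervalIntegral.integral_sub]
  · exact Continuous.intervalIntegrable (by fun_prop) _ _
  · exact Continuous.intervalIntegrable (by fun_prop) _ _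

lemma cellForm_sub {Dx Dx' Dy Dy' : ℝ × ℝ → ℝ} (hx : Continuous Dx) (hx' : Continuous Dx')
    (hy : Continuous Dy) (hy' : Continuous Dy') (W : ℕ → ℕ → ℝ) :
    cellForm r G x₀ x₁ y₀ y₁ (fun z => Dx z - Dx' z) (fun z => Dy z - Dy' z) W =
      cellForm r G x₀ x₁ y₀ y₁ Dx Dy W - cellForm r G x₀ x₁ y₀ y₁ Dx' Dy' W := by
  simp only [cellForm_eq_fluxForm_add]
  rw [fluxForm_sub hx hx']
  have h := fluxForm_sub (r := r) (G := G) (x₀ := y₀) (x₁ := y₁) (y₀ := x₀) (y₁ := x₁)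
    (hy.comp continuous_swap) (hy'.comp continuous_swap) (fun l k => W k l)
  simp only [Function.comp_def] at h ⊢
  rw [h]
  ring

lemma pdx_biPoly_swap :
    pdx (biPoly r (fun a b => c b a)) = pdy (biPoly r c) ∘ Prod.swap := by
  rw [biPoly_swap, pdx_comp_swap (contDiff_biPoly.differentiable one_ne_zero)]

lemma rectInt_sq_pdx_biPoly_swap :
    rectInt (fun z => (pdx (biPoly r (fun a b => c b a)) z) ^ 2) y₀ y₁ x₀ x₁ =
      rectInt (fun z => (pdy (biPoly r c) z) ^ 2) x₀ x₁ y₀ y₁ := by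
  rw [pdx_biPoly_swap]
  exact rectInt_comp_swap (f := fun z => (pdy (biPoly r c) z) ^ 2)
    ((contDiff_pdy (n := 0) contDiff_biPoly).continuous.pow 2)

lemma cellEnergy_nonneg (hx : x₀ ≤ x₁) (hy : y₀ ≤ y₁) (f : ℝ × ℝ → ℝ) :
    0 ≤ cellEnergy x₀ x₁ y₀ y₁ f :=
  add_nonneg (rectInt_nonneg hx hy fun _ => sq_nonneg _)
    (rectInt_nonneg hx hy fun _ => sq_nonneg _)

lemma rectInt_le_fluxForm (hG : IsGaussPoints r G) (hA : IsGaussRule r G A) (hr : 1 ≤ r)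
    (hx : x₀ < x₁) (hy : y₀ < y₁) :
    rectInt (fun z => (pdx (biPoly r c) z) ^ 2) x₀ x₁ y₀ y₁ ≤
      fluxForm r G x₀ x₁ y₀ y₁ (pdx (biPoly r c)) (dualTrace r G A x₀ x₁ y₀ y₁ c) := by
  rw [← sum_weight_mul_integral_sectionPoly_sq hA hr, fluxForm]
  refine Finset.sum_le_sum fun k hk => ?_
  have hpos : 0 ≤ (x₁ - x₀) * A k / 2 :=
    div_nonneg (mul_nonneg (sub_nonneg.2 hx.le) (hA.pos k hk).le) two_pos.le
  refine (mul_le_mul_of_nonneg_left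
    (gaussTrace_coercive hG hA hr hy (natDegree_sectionPoly_le _)) hpos).trans_eq ?_
  rw [Finset.mul_sum]
  refine Finset.sum_congr rfl fun l _ => ?_
  rw [dualTrace_sub_pred (Finset.mem_Icc.1 hk).1, mul_assoc]
  simp only [eval_sectionPoly_deriv]

lemma cellEnergy_le_cellForm (hG : IsGaussPoints r G) (hA : IsGaussRule r G A) (hr : 1 ≤ r)
    (hx : x₀ < x₁) (hy : y₀ < y₁) :
    cellEnergy x₀ x₁ y₀ y₁ (biPoly r c) ≤
      cellForm r G x₀ x₁ y₀ y₁ (pdx (biPoly r c)) (pdy (biPoly r c))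
        (dualTrace r G A x₀ x₁ y₀ y₁ c) := by
  rw [cellForm_eq_fluxForm_add, cellEnergy]
  refine add_le_add (rectInt_le_fluxForm hG hA hr hx hy) ?_
  have h := rectInt_le_fluxForm (c := fun a b => c b a) hG hA hr hy hx
  rw [rectInt_sq_pdx_biPoly_swap, pdx_biPoly_swap] at h
  refine h.trans_eq ?_
  congr 1
  funext l k
  exact dualTrace_swap k l

/-- The jumps of the discrete trace are controlled by the energy. -/
lemma sq_dualTrace_sub_pred_le {K σ : ℝ} (hK : 0 ≤ K) (hA : IsGaussRule r G A) (hr : 1 ≤ r)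
    (hT : GaussTraceBound r G A K)
    (hx : x₀ < x₁) (hy : y₀ < y₁) (hσ : x₁ - x₀ ≤ σ * (y₁ - y₀)) {k l : ℕ}
    (hk : k ∈ Finset.Icc 1 r) (hl : l ∈ Finset.range (r + 1)) :
    (dualTrace r G A x₀ x₁ y₀ y₁ c k l - dualTrace r G A x₀ x₁ y₀ y₁ c (k - 1) l) ^ 2 ≤
      K * σ * rectInt (fun z => (pdx (biPoly r c) z) ^ 2) x₀ x₁ y₀ y₁ := by
  have hd : 0 < y₁ - y₀ := sub_pos.2 hy
  have hdx : 0 < x₁ - x₀ := sub_pos.2 hx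
  have hI : ∀ k ∈ Finset.Icc 1 r, 0 ≤ (x₁ - x₀) * A k / 2 * ∫ t in y₀..y₁,
      ((sectionPoly r c (fun a => a * gaussNode G x₀ x₁ k ^ (a - 1))) ^ 2).eval t := fun k hk =>
    mul_nonneg (div_nonneg (mul_nonneg hdx.le (hA.pos k hk).le) two_pos.le)
      (intervalIntegral.integral_nonneg hy.le fun t _ => by rw [eval_pow]; positivity)
  have hsum := Finset.single_le_sum hI hk
  rw [sum_weight_mul_integral_sectionPoly_sq hA hr] at hsum
  rw [dualTrace_sub_pred (Finset.mem_Icc.1 hk).1]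
  set p := sectionPoly r c (fun a => a * gaussNode G x₀ x₁ k ^ (a - 1)) with hp
  set I := ∫ t in y₀..y₁, (p ^ 2).eval t
  have hTp := hT y₀ y₁ hy l hl p (natDegree_sectionPoly_le _)
  have hw0 : 0 ≤ (x₁ - x₀) * A k / 2 :=
    div_nonneg (mul_nonneg hdx.le (hA.pos k hk).le) two_pos.le
  have hw : (x₁ - x₀) * A k / 2 ≤ σ * (y₁ - y₀) := by
    nlinarith [hA.weight_le_two hk]
  calc ((x₁ - x₀) * A k / 2 * gaussTrace G A y₀ y₁ l p) ^ 2
      = ((x₁ - x₀) * A k / 2) ^ 2 * (gaussTrace G A y₀ y₁ l p) ^ 2 := by ring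
    _ ≤ ((x₁ - x₀) * A k / 2) ^ 2 * (K / (y₁ - y₀) * I) :=
        mul_le_mul_of_nonneg_left hTp (sq_nonneg _)
    _ = K / (y₁ - y₀) * ((x₁ - x₀) * A k / 2) * ((x₁ - x₀) * A k / 2 * I) := by ring
    _ ≤ K / (y₁ - y₀) * (σ * (y₁ - y₀)) * ((x₁ - x₀) * A k / 2 * I) :=
        mul_le_mul_of_nonneg_right (mul_le_mul_of_nonneg_left hw (by positivity)) (hI k hk)
    _ = K * σ * ((x₁ - x₀) * A k / 2 * I) := by field_simp
    _ ≤ _ := mul_le_mul_of_nonneg_left hsum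
        (mul_nonneg hK (nonneg_of_mul_nonneg_left (hdx.le.trans hσ) hd))

lemma sq_integral_cellNode_le (hG : IsGaussPoints r G) (hy : y₀ < y₁) {g : ℝ → ℝ}
    (hg : Continuous g) {l : ℕ} (hl : l ∈ Finset.range (r + 1)) :
    (∫ t in (cellNode r G y₀ y₁ l)..(cellNode r G y₀ y₁ (l + 1)), g t) ^ 2 ≤
      (y₁ - y₀) * ∫ t in y₀..y₁, g t ^ 2 := by
  have hl' := Finset.mem_range.1 hl
  have h1 := hG.cellNode_mem_Icc hy (k := l) (by omega)
  have h2 := hG.cellNode_mem_Icc hy (k := l + 1) (by omega)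
  refine le_trans ?_ (sq_integral_abs_le hg hy)
  rw [← sq_abs]
  refine pow_le_pow_left₀ (abs_nonneg _) ?_ 2
  refine (intervalIntegral.norm_integral_le_abs_integral_norm (f := g) (μ := volume)).trans ?_
  refine (intervalIntegral.abs_integral_mono_interval (c := y₀) (d := y₁) ?_
    (Filter.Eventually.of_forall fun _ => norm_nonneg _)
    (hg.norm.intervalIntegrable _ _)).trans_eq
    (abs_of_nonneg (intervalIntegral.integral_nonneg hy.le fun _ _ => abs_nonneg _))
  rw [Set.uIoc_of_le hy.le]
  exact Set.Ioc_subset_Ioc (le_min h1.1 h2.1) (max_le h1.2 h2.2)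

lemma abs_fluxForm_le {K σ h E : ℝ} (hK : 0 ≤ K) (hG : IsGaussPoints r G)
    (hA : IsGaussRule r G A) (hr : 1 ≤ r)
    (hT : GaussTraceBound r G A K)
    (hx : x₀ < x₁) (hy : y₀ < y₁) (hσ : x₁ - x₀ ≤ σ * (y₁ - y₀)) (hyh : y₁ - y₀ ≤ h)
    {D : ℝ × ℝ → ℝ} (hD : Continuous D)
    (hE : ∀ x ∈ Set.Icc x₀ x₁, h * ∫ y in y₀..y₁, D (x, y) ^ 2 ≤ E) :
    |fluxForm r G x₀ x₁ y₀ y₁ D (dualTrace r G A x₀ x₁ y₀ y₁ c)| ≤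
      r * (r + 1) * (√(K * σ * rectInt (fun z => (pdx (biPoly r c) z) ^ 2) x₀ x₁ y₀ y₁) *
        √E) := by
  have hterm : ∀ k ∈ Finset.Icc 1 r, ∀ l ∈ Finset.range (r + 1),
      |(dualTrace r G A x₀ x₁ y₀ y₁ c k l - dualTrace r G A x₀ x₁ y₀ y₁ c (k - 1) l) *
        ∫ t in (cellNode r G y₀ y₁ l)..(cellNode r G y₀ y₁ (l + 1)), D (gaussNode G x₀ x₁ k, t)| ≤
      √(K * σ * rectInt (fun z => (pdx (biPoly r c) z) ^ 2) x₀ x₁ y₀ y₁) * √E := by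
    intro k hk l hl
    rw [abs_mul]
    refine mul_le_mul
      (Real.abs_le_sqrt (sq_dualTrace_sub_pred_le hK hA hr hT hx hy hσ hk hl))
      (Real.abs_le_sqrt ?_) (abs_nonneg _) (Real.sqrt_nonneg _)
    refine (sq_integral_cellNode_le hG hy
      (hD.comp (Continuous.prodMk_right (gaussNode G x₀ x₁ k))) hl).trans ?_
    refine le_trans ?_ (hE _ (Set.Ioo_subset_Icc_self (hG.gaussNode_mem_Ioo hx hk)))
    exact mul_le_mul_of_nonneg_right hyh
      (intervalIntegral.integral_nonneg hy.le fun _ _ => sq_nonneg _)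
  refine (Finset.abs_sum_le_sum_abs _ _).trans ((Finset.sum_le_sum fun k hk =>
    (Finset.abs_sum_le_sum_abs _ _).trans (Finset.sum_le_sum (hterm k hk))).trans_eq ?_)
  simp only [Finset.sum_const, Finset.card_range, Nat.card_Icc, Nat.add_sub_cancel, nsmul_eq_mul]
  push_cast
  ring

lemma abs_cellForm_le {K σ h E : ℝ} (hK : 0 ≤ K) (hG : IsGaussPoints r G)
    (hA : IsGaussRule r G A) (hr : 1 ≤ r)
    (hT : GaussTraceBound r G A K)
    (hx : x₀ < x₁) (hy : y₀ < y₁) (hσ : 0 ≤ σ) (hxσ : x₁ - x₀ ≤ σ * (y₁ - y₀))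
    (hyσ : y₁ - y₀ ≤ σ * (x₁ - x₀)) (hxh : x₁ - x₀ ≤ h) (hyh : y₁ - y₀ ≤ h)
    {Dx Dy : ℝ × ℝ → ℝ} (hDx : Continuous Dx) (hDy : Continuous Dy)
    (hEx : ∀ x ∈ Set.Icc x₀ x₁, h * ∫ y in y₀..y₁, Dx (x, y) ^ 2 ≤ E)
    (hEy : ∀ y ∈ Set.Icc y₀ y₁, h * ∫ x in x₀..x₁, Dy (x, y) ^ 2 ≤ E) :
    |cellForm r G x₀ x₁ y₀ y₁ Dx Dy (dualTrace r G A x₀ x₁ y₀ y₁ c)| ≤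
      2 * (r * (r + 1)) * √(K * σ) * (√(cellEnergy x₀ x₁ y₀ y₁ (biPoly r c)) * √E) := by
  have hcx : 0 ≤ rectInt (fun z => (pdx (biPoly r c) z) ^ 2) x₀ x₁ y₀ y₁ :=
    rectInt_nonneg hx.le hy.le fun _ => sq_nonneg _
  have hcy : 0 ≤ rectInt (fun z => (pdy (biPoly r c) z) ^ 2) x₀ x₁ y₀ y₁ :=
    rectInt_nonneg hx.le hy.le fun _ => sq_nonneg _
  have h1 := abs_fluxForm_le (c := c) hK hG hA hr hT hx hy hxσ hyh hDx hEx
  have h2 := abs_fluxForm_le (c := fun a b => c b a) hK hG hA hr hT hy hx hyσ hxh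
    (hDy.comp continuous_swap) hEy
  rw [rectInt_sq_pdx_biPoly_swap] at h2
  have hW : dualTrace r G A y₀ y₁ x₀ x₁ (fun a b => c b a) =
      fun l k => dualTrace r G A x₀ x₁ y₀ y₁ c k l := by
    funext l k; exact dualTrace_swap k l
  rw [hW] at h2
  rw [Real.sqrt_mul (mul_nonneg hK hσ)] at h1 h2
  have h3 : √(rectInt (fun z => (pdx (biPoly r c) z) ^ 2) x₀ x₁ y₀ y₁) ≤
      √(cellEnergy x₀ x₁ y₀ y₁ (biPoly r c)) := Real.sqrt_le_sqrt (by unfold cellEnergy; linarith)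
  have h4 : √(rectInt (fun z => (pdy (biPoly r c) z) ^ 2) x₀ x₁ y₀ y₁) ≤
      √(cellEnergy x₀ x₁ y₀ y₁ (biPoly r c)) := Real.sqrt_le_sqrt (by unfold cellEnergy; linarith)
  have h5 : (0 : ℝ) ≤ r * (r + 1) * √(K * σ) * √E := by positivity
  rw [cellForm_eq_fluxForm_add]
  refine (abs_add_le _ _).trans ((add_le_add h1 h2).trans ?_)
  have := mul_le_mul_of_nonneg_left (add_le_add h3 h4) h5
  linarith

end cell

/-! ### The test function attached to a conforming piecewise polynomial -/

lemma dualTrace_matching {r m : ℕ} {G A : ℕ → ℝ} (hA : IsGaussRule r G A) (hr : 1 ≤ r)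
    (hm : 0 < m) (z : ℕ → ℝ) {t₀ t₁ : ℝ} (ht : t₀ < t₁) (c : ℕ → ℕ → ℕ → ℝ) (e : ℕ → ℝ → ℝ)
    (he : ∀ t ∈ Set.Icc t₀ t₁, e 0 t = 0 ∧ e m t = 0 ∧ ∀ i ∈ Finset.Icc 1 m,
      biPoly r (c i) (z (i - 1), t) = e (i - 1) t ∧ biPoly r (c i) (z i, t) = e i t) (l : ℕ) :
    dualTrace r G A (z 0) (z 1) t₀ t₁ (c 1) 0 l = 0 ∧
    dualTrace r G A (z (m - 1)) (z m) t₀ t₁ (c m) r l = 0 ∧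
    ∀ i, 1 ≤ i → i < m → dualTrace r G A (z i) (z (i + 1)) t₀ t₁ (c (i + 1)) 0 l =
      dualTrace r G A (z (i - 1)) (z i) t₀ t₁ (c i) r l := by
  have hext : ∀ p q : ℝ[X], (∀ t ∈ Set.Icc t₀ t₁, p.eval t = q.eval t) → p = q := fun p q h =>
    Polynomial.eq_of_infinite_eval_eq _ _ ((Set.Icc_infinite ht).mono h)
  simp only [dualTrace_zero_left, dualTrace_last_left hA hr]
  refine ⟨?_, ?_, fun i hi him => ?_⟩
  · rw [hext (sectionPoly r (c 1) fun a => z 0 ^ a) 0, map_zero]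
    intro t htt
    have h := (he t htt).2.2 1 (Finset.mem_Icc.2 ⟨le_rfl, hm⟩)
    rw [eval_sectionPoly_pow, eval_zero, ← (he t htt).1]
    exact h.1
  · rw [hext (sectionPoly r (c m) fun a => z m ^ a) 0, map_zero]
    intro t htt
    rw [eval_sectionPoly_pow, eval_zero, ← (he t htt).2.1]
    exact ((he t htt).2.2 m (Finset.mem_Icc.2 ⟨hm, le_rfl⟩)).2
  · rw [hext (sectionPoly r (c (i + 1)) fun a => z i ^ a) (sectionPoly r (c i) fun a => z i ^ a)]
    intro t htt
    rw [eval_sectionPoly_pow, eval_sectionPoly_pow,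
      ((he t htt).2.2 i (Finset.mem_Icc.2 ⟨hi, him.le⟩)).2]
    exact ((he t htt).2.2 (i + 1) (Finset.mem_Icc.2 ⟨by omega, him⟩)).1

section interp

variable {r : ℕ} {x₀ x₁ y₀ y₁ : ℝ} {f : ℝ × ℝ → ℝ}

lemma cellInterp_left (hr : 1 ≤ r) (hx : x₀ < x₁) (t : ℝ) :
    cellInterp r x₀ x₁ y₀ y₁ f (x₀, t) = ∑ l ∈ Finset.range (r + 1),
      f (x₀, interpNode r y₀ y₁ l) * (nodal r y₀ y₁ l).eval t := by
  rw [cellInterp, Finset.sum_comm]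
  refine Finset.sum_congr rfl fun l _ => ?_
  have h := sum_mul_eval_nodal_left hr hx fun k =>
    f (interpNode r x₀ x₁ k, interpNode r y₀ y₁ l) * (nodal r y₀ y₁ l).eval t
  rw [interpNode_zero] at h
  exact (Finset.sum_congr rfl fun k _ => by ring).trans h

lemma cellInterp_right (hr : 1 ≤ r) (hx : x₀ < x₁) (t : ℝ) :
    cellInterp r x₀ x₁ y₀ y₁ f (x₁, t) = ∑ l ∈ Finset.range (r + 1),
      f (x₁, interpNode r y₀ y₁ l) * (nodal r y₀ y₁ l).eval t := by
  rw [cellInterp, Finset.sum_comm]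
  refine Finset.sum_congr rfl fun l _ => ?_
  have h := sum_mul_eval_nodal_right hr hx fun k =>
    f (interpNode r x₀ x₁ k, interpNode r y₀ y₁ l) * (nodal r y₀ y₁ l).eval t
  rw [interpNode_last hr] at h
  exact (Finset.sum_congr rfl fun k _ => by ring).trans h

lemma cellInterp_bottom (hr : 1 ≤ r) (hy : y₀ < y₁) (s : ℝ) :
    cellInterp r x₀ x₁ y₀ y₁ f (s, y₀) = ∑ k ∈ Finset.range (r + 1),
      f (interpNode r x₀ x₁ k, y₀) * (nodal r x₀ x₁ k).eval s := by
  have h := cellInterp_left (y₀ := x₀) (y₁ := x₁) (f := f ∘ Prod.swap) hr hy s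
  rwa [cellInterp_comp_swap] at h

lemma cellInterp_top (hr : 1 ≤ r) (hy : y₀ < y₁) (s : ℝ) :
    cellInterp r x₀ x₁ y₀ y₁ f (s, y₁) = ∑ k ∈ Finset.range (r + 1),
      f (interpNode r x₀ x₁ k, y₁) * (nodal r x₀ x₁ k).eval s := by
  have h := cellInterp_right (y₀ := x₀) (y₁ := x₁) (f := f ∘ Prod.swap) hr hy s
  rwa [cellInterp_comp_swap] at h

end interp

namespace RectPartition

variable {a b c d : ℝ} (P : RectPartition a b c d)

/-- Cell functions with single-valued traces on the vertical edges, zero on `x = a, b`. -/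
def ConformsX (v : ℕ → ℕ → ℝ × ℝ → ℝ) : Prop :=
  ∃ e : ℕ → ℕ → ℝ → ℝ, ∀ j ∈ Finset.Icc 1 P.n, ∀ t ∈ Set.Icc (P.y (j - 1)) (P.y j),
    e 0 j t = 0 ∧ e P.m j t = 0 ∧ ∀ i ∈ Finset.Icc 1 P.m,
      v i j (P.x (i - 1), t) = e (i - 1) j t ∧ v i j (P.x i, t) = e i j t

/-- Cell functions with single-valued traces on the horizontal edges, zero on `y = c, d`. -/
def ConformsY (v : ℕ → ℕ → ℝ × ℝ → ℝ) : Prop :=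
  ∃ e : ℕ → ℕ → ℝ → ℝ, ∀ i ∈ Finset.Icc 1 P.m, ∀ s ∈ Set.Icc (P.x (i - 1)) (P.x i),
    e i 0 s = 0 ∧ e i P.n s = 0 ∧ ∀ j ∈ Finset.Icc 1 P.n,
      v i j (s, P.y (j - 1)) = e i (j - 1) s ∧ v i j (s, P.y j) = e i j s

/-- The cellwise interpolant of `u`. -/
noncomputable def interp (r : ℕ) (u : PiecewiseFun P) (i j : ℕ) : ℝ × ℝ → ℝ :=
  cellInterp r (P.x (i - 1)) (P.x i) (P.y (j - 1)) (P.y j) (u.cellFun i j)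

/-- The test function coefficients attached to cellwise coefficient matrices. -/
noncomputable def cellTrace (r : ℕ) (G A : ℕ → ℝ) (γ : ℕ → ℕ → ℕ → ℕ → ℝ) (i k j l : ℕ) : ℝ :=
  dualTrace r G A (P.x (i - 1)) (P.x i) (P.y (j - 1)) (P.y j) (γ i j) k l

variable {P}

lemma ConformsX.sub {v v' : ℕ → ℕ → ℝ × ℝ → ℝ} (hv : P.ConformsX v) (hv' : P.ConformsX v') :
    P.ConformsX fun i j z => v i j z - v' i j z := by
  obtain ⟨e, he⟩ := hv
  obtain ⟨e', he'⟩ := hv'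
  refine ⟨fun i j t => e i j t - e' i j t, fun j hj t ht => ?_⟩
  obtain ⟨h0, hm, h⟩ := he j hj t ht
  obtain ⟨h0', hm', h'⟩ := he' j hj t ht
  refine ⟨by simp only [h0, h0', sub_zero], by simp only [hm, hm', sub_zero], fun i hi => ?_⟩
  exact ⟨by simp only [(h i hi).1, (h' i hi).1], by simp only [(h i hi).2, (h' i hi).2]⟩

lemma ConformsY.sub {v v' : ℕ → ℕ → ℝ × ℝ → ℝ} (hv : P.ConformsY v) (hv' : P.ConformsY v') :
    P.ConformsY fun i j z => v i j z - v' i j z := by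
  obtain ⟨e, he⟩ := hv
  obtain ⟨e', he'⟩ := hv'
  refine ⟨fun i j s => e i j s - e' i j s, fun i hi s hs => ?_⟩
  obtain ⟨h0, hn, h⟩ := he i hi s hs
  obtain ⟨h0', hn', h'⟩ := he' i hi s hs
  refine ⟨by simp only [h0, h0', sub_zero], by simp only [hn, hn', sub_zero], fun j hj => ?_⟩
  exact ⟨by simp only [(h j hj).1, (h' j hj).1], by simp only [(h j hj).2, (h' j hj).2]⟩

lemma ConformsX.congr {v v' : ℕ → ℕ → ℝ × ℝ → ℝ} (hv : P.ConformsX v)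
    (h : ∀ i ∈ Finset.Icc 1 P.m, ∀ j ∈ Finset.Icc 1 P.n, v' i j = v i j) : P.ConformsX v' := by
  obtain ⟨e, he⟩ := hv
  refine ⟨e, fun j hj t ht => ⟨(he j hj t ht).1, (he j hj t ht).2.1, fun i hi => ?_⟩⟩
  rw [h i hi j hj]
  exact (he j hj t ht).2.2 i hi

lemma ConformsY.congr {v v' : ℕ → ℕ → ℝ × ℝ → ℝ} (hv : P.ConformsY v)
    (h : ∀ i ∈ Finset.Icc 1 P.m, ∀ j ∈ Finset.Icc 1 P.n, v' i j = v i j) : P.ConformsY v' := by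
  obtain ⟨e, he⟩ := hv
  refine ⟨e, fun i hi s hs => ⟨(he i hi s hs).1, (he i hi s hs).2.1, fun j hj => ?_⟩⟩
  rw [h i hi j hj]
  exact (he i hi s hs).2.2 j hj

lemma mem_bdry_of_vertical {i j : ℕ} (hi : i = 0 ∨ i = P.m) (hj : j ∈ Finset.Icc 1 P.n) {t : ℝ}
    (ht : t ∈ Set.Icc (P.y (j - 1)) (P.y j)) : (P.x i, t) ∈ P.bdry := by
  rw [Finset.mem_Icc] at hj
  refine ⟨⟨P.x_mem (by omega), (P.y_mem (j := j - 1) (by omega)).1.trans ht.1,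
    ht.2.trans (P.y_mem hj.2).2⟩, fun h => ?_⟩
  rcases hi with rfl | rfl
  · exact h.1.1.ne P.hxa.symm
  · exact h.1.2.ne P.hxb

lemma mem_bdry_of_horizontal {i j : ℕ} (hj : j = 0 ∨ j = P.n) (hi : i ∈ Finset.Icc 1 P.m) {s : ℝ}
    (hs : s ∈ Set.Icc (P.x (i - 1)) (P.x i)) : (s, P.y j) ∈ P.bdry := by
  rw [Finset.mem_Icc] at hi
  refine ⟨⟨⟨(P.x_mem (i := i - 1) (by omega)).1.trans hs.1,
    hs.2.trans (P.x_mem hi.2).2⟩, P.y_mem (by omega)⟩, fun h => ?_⟩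
  rcases hj with rfl | rfl
  · exact h.2.1.ne P.hyc.symm
  · exact h.2.2.ne P.hyd

lemma conformsX_cellFun {u : PiecewiseFun P} (hu : ∀ z ∈ P.bdry, u.toFun z = 0) :
    P.ConformsX u.cellFun := by
  refine ⟨fun i _ t => u.toFun (P.x i, t), fun j hj t ht =>
    ⟨hu _ (mem_bdry_of_vertical (.inl rfl) hj ht), hu _ (mem_bdry_of_vertical (.inr rfl) hj ht),
      fun i hi => ⟨?_, ?_⟩⟩⟩
  · exact u.agree i hi j hj _ ⟨Set.left_mem_Icc.2 (P.x_pred_lt hi).le, ht⟩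
  · exact u.agree i hi j hj _ ⟨Set.right_mem_Icc.2 (P.x_pred_lt hi).le, ht⟩

lemma conformsY_cellFun {u : PiecewiseFun P} (hu : ∀ z ∈ P.bdry, u.toFun z = 0) :
    P.ConformsY u.cellFun := by
  refine ⟨fun _ j s => u.toFun (s, P.y j), fun i hi s hs =>
    ⟨hu _ (mem_bdry_of_horizontal (.inl rfl) hi hs),
      hu _ (mem_bdry_of_horizontal (.inr rfl) hi hs), fun j hj => ⟨?_, ?_⟩⟩⟩
  · exact u.agree i hi j hj _ ⟨hs, Set.left_mem_Icc.2 (P.y_pred_lt hj).le⟩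
  · exact u.agree i hi j hj _ ⟨hs, Set.right_mem_Icc.2 (P.y_pred_lt hj).le⟩

lemma conformsX_interp {r : ℕ} (hr : 1 ≤ r) {u : PiecewiseFun P} (hu : P.ConformsX u.cellFun) :
    P.ConformsX (P.interp r u) := by
  obtain ⟨e, he⟩ := hu
  refine ⟨fun i j t => ∑ l ∈ Finset.range (r + 1), e i j (interpNode r (P.y (j - 1)) (P.y j) l) *
    (nodal r (P.y (j - 1)) (P.y j) l).eval t, fun j hj t _ => ?_⟩
  have hnode := fun l hl => he j hj _ (interpNode_mem hr (P.y_pred_lt hj) (k := l) hl)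
  refine ⟨Finset.sum_eq_zero fun l hl => ?_, Finset.sum_eq_zero fun l hl => ?_,
    fun i hi => ⟨?_, ?_⟩⟩
  · rw [(hnode l hl).1, zero_mul]
  · rw [(hnode l hl).2.1, zero_mul]
  · rw [interp, cellInterp_left hr (P.x_pred_lt hi)]
    exact Finset.sum_congr rfl fun l hl => by rw [((hnode l hl).2.2 i hi).1]
  · rw [interp, cellInterp_right hr (P.x_pred_lt hi)]
    exact Finset.sum_congr rfl fun l hl => by rw [((hnode l hl).2.2 i hi).2]

lemma conformsY_interp {r : ℕ} (hr : 1 ≤ r) {u : PiecewiseFun P} (hu : P.ConformsY u.cellFun) :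
    P.ConformsY (P.interp r u) := by
  obtain ⟨e, he⟩ := hu
  refine ⟨fun i j s => ∑ k ∈ Finset.range (r + 1), e i j (interpNode r (P.x (i - 1)) (P.x i) k) *
    (nodal r (P.x (i - 1)) (P.x i) k).eval s, fun i hi s _ => ?_⟩
  have hnode := fun k hk => he i hi _ (interpNode_mem hr (P.x_pred_lt hi) (k := k) hk)
  refine ⟨Finset.sum_eq_zero fun k hk => ?_, Finset.sum_eq_zero fun k hk => ?_,
    fun j hj => ⟨?_, ?_⟩⟩
  · rw [(hnode k hk).1, zero_mul]
  · rw [(hnode k hk).2.1, zero_mul]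
  · rw [interp, cellInterp_bottom hr (P.y_pred_lt hj)]
    exact Finset.sum_congr rfl fun k hk => by rw [((hnode k hk).2.2 j hj).1]
  · rw [interp, cellInterp_top hr (P.y_pred_lt hj)]
    exact Finset.sum_congr rfl fun k hk => by rw [((hnode k hk).2.2 j hj).2]

section trace

variable {r : ℕ} {G A : ℕ → ℝ} {γ : ℕ → ℕ → ℕ → ℕ → ℝ}

lemma cellTrace_matching_left (hA : IsGaussRule r G A) (hr : 1 ≤ r)
    (hγ : P.ConformsX fun i j => biPoly r (γ i j)) {j : ℕ} (hj : j ∈ Finset.Icc 1 P.n) (l : ℕ) :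
    P.cellTrace r G A γ 1 0 j l = 0 ∧ P.cellTrace r G A γ P.m r j l = 0 ∧
    ∀ i, 1 ≤ i → i < P.m →
      P.cellTrace r G A γ (i + 1) 0 j l = P.cellTrace r G A γ i r j l := by
  obtain ⟨e, he⟩ := hγ
  exact dualTrace_matching hA hr P.hm P.x (P.y_pred_lt hj) (fun i => γ i j) (fun i => e i j)
    (he j hj) l

lemma cellTrace_matching_bottom (hA : IsGaussRule r G A) (hr : 1 ≤ r)
    (hγ : P.ConformsY fun i j => biPoly r (γ i j)) {i : ℕ} (hi : i ∈ Finset.Icc 1 P.m) (k : ℕ) :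
    P.cellTrace r G A γ i k 1 0 = 0 ∧ P.cellTrace r G A γ i k P.n r = 0 ∧
    ∀ j, 1 ≤ j → j < P.n →
      P.cellTrace r G A γ i k (j + 1) 0 = P.cellTrace r G A γ i k j r := by
  obtain ⟨e, he⟩ := hγ
  have hei := he i hi
  have h := dualTrace_matching hA hr P.hn P.y (P.x_pred_lt hi) (fun j a b => γ i j b a)
    (fun j => e i j)
    (by simpa only [biPoly_swap, Function.comp_apply, Prod.swap_prod_mk] using hei) k
  simp only [dualTrace_swap] at h
  exact h

lemma isTestFun_cellTrace (hA : IsGaussRule r G A) (hr : 1 ≤ r)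
    (hx : P.ConformsX fun i j => biPoly r (γ i j)) (hy : P.ConformsY fun i j => biPoly r (γ i j)) :
    IsTestFun r P (P.cellTrace r G A γ) :=
  ⟨fun _ hj l _ => (cellTrace_matching_left hA hr hx hj l).2.1,
    fun _ hi k _ => (cellTrace_matching_bottom hA hr hy hi k).2.1⟩

lemma wE_cellTrace (hA : IsGaussRule r G A) (hr : 1 ≤ r)
    (hx : P.ConformsX fun i j => biPoly r (γ i j)) (hy : P.ConformsY fun i j => biPoly r (γ i j))
    {i j : ℕ} (hi : i ∈ Finset.Icc 1 P.m) (hj : j ∈ Finset.Icc 1 P.n) (k l : ℕ) :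
    wE r (P.cellTrace r G A γ) i k j l = P.cellTrace r G A γ i k j l := by
  have hX := cellTrace_matching_left hA hr hx hj
  have hY := fun {i} (hi : i ∈ Finset.Icc 1 P.m) => cellTrace_matching_bottom hA hr hy hi
  rw [wE]
  split_ifs with h hk hl hl
  · rcases h with ⟨rfl, rfl⟩ | ⟨rfl, rfl⟩
    · exact (hX l).1.symm
    · exact (hY hi k).1.symm
  all_goals
    rw [Finset.mem_Icc] at hi hj
  · obtain ⟨i, rfl⟩ := Nat.exists_eq_add_of_le' hi.1
    obtain ⟨j, rfl⟩ := Nat.exists_eq_add_of_le' hj.1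
    rw [hk, hl, (hX 0).2.2 i (by omega) (by omega),
      (hY (Finset.mem_Icc.2 ⟨by omega, by omega⟩) r).2.2 j (by omega) (by omega)]
    rfl
  · obtain ⟨i, rfl⟩ := Nat.exists_eq_add_of_le' hi.1
    rw [hk, (hX l).2.2 i (by omega) (by omega)]
    rfl
  · obtain ⟨j, rfl⟩ := Nat.exists_eq_add_of_le' hj.1
    rw [hl, (hY (Finset.mem_Icc.2 hi) k).2.2 j (by omega) (by omega)]
    rfl

end trace

end RectPartition

lemma pdx_sub {f g : ℝ × ℝ → ℝ} (hf : Differentiable ℝ f) (hg : Differentiable ℝ g) :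
    pdx (fun z => f z - g z) = fun z => pdx f z - pdx g z := by
  funext z
  simp only [pdx, fderiv_fun_sub (hf z) (hg z), sub_apply]

lemma pdy_sub {f g : ℝ × ℝ → ℝ} (hf : Differentiable ℝ f) (hg : Differentiable ℝ g) :
    pdy (fun z => f z - g z) = fun z => pdy f z - pdy g z := by
  funext z
  simp only [pdy, fderiv_fun_sub (hf z) (hg z), sub_apply]

section cellwise

variable {x₀ x₁ y₀ y₁ : ℝ}

lemma rectInt_mono {f g : ℝ × ℝ → ℝ} (hf : Continuous f) (hg : Continuous g) (hx : x₀ ≤ x₁)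
    (hy : y₀ ≤ y₁) (h : ∀ z, f z ≤ g z) :
    rectInt f x₀ x₁ y₀ y₁ ≤ rectInt g x₀ x₁ y₀ y₁ :=
  intervalIntegral.integral_mono_on hx ((continuous_integral_right hf _ _).intervalIntegrable _ _)
    ((continuous_integral_right hg _ _).intervalIntegrable _ _) fun s _ =>
      intervalIntegral.integral_mono_on hy (Continuous.intervalIntegrable (by fun_prop) _ _)
        (Continuous.intervalIntegrable (by fun_prop) _ _) fun t _ => h (s, t)

lemma rectInt_const_mul (k : ℝ) (f : ℝ × ℝ → ℝ) :
    rectInt (fun z => k * f z) x₀ x₁ y₀ y₁ = k * rectInt f x₀ x₁ y₀ y₁ := by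
  simp only [rectInt, intervalIntegral.integral_const_mul]

lemma rectInt_sq_sub_le {f g p : ℝ × ℝ → ℝ} (hf : Continuous f) (hg : Continuous g)
    (hp : Continuous p) (hx : x₀ ≤ x₁) (hy : y₀ ≤ y₁) :
    rectInt (fun z => (f z - g z) ^ 2) x₀ x₁ y₀ y₁ ≤
      2 * rectInt (fun z => (f z - p z) ^ 2) x₀ x₁ y₀ y₁ +
        2 * rectInt (fun z => (g z - p z) ^ 2) x₀ x₁ y₀ y₁ := by
  rw [← rectInt_const_mul, ← rectInt_const_mul, ← rectInt_add (by fun_prop) (by fun_prop)]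
  refine rectInt_mono (by fun_prop) (by fun_prop) hx hy fun z => ?_
  nlinarith [sq_nonneg (f z - p z + (g z - p z))]

lemma rectInt_le_of_forall_mul_integral_le {D : ℝ × ℝ → ℝ} (hD : Continuous D)
    (hD0 : ∀ z, 0 ≤ D z) {h E : ℝ} (hx : x₀ < x₁) (hy : y₀ ≤ y₁) (hh : x₁ - x₀ ≤ h)
    (hE : ∀ x ∈ Set.Icc x₀ x₁, h * ∫ y in y₀..y₁, D (x, y) ≤ E) :
    rectInt D x₀ x₁ y₀ y₁ ≤ E := by
  have hpos : 0 < h := (sub_pos.2 hx).trans_le hh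
  have hE0 : 0 ≤ E :=
    (mul_nonneg hpos.le (intervalIntegral.integral_nonneg hy fun _ _ => hD0 _)).trans
      (hE x₀ (Set.left_mem_Icc.2 hx.le))
  calc rectInt D x₀ x₁ y₀ y₁ ≤ ∫ _ in x₀..x₁, E / h :=
        intervalIntegral.integral_mono_on hx.le
          ((continuous_integral_right hD _ _).intervalIntegrable _ _)
          intervalIntegrable_const fun s hs => by
            rw [le_div_iff₀ hpos, mul_comm]
            exact hE s hs
    _ = (x₁ - x₀) / h * E := by
        rw [intervalIntegral.integral_const, smul_eq_mul]
        ring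
    _ ≤ E := mul_le_of_le_one_left hE0 ((div_le_one hpos).2 hh)

lemma cellEnergy_sub_le {f g p : ℝ × ℝ → ℝ} (hf : ContDiff ℝ 1 f) (hg : ContDiff ℝ 1 g)
    (hp : ContDiff ℝ 1 p) {h E : ℝ} (hx : x₀ < x₁) (hy : y₀ < y₁) (hxh : x₁ - x₀ ≤ h)
    (hyh : y₁ - y₀ ≤ h)
    (hEx : ∀ x ∈ Set.Icc x₀ x₁, h * ∫ y in y₀..y₁, (pdx f (x, y) - pdx p (x, y)) ^ 2 ≤ E)
    (hEy : ∀ y ∈ Set.Icc y₀ y₁, h * ∫ x in x₀..x₁, (pdy f (x, y) - pdy p (x, y)) ^ 2 ≤ E) :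
    cellEnergy x₀ x₁ y₀ y₁ (fun z => f z - g z) ≤
      4 * E + 2 * cellEnergy x₀ x₁ y₀ y₁ (fun z => g z - p z) := by
  have hdf := hf.differentiable one_ne_zero
  have hdg := hg.differentiable one_ne_zero
  have hdp := hp.differentiable one_ne_zero
  have hcx : ∀ {v : ℝ × ℝ → ℝ}, ContDiff ℝ 1 v → Continuous (pdx v) := fun hv =>
    (contDiff_pdx (n := 0) (by exact_mod_cast hv)).continuous
  have hcy : ∀ {v : ℝ × ℝ → ℝ}, ContDiff ℝ 1 v → Continuous (pdy v) := fun hv =>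
    (contDiff_pdy (n := 0) (by exact_mod_cast hv)).continuous
  have hX := rectInt_le_of_forall_mul_integral_le
    (D := fun z => (pdx f z - pdx p z) ^ 2) (((hcx hf).sub (hcx hp)).pow 2)
    (fun _ => sq_nonneg _) hx hy.le hxh hEx
  have hY := rectInt_le_of_forall_mul_integral_le
    (D := (fun z => (pdy f z - pdy p z) ^ 2) ∘ Prod.swap)
    ((((hcy hf).sub (hcy hp)).pow 2).comp continuous_swap)
    (fun _ => sq_nonneg _) hy hx.le hyh hEy
  rw [rectInt_comp_swap (f := fun z => (pdy f z - pdy p z) ^ 2)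
    (((hcy hf).sub (hcy hp)).pow 2)] at hY
  have hX' := rectInt_sq_sub_le (hcx hf) (hcx hg) (hcx hp) hx.le hy.le
  have hY' := rectInt_sq_sub_le (hcy hf) (hcy hg) (hcy hp) hx.le hy.le
  rw [cellEnergy, cellEnergy, pdx_sub hdf hdg, pdy_sub hdf hdg, pdx_sub hdg hdp, pdy_sub hdg hdp]
  linarith

end cellwise

namespace RectPartition

variable {a b c d : ℝ} {P : RectPartition a b c d}

lemma sub_mem_sides_x {i : ℕ} (hi : i ∈ Finset.Icc 1 P.m) : P.x i - P.x (i - 1) ∈ P.sides :=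
  Finset.mem_union_left _ (Finset.mem_image_of_mem P.hx hi)

lemma sub_mem_sides_y {j : ℕ} (hj : j ∈ Finset.Icc 1 P.n) : P.y j - P.y (j - 1) ∈ P.sides :=
  Finset.mem_union_right _ (Finset.mem_image_of_mem P.hy hj)

lemma le_meshSize {s : ℝ} (hs : s ∈ P.sides) : s ≤ P.meshSize :=
  Finset.le_max' _ _ hs

lemma meshSize_pos : 0 < P.meshSize := by
  have h1 : 1 ∈ Finset.Icc 1 P.m := Finset.mem_Icc.2 ⟨le_rfl, P.hm⟩
  exact (sub_pos.2 (P.x_pred_lt h1)).trans_le (le_meshSize (sub_mem_sides_x h1))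

lemma IsCellValue.mem_Icc {α : ℝ × ℝ → ℝ} {κ : ℕ → ℕ → ℝ} (hκ : P.IsCellValue α κ) {α₀ α₁ : ℝ}
    (hα : ∀ z ∈ P.dom, α₀ ≤ α z ∧ α z ≤ α₁) {i j : ℕ} (hi : i ∈ Finset.Icc 1 P.m)
    (hj : j ∈ Finset.Icc 1 P.n) : κ i j ∈ Set.Icc α₀ α₁ := by
  obtain ⟨s, hs⟩ := exists_between (P.x_pred_lt hi)
  obtain ⟨t, ht⟩ := exists_between (P.y_pred_lt hj)
  have hz : (s, t) ∈ P.openCell i j := ⟨hs, ht⟩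
  rw [← hκ i hi j hj _ hz]
  exact hα _ (P.cell_subset_dom hi hj (P.openCell_subset_cell i j hz))

end RectPartition

section seminorms

variable {a b c d : ℝ} {P : RectPartition a b c d}

lemma semiH1_eq {v : PiecewiseFun P} (hv : CellSmooth P 1 v) :
    semiH1 P v = √(∑ i ∈ Finset.Icc 1 P.m, ∑ j ∈ Finset.Icc 1 P.n,
      cellEnergy (P.x (i - 1)) (P.x i) (P.y (j - 1)) (P.y j) (v.cellFun i j)) := by
  rw [semiH1]
  congr 1
  refine Finset.sum_congr rfl fun i hi => Finset.sum_congr rfl fun j hj => ?_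
  have hx : Continuous (pdx (v.cellFun i j)) := (contDiff_pdx (n := 0) (hv i hi j hj)).continuous
  have hy : Continuous (pdy (v.cellFun i j)) := (contDiff_pdy (n := 0) (hv i hi j hj)).continuous
  simp only [cellDx, cellDy, RectPartition.cell]
  rw [setIntegral_prod_eq_rectInt (by fun_prop) (P.x_pred_lt hi).le (P.y_pred_lt hj).le,
    rectInt_add (by fun_prop) (by fun_prop), cellEnergy]

lemma brokenSemi_eq {r : ℕ} {u : PiecewiseFun P} (hu : CellSmooth P (r + 1) u) :
    brokenSemi P u (r + 1) = √(∑ i ∈ Finset.Icc 1 P.m, ∑ j ∈ Finset.Icc 1 P.n,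
      cellSemiSq r (P.x (i - 1)) (P.x i) (P.y (j - 1)) (P.y j) (u.cellFun i j)) := by
  rw [brokenSemi]
  congr 1
  refine Finset.sum_congr rfl fun i hi => Finset.sum_congr rfl fun j hj => ?_
  rw [cellSemiSq]
  refine Finset.sum_congr rfl fun t ht => ?_
  have ht' : t ≤ r + 1 := Nat.lt_succ_iff.1 (Finset.mem_range.1 ht)
  have hc : Continuous (pdx^[t] (pdy^[r + 1 - t] (u.cellFun i j))) :=
    (contDiff_iterate_pdx (n := 0) t (contDiff_iterate_pdy (n := 0 + t) (r + 1 - t)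
      ((hu i hi j hj).of_le (by norm_cast; omega)))).continuous
  exact setIntegral_prod_eq_rectInt (by fun_prop) (P.x_pred_lt hi).le (P.y_pred_lt hj).le

end seminorms

/-- An energy estimate for sums: local coercivity and local continuity give a global bound. -/
lemma sum_le_of_sum_mul_le {ι : Type*} {s : Finset ι} {κ F B D E : ι → ℝ} {α₀ α₁ K : ℝ}
    (hα₀ : 0 < α₀) (hK : 0 ≤ K) (hκ : ∀ q ∈ s, κ q ∈ Set.Icc α₀ α₁)
    (hD0 : ∀ q ∈ s, 0 ≤ D q) (hE0 : ∀ q ∈ s, 0 ≤ E q) (hD : ∀ q ∈ s, D q ≤ F q)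
    (hB : ∀ q ∈ s, |B q| ≤ K * (√(D q) * √(E q)))
    (hFB : ∑ q ∈ s, κ q * F q = ∑ q ∈ s, κ q * B q) :
    ∑ q ∈ s, D q ≤ (α₁ / α₀ * K) ^ 2 * ∑ q ∈ s, E q := by
  set SD := ∑ q ∈ s, D q with hSD
  set SE := ∑ q ∈ s, E q with hSE
  have hSD0 : 0 ≤ SD := Finset.sum_nonneg hD0
  have hSE0 : 0 ≤ SE := Finset.sum_nonneg hE0
  rcases s.eq_empty_or_nonempty with rfl | ⟨q₀, hq₀⟩
  · simp [hSD, hSE]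
  have hα₁ : 0 ≤ α₁ := hα₀.le.trans ((hκ q₀ hq₀).1.trans (hκ q₀ hq₀).2)
  have hlow : α₀ * SD ≤ ∑ q ∈ s, κ q * F q := by
    rw [hSD, Finset.mul_sum]
    exact Finset.sum_le_sum fun q hq => mul_le_mul (hκ q hq).1 (hD q hq) (hD0 q hq)
      (hα₀.le.trans (hκ q hq).1)
  have hup : ∑ q ∈ s, κ q * B q ≤ α₁ * K * (√SD * √SE) := by
    calc ∑ q ∈ s, κ q * B q ≤ ∑ q ∈ s, α₁ * K * (√(D q) * √(E q)) := by
          refine Finset.sum_le_sum fun q hq => ?_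
          rw [mul_assoc]
          have hκ0 : 0 ≤ κ q := hα₀.le.trans (hκ q hq).1
          exact (mul_le_mul_of_nonneg_left ((le_abs_self _).trans (hB q hq)) hκ0).trans
            (mul_le_mul_of_nonneg_right (hκ q hq).2 (by positivity))
      _ = α₁ * K * ∑ q ∈ s, √(D q) * √(E q) := (Finset.mul_sum _ _ _).symm
      _ ≤ α₁ * K * (√SD * √SE) := mul_le_mul_of_nonneg_left
          (by
            have h := Real.sum_mul_le_sqrt_mul_sqrt s (fun q => √(D q)) (fun q => √(E q))
            rwa [Finset.sum_congr rfl fun q hq => Real.sq_sqrt (hD0 q hq),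
              Finset.sum_congr rfl fun q hq => Real.sq_sqrt (hE0 q hq)] at h)
          (by positivity)
  have hle : √SD ≤ α₁ / α₀ * K * √SE := by
    rcases (Real.sqrt_nonneg SD).eq_or_lt with h0 | hpos
    · rw [← h0]
      positivity
    · refine le_of_mul_le_mul_left ?_ (mul_pos hα₀ hpos)
      calc α₀ * √SD * √SD = α₀ * SD := by rw [mul_assoc, Real.mul_self_sqrt hSD0]
        _ ≤ α₁ * K * (√SD * √SE) := (hlow.trans_eq hFB).trans hup
        _ = α₀ * √SD * (α₁ / α₀ * K * √SE) := by field_simp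
  calc SD = √SD ^ 2 := (Real.sq_sqrt hSD0).symm
    _ ≤ (α₁ / α₀ * K * √SE) ^ 2 := pow_le_pow_left₀ (Real.sqrt_nonneg _) hle 2
    _ = (α₁ / α₀ * K) ^ 2 * SE := by rw [mul_pow, Real.sq_sqrt hSE0]

/-- Optimal-order `H¹` error estimate for the finite volume method: there is
`C = C(r, σ) > 0` such that for every `σ`-quasi-uniform partition with mesh size
`h`, piecewise constant `0 < α₀ ≤ α ≤ α₁`, exact solution `u` (continuous,
vanishing on `∂Ω`, cellwise `C^{r+1}`, with continuous fluxes) and every finite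
volume solution `u_P`, `|u − u_P|₁ ≤ C (α₁/α₀) h^r |u|_{r+1,P}`. -/
theorem fvm_H1_error (r : ℕ) (hr : 1 ≤ r) (G : ℕ → ℝ) (hG : IsGaussPoints r G)
    (σ : ℝ) (hσ : 1 ≤ σ) :
    ∃ C : ℝ, 0 < C ∧
      ∀ (a b c d : ℝ), a < b → c < d →
      ∀ P : RectPartition a b c d, P.QuasiUniform σ →
      ∀ (α : ℝ × ℝ → ℝ) (α₀ α₁ : ℝ), 0 < α₀ → PiecewiseConstant P α →
        (∀ z ∈ P.dom, α₀ ≤ α z ∧ α z ≤ α₁) →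
      ∀ u : PiecewiseFun P, ContinuousOn u.toFun P.dom →
        (∀ z ∈ P.bdry, u.toFun z = 0) → CellSmooth P (r + 1) u →
        FluxContinuous P α u →
      ∀ uP : PiecewiseFun P, IsFVSolution r G P α u uP →
        semiH1 P (u.sub uP) ≤ C * (α₁ / α₀) * P.meshSize ^ r * brokenSemi P u (r + 1) := by
  have hσ0 : 0 ≤ σ := zero_le_one.trans hσ
  obtain ⟨A, hA⟩ := hG.exists_isGaussRule hr
  obtain ⟨K₁, hK₁, hT⟩ := exists_gaussTrace_sq_le hG hA hr
  obtain ⟨K₂, hK₂, hI⟩ := exists_integral_sq_sub_cellInterp_le hr hσ0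
  set K := 2 * ((r : ℝ) * (r + 1)) * √(K₁ * σ) with hK
  have hK0 : 0 ≤ K := by positivity
  refine ⟨√((4 + 2 * K ^ 2) * K₂), by positivity, ?_⟩
  intro a b c d _ _ P hP α α₀ α₁ hα₀ hpc hα u _ hu0 hu hflux uP ⟨⟨_, huP0, huPp⟩, hFV⟩
  obtain ⟨κ, hκ⟩ := exists_isCellValue hpc
  have hc : ∀ i j, ∃ c, i ∈ Finset.Icc 1 P.m → j ∈ Finset.Icc 1 P.n →
      (fun z => uP.cellFun i j z - P.interp r u i j z) = biPoly r c := by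
    intro i j
    by_cases hij : i ∈ Finset.Icc 1 P.m ∧ j ∈ Finset.Icc 1 P.n
    · obtain ⟨c₁, hc₁⟩ := (huPp i hij.1 j hij.2).exists_eq_biPoly
      obtain ⟨c₂, hc₂⟩ := exists_cellInterp_eq_biPoly hr (P.x_pred_lt hij.1) (P.y_pred_lt hij.2)
        (u.cellFun i j)
      refine ⟨fun a b => c₁ a b - c₂ a b, fun _ _ => ?_⟩
      rw [biPoly_sub, hc₁, RectPartition.interp, hc₂]
    · exact ⟨0, fun hi hj => absurd ⟨hi, hj⟩ hij⟩
  choose γ hγ using hc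
  have hX : P.ConformsX fun i j => biPoly r (γ i j) :=
    ((P.conformsX_cellFun huP0).sub (P.conformsX_interp hr (P.conformsX_cellFun hu0))).congr
      fun i hi j hj => (hγ i j hi hj).symm
  have hY : P.ConformsY fun i j => biPoly r (γ i j) :=
    ((P.conformsY_cellFun huP0).sub (P.conformsY_interp hr (P.conformsY_cellFun hu0))).congr
      fun i hi j hj => (hγ i j hi hj).symm
  set w := P.cellTrace r G A γ with hw
  have hwt : IsTestFun r P w := P.isTestFun_cellTrace hA hr hX hY
  set I := Finset.Icc 1 P.m ×ˢ Finset.Icc 1 P.n with hIdef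
  have hmem : ∀ q ∈ I, q.1 ∈ Finset.Icc 1 P.m ∧ q.2 ∈ Finset.Icc 1 P.n := fun q hq =>
    Finset.mem_product.1 hq
  have hx : ∀ q ∈ I, P.x (q.1 - 1) < P.x q.1 := fun q hq => P.x_pred_lt (hmem q hq).1
  have hy : ∀ q ∈ I, P.y (q.2 - 1) < P.y q.2 := fun q hq => P.y_pred_lt (hmem q hq).2
  set h := P.meshSize with hh
  have hsx : ∀ q ∈ I, P.x q.1 - P.x (q.1 - 1) ∈ P.sides := fun q hq =>
    P.sub_mem_sides_x (hmem q hq).1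
  have hsy : ∀ q ∈ I, P.y q.2 - P.y (q.2 - 1) ∈ P.sides := fun q hq =>
    P.sub_mem_sides_y (hmem q hq).2
  set S : ℕ × ℕ → ℝ := fun q =>
    cellSemiSq r (P.x (q.1 - 1)) (P.x q.1) (P.y (q.2 - 1)) (P.y q.2) (u.cellFun q.1 q.2) with hS
  set D : ℕ × ℕ → ℝ := fun q =>
    cellEnergy (P.x (q.1 - 1)) (P.x q.1) (P.y (q.2 - 1)) (P.y q.2)
      (biPoly r (γ q.1 q.2)) with hD
  set Φ : ℕ × ℕ → (ℝ × ℝ → ℝ) → (ℝ × ℝ → ℝ) → ℝ := fun q Dx Dy =>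
    cellForm r G (P.x (q.1 - 1)) (P.x q.1) (P.y (q.2 - 1)) (P.y q.2) Dx Dy
      (dualTrace r G A (P.x (q.1 - 1)) (P.x q.1) (P.y (q.2 - 1)) (P.y q.2) (γ q.1 q.2)) with hΦ
  have haP : ∀ v : PiecewiseFun P, aP r G P α (cellDx v) (cellDy v) w =
      ∑ q ∈ I, κ q.1 q.2 * Φ q (pdx (v.cellFun q.1 q.2)) (pdy (v.cellFun q.1 q.2)) := by
    intro v
    rw [aP_eq_sum_cellForm hG hr hκ hwt, hIdef, Finset.sum_product]
    refine Finset.sum_congr rfl fun i hi => Finset.sum_congr rfl fun j hj => ?_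
    simp only [hw, P.wE_cellTrace hA hr hX hY hi hj]
    rfl
  have hS0 : ∀ q ∈ I, 0 ≤ S q := fun q hq => cellSemiSq_nonneg (hx q hq).le (hy q hq).le
  have hinterp := fun q (hq : q ∈ I) => hI _ _ _ _ h (hx q hq) (hy q hq)
    (P.le_meshSize (hsx q hq)) (P.le_meshSize (hsy q hq)) (hP _ (hsy q hq) _ (hsx q hq))
    (hP _ (hsx q hq) _ (hsy q hq)) _ (hu _ (hmem q hq).1 _ (hmem q hq).2)
  have hsm : ∀ q ∈ I, ContDiff ℝ 1 (u.cellFun q.1 q.2) := fun q hq =>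
    (hu _ (hmem q hq).1 _ (hmem q hq).2).of_le (by norm_cast; omega)
  have hsmP : ∀ q ∈ I, ContDiff ℝ 1 (uP.cellFun q.1 q.2) := fun q hq => by
    obtain ⟨c₁, hc₁⟩ := (huPp _ (hmem q hq).1 _ (hmem q hq).2).exists_eq_biPoly
    rw [hc₁]
    exact contDiff_biPoly
  have hsmI : ∀ q : ℕ × ℕ, ContDiff ℝ 1 (P.interp r u q.1 q.2) := fun q => contDiff_cellInterp
  have hcx : ∀ {v : ℝ × ℝ → ℝ}, ContDiff ℝ 1 v → Continuous (pdx v) := fun hv =>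
    (contDiff_pdx (n := 0) (by exact_mod_cast hv)).continuous
  have hcy : ∀ {v : ℝ × ℝ → ℝ}, ContDiff ℝ 1 v → Continuous (pdy v) := fun hv =>
    (contDiff_pdy (n := 0) (by exact_mod_cast hv)).continuous
  have hDS : ∑ q ∈ I, D q ≤ (α₁ / α₀ * K) ^ 2 * ∑ q ∈ I, K₂ * (h ^ r) ^ 2 * S q := by
    refine sum_le_of_sum_mul_le (κ := fun q => κ q.1 q.2)
      (F := fun q => Φ q (pdx (biPoly r (γ q.1 q.2))) (pdy (biPoly r (γ q.1 q.2))))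
      (B := fun q => Φ q (fun z => pdx (u.cellFun q.1 q.2) z - pdx (P.interp r u q.1 q.2) z)
        (fun z => pdy (u.cellFun q.1 q.2) z - pdy (P.interp r u q.1 q.2) z)) hα₀ hK0
      (fun q hq => hκ.mem_Icc hα (hmem q hq).1 (hmem q hq).2)
      (fun q hq => cellEnergy_nonneg (hx q hq).le (hy q hq).le _)
      (fun q hq => mul_nonneg (by positivity) (hS0 q hq))
      (fun q hq => cellEnergy_le_cellForm hG hA hr (hx q hq) (hy q hq))
      (fun q hq => abs_cellForm_le hK₁.le hG hA hr hT (hx q hq) (hy q hq) hσ0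
        (hP _ (hsx q hq) _ (hsy q hq)) (hP _ (hsy q hq) _ (hsx q hq))
        (P.le_meshSize (hsx q hq)) (P.le_meshSize (hsy q hq))
        ((hcx (hsm q hq)).sub (hcx (hsmI q))) ((hcy (hsm q hq)).sub (hcy (hsmI q)))
        (hinterp q hq).1 (hinterp q hq).2) ?_
    have hgal := (hFV w hwt).trans (aP_eq_fvRHS hG hr hκ hwt hu hflux).symm
    rw [haP, haP] at hgal
    calc _ = ∑ q ∈ I, κ q.1 q.2 * Φ q (pdx (uP.cellFun q.1 q.2)) (pdy (uP.cellFun q.1 q.2)) -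
          ∑ q ∈ I, κ q.1 q.2 * Φ q (pdx (P.interp r u q.1 q.2)) (pdy (P.interp r u q.1 q.2)) := by
          rw [← Finset.sum_sub_distrib]
          refine Finset.sum_congr rfl fun q hq => ?_
          rw [← hγ _ _ (hmem q hq).1 (hmem q hq).2,
            pdx_sub ((hsmP q hq).differentiable one_ne_zero) ((hsmI q).differentiable one_ne_zero),
            pdy_sub ((hsmP q hq).differentiable one_ne_zero) ((hsmI q).differentiable one_ne_zero),
            ← mul_sub]
          congr 1
          exact cellForm_sub (hcx (hsmP q hq)) (hcx (hsmI q)) (hcy (hsmP q hq)) (hcy (hsmI q)) _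
      _ = _ := by
          rw [hgal, ← Finset.sum_sub_distrib]
          refine Finset.sum_congr rfl fun q hq => ?_
          rw [← mul_sub]
          congr 1
          exact (cellForm_sub (hcx (hsm q hq)) (hcx (hsmI q)) (hcy (hsm q hq))
            (hcy (hsmI q)) _).symm
  have hratio : 1 ≤ α₁ / α₀ := by
    have h11 := hκ.mem_Icc hα (Finset.mem_Icc.2 ⟨le_rfl, P.hm⟩) (Finset.mem_Icc.2 ⟨le_rfl, P.hn⟩)
    exact (one_le_div hα₀).2 (h11.1.trans h11.2)
  have hsub : CellSmooth P 1 (u.sub uP) := fun i hi j hj =>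
    (hsm (i, j) (Finset.mem_product.2 ⟨hi, hj⟩)).sub (hsmP (i, j) (Finset.mem_product.2 ⟨hi, hj⟩))
  have herr : ∑ i ∈ Finset.Icc 1 P.m, ∑ j ∈ Finset.Icc 1 P.n,
      cellEnergy (P.x (i - 1)) (P.x i) (P.y (j - 1)) (P.y j) ((u.sub uP).cellFun i j) ≤
      4 * ∑ q ∈ I, K₂ * (h ^ r) ^ 2 * S q + 2 * ∑ q ∈ I, D q := by
    rw [Finset.mul_sum, Finset.mul_sum, ← Finset.sum_add_distrib, hIdef, ← Finset.sum_product']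
    refine Finset.sum_le_sum fun q hq => ?_
    have hle := cellEnergy_sub_le (hsm q hq) (hsmP q hq) (hsmI q) (hx q hq) (hy q hq)
      (P.le_meshSize (hsx q hq)) (P.le_meshSize (hsy q hq)) (hinterp q hq).1 (hinterp q hq).2
    rwa [hγ _ _ (hmem q hq).1 (hmem q hq).2] at hle
  have hSS : ∑ q ∈ I, S q = ∑ i ∈ Finset.Icc 1 P.m, ∑ j ∈ Finset.Icc 1 P.n,
      cellSemiSq r (P.x (i - 1)) (P.x i) (P.y (j - 1)) (P.y j) (u.cellFun i j) :=
    Finset.sum_product _ _ _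
  have hSS0 : 0 ≤ ∑ q ∈ I, S q := Finset.sum_nonneg hS0
  have hh0 : 0 < h := P.meshSize_pos
  rw [semiH1_eq hsub, brokenSemi_eq hu, ← hSS]
  refine Real.sqrt_le_iff.2 ⟨by positivity, herr.trans ?_⟩
  rw [mul_pow, mul_pow, mul_pow, Real.sq_sqrt (by positivity), Real.sq_sqrt hSS0]
  rw [← Finset.mul_sum] at hDS ⊢
  have hsq : 1 ≤ (α₁ / α₀) ^ 2 := one_le_pow₀ hratio
  have hT0 : 0 ≤ K₂ * (h ^ r) ^ 2 * ∑ q ∈ I, S q := by positivity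
  nlinarith [mul_le_mul_of_nonneg_right hsq hT0]
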